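/- arXiv:math/0403422 — 2 statements merged into one kernel-verified Lean document; each statement's English description precedes it below -/
import Mathlib

section
/- There exists an absolute constant C > 0 such that for every odd prime p, one has |I_4(0,p−1) − p^7| ≤ C · p^{7 − 1/4} · (log p)^{3/2}; equivalently, I_4(0,p−1) = p^7 · (1 + O(p^{−1/4} (log p)^{3/2})). -/
namespace FactorialCongruence

open Polynomial Finset

section Stepanov

theorem pow_sub_dvd_hasseDeriv_pow {R : Type*} [CommRing R] (f : R[X]) (N s : ℕ) :
    f ^ (N - s) ∣ hasseDeriv s (f ^ N) := by
  induction N generalizing s with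
  | zero => simp
  | succ N ih =>
    rw [pow_succ', hasseDeriv_mul]
    refine Finset.dvd_sum fun ij hij => ?_
    rw [HasAntidiagonal.mem_antidiagonal] at hij
    rcases Nat.eq_zero_or_pos ij.1 with h0 | h0
    · rw [h0, hasseDeriv_zero']
      obtain rfl : ij.2 = s := by omega
      refine dvd_trans (pow_dvd_pow f (show N + 1 - ij.2 ≤ 1 + (N - ij.2) by omega)) ?_
      rw [pow_add, pow_one]
      exact mul_dvd_mul_left f (ih _)
    · exact dvd_mul_of_dvd_right
        ((pow_dvd_pow f (show N + 1 - s ≤ N - ij.2 by omega)).trans (ih _)) _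

theorem exists_hasseDeriv_pow_eq {R : Type*} [CommRing R] [IsDomain R] {f : R[X]} (hf : f.Monic)
    {N s : ℕ} (hs : s ≤ N) :
    ∃ G : R[X], hasseDeriv s (f ^ N) = f ^ (N - s) * G ∧ G.natDegree ≤ s * f.natDegree := by
  obtain ⟨G, hG⟩ := pow_sub_dvd_hasseDeriv_pow f N s
  refine ⟨G, hG, ?_⟩
  rcases eq_or_ne G 0 with rfl | hG0
  · simp
  have h := natDegree_hasseDeriv_le (f ^ N) s
  rw [hG, (hf.pow _).natDegree_mul' hG0, natDegree_pow, natDegree_pow] at h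
  obtain ⟨t, rfl⟩ := Nat.exists_eq_add_of_le hs
  rw [Nat.add_sub_cancel_left, add_mul] at h
  omega

theorem X_sub_C_pow_dvd_of_hasseDeriv {R : Type*} [CommRing R] {P : R[X]} {x : R} {l : ℕ}
    (h : ∀ s < l, (hasseDeriv s P).eval x = 0) : (X - C x) ^ l ∣ P := by
  have h1 : X ^ l ∣ taylor x P := by
    rw [X_pow_dvd_iff]
    intro s hs
    rw [taylor_coeff, h s hs]
  obtain ⟨Q, hQ⟩ := h1
  refine ⟨taylor (-x) Q, ?_⟩
  have h2 : taylor (-x) (taylor x P) = P := by simp [taylor_taylor]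
  rw [← h2, hQ, taylor_mul, taylor_pow, taylor_X, map_neg, sub_eq_add_neg]

theorem eq_zero_of_sum_X_pow_mul_eq_zero {K ι : Type*} [Field K] [Fintype ι] {φ : ι → ℕ}
    (hφ : Function.Injective φ) {h : ι → K[X]} (hh : ∀ i, (h i).coeff 0 ≠ 0) {v : ι → K}
    (hv : ∑ i, C (v i) * (X ^ φ i * h i) = 0) : v = 0 := by
  by_contra hne
  obtain ⟨i₁, hi₁⟩ := Function.ne_iff.mp hne
  obtain ⟨i₀, hi₀, hmin⟩ := Set.exists_min_image {i | v i ≠ 0} φ (Set.toFinite _) ⟨i₁, hi₁⟩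
  have h1 := congrArg (fun P => coeff P (φ i₀)) hv
  simp only [finsetSum_coeff, coeff_C_mul, coeff_X_pow_mul', coeff_zero] at h1
  rw [Finset.sum_eq_single i₀] at h1
  · simp only [le_refl, if_true, Nat.sub_self, mul_eq_zero] at h1
    exact h1.elim hi₀ (hh i₀)
  · intro i _ hi
    by_cases hvi : v i = 0
    · simp [hvi]
    · have := hmin i hvi
      have h3 : φ i ≠ φ i₀ := fun h => hi (hφ h)
      rw [if_neg (by omega), mul_zero]
  · simp

theorem card_mul_le_natDegree {K : Type*} [Field K] {P : K[X]} (hP : P ≠ 0) {l : ℕ}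
    (Z : Finset K) (h : ∀ x ∈ Z, (X - C x) ^ l ∣ P) : #Z * l ≤ P.natDegree := by
  have h1 : ∏ x ∈ Z, (X - C x) ^ l ∣ P := by
    refine Finset.prod_dvd_of_coprime ?_ h
    intro x _ y _ hxy
    exact (pairwise_coprime_X_sub_C Function.injective_id hxy).pow
  have h2 := natDegree_le_of_dvd h1 hP
  rw [natDegree_prod_of_monic _ _ fun x _ => (monic_X_sub_C x).pow l] at h2
  simpa using h2

theorem stepanov {K : Type*} [Field K] [Fintype K] [DecidableEq K] {q d e m l J : ℕ}
    (hq : Fintype.card K = q) (hde : q = d * e + 1) (he : 0 < e)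
    {f g : K[X]} (hf : f.Monic) (hfg : f = X * g) (hg : g.coeff 0 ≠ 0)
    (hm : f.natDegree = m) {c : K} (hlq : l ≤ q)
    (hlJ : l * (e + J + l * m) < d * J * e) :
    #{x : K | f.eval x ^ e = c} * l ≤ l * m + q * m + q * J := by
  classical
  have hG : ∀ (N s : ℕ), ∃ G : K[X], s ≤ N →
      (hasseDeriv s (f ^ N) = f ^ (N - s) * G ∧ G.natDegree ≤ s * f.natDegree) := by
    intro N s
    by_cases h : s ≤ N
    · obtain ⟨G, hG⟩ := exists_hasseDeriv_pow_eq hf h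
      exact ⟨G, fun _ => hG⟩
    · exact ⟨0, fun h' => absurd h' h⟩
  choose G hG using hG
  let Q : ℕ → ℕ → K[X] → K[X] := fun s i k =>
    ∑ ab ∈ antidiagonal s, hasseDeriv ab.1 k * f ^ ab.1 * G (l + e * i) ab.2
  have hQ : ∀ s ≤ l, ∀ i k, hasseDeriv s (k * f ^ (l + e * i)) = f ^ (l - s) * f ^ (e * i) * Q s i k := by
    intro s hs i k
    rw [hasseDeriv_mul, mul_sum]
    refine sum_congr rfl fun ab hab => ?_
    rw [HasAntidiagonal.mem_antidiagonal] at hab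
    rw [(hG (l + e * i) ab.2 (by omega)).1]
    have : l + e * i - ab.2 = (l - s) + e * i + ab.1 := by omega
    rw [this, pow_add, pow_add]
    ring
  let κ : (Fin d × Fin J × Fin e → K) → Fin d → Fin J → K[X] := fun v i j =>
    ∑ t : Fin e, C (v (i, j, t)) * X ^ (t : ℕ)
  have hκdeg : ∀ v i j, (κ v i j).natDegree ≤ e - 1 := by
    intro v i j
    refine natDegree_sum_le_of_forall_le _ _ fun t _ => ?_
    refine (natDegree_C_mul_X_pow_le _ _).trans ?_
    have := t.2
    omega
  let Ψ : (Fin d × Fin J × Fin e → K) → ℕ → K[X] := fun v s =>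
    ∑ i : Fin d, ∑ j : Fin J, C (c ^ (i : ℕ)) * X ^ (j : ℕ) * Q s i (κ v i j)
  have hΨdeg : ∀ v, ∀ s < l, (Ψ v s).natDegree < e + J + l * m := by
    intro v s hs
    have hsm : s * m ≤ l * m := Nat.mul_le_mul_right _ hs.le
    have : (Ψ v s).natDegree ≤ (e - 1) + J + l * m := by
      refine natDegree_sum_le_of_forall_le _ _ fun i _ => ?_
      refine natDegree_sum_le_of_forall_le _ _ fun j _ => ?_
      refine natDegree_mul_le.trans ?_
      have h1 := natDegree_C_mul_X_pow_le (c ^ (i : ℕ)) (j : ℕ)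
      have h2 : (Q s i (κ v i j)).natDegree ≤ (e - 1) + s * m := by
        refine natDegree_sum_le_of_forall_le _ _ fun ab hab => ?_
        rw [HasAntidiagonal.mem_antidiagonal] at hab
        refine natDegree_mul_le.trans ?_
        have h3 := (hG (l + e * i) ab.2 (by omega)).2
        have h4 : (hasseDeriv ab.1 (κ v i j) * f ^ ab.1).natDegree ≤ (e - 1) + ab.1 * m := by
          refine natDegree_mul_le.trans (add_le_add ?_ ?_)
          · exact (natDegree_hasseDeriv_le _ _).trans ((Nat.sub_le _ _).trans (hκdeg v i j))
          · rw [natDegree_pow, hm]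
        rw [hm] at h3
        rw [← hab, add_mul]
        omega
      have := j.2
      omega
    omega
  have hκadd : ∀ v w i j, κ (v + w) i j = κ v i j + κ w i j := by
    intro v w i j
    simp only [κ, ← sum_add_distrib, Pi.add_apply, map_add, add_mul]
  have hκsmul : ∀ (a : K) v i j, κ (a • v) i j = a • κ v i j := by
    intro a v i j
    simp only [κ, Pi.smul_apply, smul_eq_mul, map_mul, smul_sum, smul_eq_C_mul, mul_assoc]
  let T : (Fin d × Fin J × Fin e → K) →ₗ[K] (Fin l × Fin (e + J + l * m) → K) :=
    { toFun := fun v st => (Ψ v st.1).coeff st.2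
      map_add' := by
        intro v w
        ext st
        simp only [Pi.add_apply, ← coeff_add]
        congr 1
        simp only [Ψ, Q, hκadd, map_add, add_mul, sum_add_distrib, mul_add]
      map_smul' := by
        intro a v
        ext st
        simp only [Pi.smul_apply, RingHom.id_apply, ← coeff_smul]
        congr 1
        simp only [Ψ, Q, hκsmul, map_smul, ← smul_sum, smul_mul_assoc, mul_smul_comm] }
  have hker : LinearMap.ker T ≠ ⊥ := by
    refine LinearMap.ker_ne_bot_of_finrank_lt ?_
    simp only [Module.finrank_fintype_fun_eq_card, Fintype.card_prod, Fintype.card_fin]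
    rwa [← mul_assoc d J e]
  obtain ⟨v, hv, hv0⟩ := (Submodule.ne_bot_iff _).mp hker
  have hΨ0 : ∀ s < l, Ψ v s = 0 := by
    intro s hs
    ext t
    rw [coeff_zero]
    by_cases ht : t < e + J + l * m
    · have := congrFun (LinearMap.mem_ker.mp hv) (⟨s, hs⟩, ⟨t, ht⟩)
      exact this
    · exact coeff_eq_zero_of_natDegree_lt (lt_of_lt_of_le (hΨdeg v s hs) (not_lt.mp ht))
  let R : K[X] := ∑ i : Fin d, ∑ j : Fin J, κ v i j * f ^ (l + e * i) * X ^ (q * j)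
  have hR0 : R ≠ 0 := by
    intro hR
    apply hv0
    have hei : ∀ (i : Fin d) (t : Fin e), e * i + t < q := by
      intro i t
      have h1 : e * (i + 1) ≤ e * d := Nat.mul_le_mul_left _ i.2
      have := t.2
      rw [mul_add, mul_comm e d] at h1
      omega
    refine eq_zero_of_sum_X_pow_mul_eq_zero
      (φ := fun s : Fin d × Fin J × Fin e => q * s.2.1 + (e * s.1 + s.2.2))
      (h := fun s => g ^ (e * s.1)) ?_ ?_ ?_
    · rintro ⟨i, j, t⟩ ⟨i', j', t'⟩ h
      simp only at h
      have hj : (j : ℕ) = j' := by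
        have h1 := congrArg (· / q) h
        have hq0 : 0 < q := by omega
        simpa [Nat.mul_add_div hq0, Nat.div_eq_of_lt (hei _ _)] using h1
      rw [hj] at h
      have h := Nat.add_left_cancel h
      have hi : (i : ℕ) = i' := by
        have h1 := congrArg (· / e) h
        simpa [Nat.mul_add_div he, Nat.div_eq_of_lt (Fin.is_lt _)] using h1
      rw [hi] at h
      have h := Nat.add_left_cancel h
      simp [Fin.ext_iff, hi, hj, h]
    · intro s
      rw [coeff_zero_eq_eval_zero, eval_pow, ← coeff_zero_eq_eval_zero]
      exact pow_ne_zero _ hg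
    · have hfl : f ^ l ≠ 0 := pow_ne_zero _ hf.ne_zero
      refine (mul_eq_zero.mp ?_).resolve_left hfl
      rw [← hR, mul_sum, Fintype.sum_prod_type]
      refine sum_congr rfl fun i _ => ?_
      rw [Fintype.sum_prod_type]
      refine sum_congr rfl fun j _ => ?_
      simp only [κ, sum_mul]
      refine sum_congr rfl fun t _ => ?_
      have hfe : f ^ (l + e * i) = f ^ l * (X ^ (e * (i : ℕ)) * g ^ (e * (i : ℕ))) := by
        rw [pow_add, ← mul_pow, ← hfg]
      rw [hfe]
      ring
  have hRdeg : R.natDegree ≤ l * m + q * m + q * J := by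
    refine natDegree_sum_le_of_forall_le _ _ fun i _ => ?_
    refine natDegree_sum_le_of_forall_le _ _ fun j _ => ?_
    refine natDegree_mul_le.trans ?_
    have h1 : (κ v i j * f ^ (l + e * i)).natDegree ≤ (e - 1) + (l + e * i) * m := by
      refine natDegree_mul_le.trans (add_le_add (hκdeg v i j) ?_)
      rw [natDegree_pow, hm]
    have h2 : (X ^ (q * j) : K[X]).natDegree ≤ q * j := natDegree_X_pow_le _
    have h3 : e * i * m ≤ q * m := by
      refine Nat.mul_le_mul_right _ ?_
      have : e * i ≤ e * d := Nat.mul_le_mul_left _ i.2.le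
      rw [mul_comm e d] at this
      omega
    have h4 : q * (j + 1) ≤ q * J := Nat.mul_le_mul_left _ j.2
    have h5 : e ≤ q := by
      have : 1 * e ≤ d * e := Nat.mul_le_mul_right _ (by have := i.2; omega)
      omega
    rw [add_mul] at h1
    rw [mul_add] at h4
    omega
  refine (card_mul_le_natDegree hR0 _ fun x hx => ?_).trans hRdeg
  rw [mem_filter] at hx
  have hxf : f.eval x ^ e = c := hx.2
  let R' : K[X] := ∑ i : Fin d, ∑ j : Fin J, C (x ^ (j : ℕ)) * (κ v i j * f ^ (l + e * i))
  have hRR' : (X - C x) ^ l ∣ R - R' := by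
    simp only [R, R', ← sum_sub_distrib]
    refine dvd_sum fun i _ => dvd_sum fun j _ => ?_
    have h1 : κ v i j * f ^ (l + e * i) * X ^ (q * (j : ℕ)) -
        C (x ^ (j : ℕ)) * (κ v i j * f ^ (l + e * i)) =
        κ v i j * f ^ (l + e * i) * ((X ^ q) ^ (j : ℕ) - C x ^ (j : ℕ)) := by
      rw [pow_mul, map_pow]; ring
    rw [h1]
    refine dvd_mul_of_dvd_right (dvd_trans ?_ (sub_dvd_pow_sub_pow _ _ _)) _
    have h2 : (X ^ q - C x : K[X]) = (X - C x) ^ q := by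
      obtain ⟨p, hp⟩ := CharP.exists K
      have := hp
      obtain ⟨n, hpp, hn⟩ := FiniteField.card K p
      have : Fact p.Prime := ⟨hpp⟩
      have hqn : q = p ^ (n : ℕ) := by rw [← hq, hn]
      rw [hqn, sub_pow_char_pow, ← map_pow, ← hqn, ← hq, FiniteField.pow_card]
    rw [h2]
    exact pow_dvd_pow _ hlq
  rw [← sub_add_cancel R R']
  refine dvd_add hRR' (X_sub_C_pow_dvd_of_hasseDeriv fun s hs => ?_)
  have h1 : hasseDeriv s R' = f ^ (l - s) * ∑ i : Fin d, ∑ j : Fin J,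
      C (x ^ (j : ℕ)) * (f ^ (e * (i : ℕ)) * Q s i (κ v i j)) := by
    simp only [R', map_sum, mul_sum, ← smul_eq_C_mul, map_smul, hQ s hs.le, mul_smul_comm,
      mul_assoc]
  have h2 := congrArg (eval x) (hΨ0 s hs)
  simp only [Ψ, eval_finsetSum, eval_mul, eval_C, eval_pow, eval_X, eval_zero] at h2
  rw [h1, eval_mul, mul_eq_zero]
  right
  rw [← h2]
  simp only [eval_finsetSum, eval_mul, eval_C, eval_pow, pow_mul, hxf]
  exact sum_congr rfl fun i _ => sum_congr rfl fun j _ => by ring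

end Stepanov

section PowerSums

theorem mul_eval_derivative_le {a S : ℕ → ℂ} {m : ℕ} {C R ρ : ℝ} (hR : 0 ≤ R)
    (hC : 0 ≤ C) (hRρ : R * ρ < 1)
    (ham : ∀ n, m ≤ n → a n = 0) (hS : ∀ n, ‖S n‖ ≤ C * R ^ n)
    (hrec : ∀ n : ℕ, (n : ℂ) * a n = ∑ k ∈ range (n + 1), S k * a (n - k)) {z : ℂ} (hz : ‖z‖ ≤ ρ) :
    ‖z * (derivative (∑ i ∈ range m, Polynomial.C (a i) * X ^ i)).eval z‖ ≤
      C * (1 - R * ρ)⁻¹ * ‖(∑ i ∈ range m, Polynomial.C (a i) * X ^ i).eval z‖ := by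
  have hρ : 0 ≤ ρ := (norm_nonneg z).trans hz
  have hgeo := (hasSum_geometric_of_lt_one (mul_nonneg hR hρ) hRρ).mul_left C
  have hb : ∀ n, ‖S n * z ^ n‖ ≤ C * (R * ρ) ^ n := by
    intro n
    rw [norm_mul, norm_pow, mul_pow, ← mul_assoc]
    exact mul_le_mul (hS n) (pow_le_pow_left₀ (norm_nonneg _) hz n) (by positivity)
      (by positivity)
  have hf : Summable fun n => ‖S n * z ^ n‖ :=
    Summable.of_nonneg_of_le (fun _ => norm_nonneg _) hb hgeo.summable
  have hL : HasSum (fun n => a n * z ^ n) ((∑ i ∈ range m, Polynomial.C (a i) * X ^ i).eval z) := by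
    have : (∑ i ∈ range m, Polynomial.C (a i) * X ^ i).eval z = ∑ i ∈ range m, a i * z ^ i := by
      simp [eval_finsetSum]
    rw [this]
    refine hasSum_sum_of_ne_finset_zero fun i hi => ?_
    rw [ham i (by simpa using hi), zero_mul]
  have hg : Summable fun n => ‖a n * z ^ n‖ := by
    refine summable_of_ne_finset_zero (s := range m) fun i hi => ?_
    rw [ham i (by simpa using hi), zero_mul, norm_zero]
  have hprod := hasSum_sum_range_mul_of_summable_norm hf hg
  have hD : HasSum (fun n : ℕ => (n : ℂ) * a n * z ^ n)
      (z * (derivative (∑ i ∈ range m, Polynomial.C (a i) * X ^ i)).eval z) := by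
    have : z * (derivative (∑ i ∈ range m, Polynomial.C (a i) * X ^ i)).eval z =
        ∑ i ∈ range m, (i : ℂ) * a i * z ^ i := by
      simp only [derivative_sum, eval_finsetSum, mul_sum]
      refine sum_congr rfl fun i _ => ?_
      rcases i with _ | i
      · simp
      · rw [derivative_C_mul_X_pow]
        simp [pow_succ]
        ring
    rw [this]
    refine hasSum_sum_of_ne_finset_zero fun i hi => ?_
    rw [ham i (by simpa using hi), mul_zero, zero_mul]
  have heq : (fun n : ℕ => (n : ℂ) * a n * z ^ n) =
      fun n => ∑ k ∈ range (n + 1), S k * z ^ k * (a (n - k) * z ^ (n - k)) := by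
    ext n
    rw [hrec, sum_mul]
    refine sum_congr rfl fun k hk => ?_
    have : z ^ n = z ^ k * z ^ (n - k) := by
      rw [← pow_add]; congr 1; have := mem_range.mp hk; omega
    rw [this]; ring
  rw [heq] at hD
  rw [hD.unique hprod, hL.tsum_eq, norm_mul]
  exact mul_le_mul_of_nonneg_right (tsum_of_norm_bounded hgeo hb) (norm_nonneg _)

theorem one_le_mul_norm_of_root {a S : ℕ → ℂ} {m : ℕ} {C R : ℝ} (hR : 0 < R)
    (hC : 0 ≤ C) (ha0 : a 0 = 1) (hm : 0 < m)
    (ham : ∀ n, m ≤ n → a n = 0) (hS : ∀ n, ‖S n‖ ≤ C * R ^ n)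
    (hrec : ∀ n : ℕ, (n : ℂ) * a n = ∑ k ∈ range (n + 1), S k * a (n - k)) {w : ℂ}
    (hw : (∑ i ∈ range m, Polynomial.C (a i) * X ^ i).IsRoot w) : 1 ≤ R * ‖w‖ := by
  by_contra! hlt
  set L : ℂ[X] := ∑ i ∈ range m, Polynomial.C (a i) * X ^ i with hL
  have hL0 : L.eval 0 = 1 := by
    simp only [hL, eval_finsetSum, eval_mul, eval_C, eval_pow, eval_X]
    rw [sum_eq_single 0] <;> simp +contextual [ha0, hm]
  have hLne : L ≠ 0 := by rintro h; simp [h] at hL0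
  have hw0 : w ≠ 0 := by rintro rfl; rw [IsRoot, hL0] at hw; exact one_ne_zero hw
  obtain ⟨ρ, hρ1, hρ2⟩ : ∃ ρ, ‖w‖ < ρ ∧ ρ < 1 / R :=
    exists_between (by rwa [lt_div_iff₀ hR, mul_comm])
  have hRρ : R * ρ < 1 := by rwa [lt_div_iff₀ hR, mul_comm] at hρ2
  obtain ⟨M, hM, hMw⟩ := exists_eq_pow_rootMultiplicity_mul_and_not_dvd L hLne w
  rw [dvd_iff_isRoot, IsRoot] at hMw
  obtain ⟨k, hk⟩ : ∃ k, L.rootMultiplicity w = k + 1 :=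
    Nat.exists_eq_succ_of_ne_zero ((rootMultiplicity_pos hLne).mpr hw).ne'
  rw [hk] at hM
  set B := C * (1 - R * ρ)⁻¹
  have key : ∀ᶠ z in nhdsWithin w {w}ᶜ,
      ‖z * ((k + 1 : ℂ) * M.eval z + (z - w) * (derivative M).eval z)‖ ≤
        B * ‖(z - w) * M.eval z‖ := by
    have hball : ∀ᶠ z in nhdsWithin w {w}ᶜ, ‖z‖ < ρ :=
      nhdsWithin_le_nhds ((continuous_norm.tendsto w).eventually_lt_const hρ1)
    filter_upwards [hball, self_mem_nhdsWithin] with z hz hzw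
    have hzw' : z - w ≠ 0 := sub_ne_zero.mpr hzw
    have h := mul_eval_derivative_le hR.le hC hRρ ham hS hrec hz.le
    rw [← hL, hM] at h
    have h1 : z * (derivative ((X - Polynomial.C w) ^ (k + 1) * M)).eval z =
        (z - w) ^ k * (z * ((k + 1 : ℂ) * M.eval z + (z - w) * (derivative M).eval z)) := by
      simp [derivative_mul, derivative_X_sub_C_pow]
      ring
    have h2 : ((X - Polynomial.C w) ^ (k + 1) * M).eval z = (z - w) ^ k * ((z - w) * M.eval z) := by
      simp; ring
    rw [h1, h2, norm_mul, norm_mul ((z - w) ^ k), mul_left_comm] at h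
    exact le_of_mul_le_mul_left h (norm_pos_iff.mpr (pow_ne_zero _ hzw'))
  have hlim := le_of_tendsto_of_tendsto
    (f := fun z => ‖z * ((k + 1 : ℂ) * M.eval z + (z - w) * (derivative M).eval z)‖)
    (g := fun z => B * ‖(z - w) * M.eval z‖)
    (Continuous.tendsto (by fun_prop) w |>.mono_left nhdsWithin_le_nhds)
    (Continuous.tendsto (by fun_prop) w |>.mono_left nhdsWithin_le_nhds) key
  simp only [sub_self, zero_mul, add_zero, norm_zero, mul_zero] at hlim
  have := norm_le_zero_iff.mp hlim
  have hk1 : (k + 1 : ℂ) ≠ 0 := by exact_mod_cast k.succ_ne_zero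
  simp [hw0, hMw, hk1] at this

theorem norm_powerSum_one_le {a S : ℕ → ℂ} {m : ℕ} {C R : ℝ} (hR : 0 < R)
    (hC : 0 ≤ C) (ha0 : a 0 = 1) (hm : 0 < m)
    (ham : ∀ n, m ≤ n → a n = 0) (hS0 : S 0 = 0) (hS : ∀ n, ‖S n‖ ≤ C * R ^ n)
    (hrec : ∀ n : ℕ, (n : ℂ) * a n = ∑ k ∈ range (n + 1), S k * a (n - k)) :
    ‖S 1‖ ≤ (m - 1 : ℕ) * R := by
  set L : ℂ[X] := ∑ i ∈ range m, Polynomial.C (a i) * X ^ i with hL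
  have hcoeff : ∀ n, L.coeff n = a n := by
    intro n
    simp only [hL, finsetSum_coeff, coeff_C_mul_X_pow]
    rw [sum_ite_eq]
    split_ifs with h
    · rfl
    · exact (ham n (by simpa using h)).symm
  have hS1 : S 1 = a 1 := by
    have := hrec 1
    simpa [sum_range_succ, hS0, ha0] using this.symm
  have hL0 : L.eval 0 = 1 := by rw [← coeff_zero_eq_eval_zero, hcoeff, ha0]
  have hL1 : (derivative L).eval 0 = a 1 := by
    rw [← coeff_zero_eq_eval_zero, coeff_derivative, hcoeff]; simp
  have h := (IsAlgClosed.splits L).eval_derivative_div_eval_of_ne_zero (x := 0) (by simp [hL0])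
  rw [hL0, hL1, div_one] at h
  rw [hS1, h]
  refine (norm_multiset_sum_le _).trans ?_
  rw [Multiset.map_map]
  have hdeg : L.natDegree ≤ m - 1 := by
    rw [natDegree_le_iff_coeff_eq_zero]
    intro n hn
    rw [hcoeff, ham n (by omega)]
  have hcard : ((L.roots.card : ℕ) : ℝ) ≤ (m - 1 : ℕ) := by
    exact_mod_cast (card_roots' L).trans hdeg
  refine (Multiset.sum_le_card_nsmul _ R ?_).trans ?_
  · intro x hx
    obtain ⟨w, hw, rfl⟩ := Multiset.mem_map.mp hx
    have hwr := one_le_mul_norm_of_root hR hC ha0 hm ham hS hrec (isRoot_of_mem_roots hw)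
    have hw0 : 0 < ‖w‖ := by
      by_contra! hw0
      rw [le_antisymm hw0 (norm_nonneg w)] at hwr
      linarith
    simp only [Function.comp_apply, zero_sub, norm_div, norm_one, norm_neg]
    rwa [div_le_iff₀ hw0]
  · rw [Multiset.card_map, nsmul_eq_mul]
    exact mul_le_mul_of_nonneg_right hcard hR.le

end PowerSums

section EulerProduct

variable {F : Type*} [Field F] [Finite F]

theorem finite_monic_natDegree_le (n : ℕ) : {g : F[X] | g.Monic ∧ g.natDegree ≤ n}.Finite := by
  have : Finite (degreeLT F (n + 1)) := Finite.of_equiv _ (degreeLTEquiv F (n + 1)).toEquiv.symm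
  refine Set.Finite.subset (Set.toFinite (degreeLT F (n + 1) : Set F[X])) fun g hg => ?_
  rw [SetLike.mem_coe, mem_degreeLT]
  exact (degree_le_of_natDegree_le hg.2).trans_lt (by exact_mod_cast n.lt_succ_self)

variable (F) in
/-- The monic polynomials of degree `n`. -/
noncomputable def monics (n : ℕ) : Finset F[X] :=
  ((finite_monic_natDegree_le n).subset
    (show {g : F[X] | g.Monic ∧ g.natDegree = n} ⊆ _ from fun _ h => ⟨h.1, h.2.le⟩)).toFinset

variable (F) in
/-- The monic irreducible polynomials of degree at most `n`. -/
noncomputable def irreds (n : ℕ) : Finset F[X] :=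
  ((finite_monic_natDegree_le n).subset
    (show {g : F[X] | g.Monic ∧ g.natDegree ≤ n ∧ Irreducible g} ⊆ _ from
      fun _ h => ⟨h.1, h.2.1⟩)).toFinset

theorem mem_monics {n : ℕ} {g : F[X]} : g ∈ monics F n ↔ g.Monic ∧ g.natDegree = n := by
  simp [monics]

theorem mem_irreds {n : ℕ} {g : F[X]} :
    g ∈ irreds F n ↔ g.Monic ∧ g.natDegree ≤ n ∧ Irreducible g := by
  simp [irreds]

/-- The coefficients of the `L`-series `∑ w(g) T ^ deg g` over monic `g`. -/
noncomputable def lCoeff (w : F[X] →* ℂ) (n : ℕ) : ℂ := ∑ g ∈ monics F n, w g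

/-- The coefficients of the logarithmic derivative of the Euler product attached to `w`. -/
noncomputable def eulerPowerSum (w : F[X] →* ℂ) (n : ℕ) : ℂ :=
  ∑ P ∈ irreds F n with P.natDegree ∣ n, (P.natDegree : ℂ) * w P ^ (n / P.natDegree)

open UniqueFactorizationMonoid in
open scoped Classical in
theorem natDegree_eq_sum_irreds {n : ℕ} {g : F[X]} (hg : g ∈ monics F n) :
    n = ∑ P ∈ irreds F n, ∑ j ∈ Icc 1 n, if P ^ j ∣ g then P.natDegree else 0 := by
  obtain ⟨hgm, hgn⟩ := mem_monics.mp hg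
  have hg0 := hgm.ne_zero
  have hprod : (normalizedFactors g).prod = g := by
    have := prod_normalizedFactors_eq hg0
    rwa [hgm.normalize_eq_self] at this
  have hmonic : ∀ P ∈ normalizedFactors g, P.Monic := fun P hP =>
    (normalize_normalized_factor P hP) ▸ monic_normalize (irreducible_of_normalized_factor P hP).ne_zero
  have hsub : (normalizedFactors g).toFinset ⊆ irreds F n := by
    intro P hP
    rw [Multiset.mem_toFinset] at hP
    exact mem_irreds.mpr ⟨hmonic P hP, hgn ▸ natDegree_le_of_dvd (dvd_of_mem_normalizedFactors hP) hg0,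
      irreducible_of_normalized_factor P hP⟩
  have h1 : n = ∑ P ∈ irreds F n, (normalizedFactors g).count P * P.natDegree := by
    conv_lhs => rw [← hgn, ← hprod, natDegree_multiset_prod_of_monic _ hmonic,
      Finset.sum_multiset_map_count]
    simp only [smul_eq_mul]
    refine sum_subset hsub fun P _ hP => ?_
    rw [Multiset.mem_toFinset, ← Multiset.count_eq_zero] at hP
    rw [hP, zero_mul]
  conv_lhs => rw [h1]
  refine sum_congr rfl fun P hP => ?_
  obtain ⟨hPm, -, hPi⟩ := mem_irreds.mp hP
  rw [← sum_filter, sum_const, smul_eq_mul]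
  congr 1
  have hcount := emultiplicity_eq_count_normalizedFactors hPi hg0
  rw [hPm.normalize_eq_self] at hcount
  have hdvd : ∀ j, P ^ j ∣ g ↔ j ≤ (normalizedFactors g).count P := by
    intro j
    rw [pow_dvd_iff_le_emultiplicity, hcount, Nat.cast_le]
  have hle : (normalizedFactors g).count P ≤ n := by
    have h2 := natDegree_le_of_dvd ((hdvd _).mpr le_rfl) hg0
    rw [natDegree_pow, hgn] at h2
    exact (Nat.le_mul_of_pos_right _ hPi.natDegree_pos).trans h2
  have : {j ∈ Icc 1 n | P ^ j ∣ g} = Icc 1 ((normalizedFactors g).count P) := by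
    ext j
    simp only [mem_filter, mem_Icc, hdvd]
    omega
  rw [this, Nat.card_Icc, Nat.add_sub_cancel]

open scoped Classical in
theorem sum_monics_dvd (w : F[X] →* ℂ) {n : ℕ} {Q : F[X]} (hQ : Q.Monic) :
    (∑ g ∈ monics F n with Q ∣ g, w g) =
      if Q.natDegree ≤ n then w Q * lCoeff w (n - Q.natDegree) else 0 := by
  split_ifs with h
  · rw [lCoeff, mul_sum]
    symm
    refine sum_bij (fun h _ => Q * h) ?_ ?_ ?_ ?_
    · intro a ha
      obtain ⟨ham, han⟩ := mem_monics.mp ha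
      rw [mem_filter, mem_monics, hQ.natDegree_mul ham]
      exact ⟨⟨hQ.mul ham, by omega⟩, dvd_mul_right _ _⟩
    · intro a _ b _ hab
      exact mul_left_cancel₀ hQ.ne_zero hab
    · intro b hb
      obtain ⟨hb1, c, rfl⟩ := mem_filter.mp hb
      obtain ⟨hbm, hbn⟩ := mem_monics.mp hb1
      have hc := hQ.of_mul_monic_left hbm
      refine ⟨c, mem_monics.mpr ⟨hc, ?_⟩, rfl⟩
      rw [hQ.natDegree_mul hc] at hbn
      omega
    · intro a _
      rw [map_mul]
  · refine sum_eq_zero fun g hg => absurd ?_ h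
    obtain ⟨hg1, hg2⟩ := mem_filter.mp hg
    obtain ⟨hgm, hgn⟩ := mem_monics.mp hg1
    exact hgn ▸ natDegree_le_of_dvd hg2 hgm.ne_zero

theorem natCast_mul_lCoeff (w : F[X] →* ℂ) (n : ℕ) :
    (n : ℂ) * lCoeff w n = ∑ k ∈ range (n + 1), eulerPowerSum w k * lCoeff w (n - k) := by
  classical
  have hL : (n : ℂ) * lCoeff w n = ∑ P ∈ irreds F n, ∑ j ∈ Icc 1 n,
      if j * P.natDegree ≤ n then
        (P.natDegree : ℂ) * w P ^ j * lCoeff w (n - j * P.natDegree) else 0 := by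
    have h1 : (n : ℂ) * lCoeff w n = ∑ g ∈ monics F n, ∑ P ∈ irreds F n, ∑ j ∈ Icc 1 n,
        if P ^ j ∣ g then (P.natDegree : ℂ) * w g else 0 := by
      rw [lCoeff, mul_sum]
      refine sum_congr rfl fun g hg => ?_
      conv_lhs => rw [natDegree_eq_sum_irreds hg]
      push_cast
      simp only [sum_mul, ite_mul, zero_mul]
    rw [h1, sum_comm]
    refine sum_congr rfl fun P hP => ?_
    rw [sum_comm]
    refine sum_congr rfl fun j _ => ?_
    obtain ⟨hPm, -, -⟩ := mem_irreds.mp hP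
    rw [← sum_filter, ← mul_sum, sum_monics_dvd w (hPm.pow j), natDegree_pow, map_pow]
    split_ifs <;> ring
  have hR : ∑ k ∈ range (n + 1), eulerPowerSum w k * lCoeff w (n - k) =
      ∑ P ∈ irreds F n, ∑ k ∈ range (n + 1), if P.natDegree ≤ k ∧ P.natDegree ∣ k then
        (P.natDegree : ℂ) * w P ^ (k / P.natDegree) * lCoeff w (n - k) else 0 := by
    rw [sum_comm]
    refine sum_congr rfl fun k hk => ?_
    rw [← sum_filter, eulerPowerSum, sum_mul]
    refine sum_congr ?_ fun _ _ => rfl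
    ext P
    have := mem_range.mp hk
    simp only [mem_filter, mem_irreds]
    constructor
    · rintro ⟨⟨h1, h2, h3⟩, h4⟩
      exact ⟨⟨h1, by omega, h3⟩, h2, h4⟩
    · rintro ⟨⟨h1, h2, h3⟩, h4, h5⟩
      exact ⟨⟨h1, h4, h3⟩, h5⟩
  rw [hL, hR]
  refine sum_congr rfl fun P hP => ?_
  obtain ⟨-, -, hPi⟩ := mem_irreds.mp hP
  have hd := hPi.natDegree_pos
  rw [← sum_filter, ← sum_filter]
  refine sum_bij (fun j _ => j * P.natDegree) ?_ ?_ ?_ ?_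
  · intro j hj
    simp only [mem_filter, mem_Icc, mem_range] at hj ⊢
    exact ⟨by omega, Nat.le_mul_of_pos_left _ (by omega), dvd_mul_left _ _⟩
  · intro a _ b _ hab
    exact Nat.eq_of_mul_eq_mul_right hd hab
  · intro k hk
    simp only [mem_filter, mem_range] at hk
    obtain ⟨hkn, hle, j, rfl⟩ := hk
    refine ⟨j, ?_, mul_comm _ _⟩
    simp only [mem_filter, mem_Icc]
    have h1 : 0 < j := Nat.pos_of_ne_zero (by rintro rfl; omega)
    have h2 : j ≤ P.natDegree * j := Nat.le_mul_of_pos_left _ hd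
    rw [mul_comm j]
    omega
  · intro j _
    rw [Nat.mul_div_cancel _ hd]

end EulerProduct

section CharacterWeight

theorem norm_algebraMap_sub {F K : Type*} [Field F] [Field K] [Algebra F K] [FiniteDimensional F K]
    (a : F) (x : K) :
    Algebra.norm F (algebraMap F K a - x) =
      (minpoly F x).eval a ^ (Module.finrank F K / (minpoly F x).natDegree) := by
  have hxint : IsIntegral F (x - algebraMap F K a) := Algebra.IsIntegral.isIntegral _
  have h1 := Algebra.norm_eq_norm_adjoin F (x - algebraMap F K a)
  have h2 := Algebra.PowerBasis.norm_gen_eq_coeff_zero_minpoly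
    (IntermediateField.adjoin.powerBasis hxint)
  have h3 : Module.finrank F (IntermediateField.adjoin F {x - algebraMap F K a}) =
      (minpoly F x).natDegree := by
    rw [IntermediateField.adjoin.finrank hxint, minpoly.sub_algebraMap, natDegree_comp,
      natDegree_X_add_C, mul_one]
  have h4 := Module.finrank_mul_finrank F
    (IntermediateField.adjoin F {x - algebraMap F K a}) K
  rw [IntermediateField.adjoin.powerBasis_gen, IntermediateField.minpoly_gen,
    minpoly.sub_algebraMap, ← (IntermediateField.adjoin.powerBasis hxint).finrank, h3,
    coeff_zero_eq_eval_zero, eval_comp] at h2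
  rw [h3] at h4
  have hpos : 0 < (minpoly F x).natDegree :=
    minpoly.natDegree_pos (Algebra.IsIntegral.isIntegral x)
  have h5 : algebraMap F K a - x = algebraMap F K (-1) * (x - algebraMap F K a) := by
    simp
  rw [h5, map_mul, Algebra.norm_algebraMap, h1, h2, ← h4, Nat.mul_div_cancel_left _ hpos,
    mul_pow, ← pow_mul, ← mul_assoc, ← mul_pow]
  simp

theorem card_minpoly_eq {F K : Type*} [Field F] [Field K] [Algebra F K] [Finite F] [Fintype K]
    [DecidableEq F[X]] {P : F[X]}
    (hP : P.Monic) (hPi : Irreducible P) (hdvd : P.natDegree ∣ Module.finrank F K) :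
    #{x : K | minpoly F x = P} = P.natDegree := by
  classical
  have hfd : FiniteDimensional F K := Module.Finite.of_finite
  have hsplit : (P.map (algebraMap F K)).Splits := by
    have := Fintype.ofFinite F
    refine (FiniteField.isSplittingField_sub K F).splits.of_dvd ?_ ?_
    · exact map_ne_zero (FiniteField.X_pow_card_sub_X_ne_zero _ Fintype.one_lt_card)
    · rw [Module.card_eq_pow_finrank (K := F) (V := K), ← Nat.card_eq_fintype_card]
      exact (map_dvd_map' _).mpr (hPi.natDegree_dvd_iff_dvd_X_pow_card_pow_sub_X.mp hdvd)
  have hsep : P.Separable := PerfectField.separable_of_irreducible hPi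
  rw [← card_rootSet_eq_natDegree hsep hsplit, ← Set.toFinset_card]
  congr 1
  ext x
  simp only [mem_filter, mem_univ, true_and, Set.mem_toFinset, mem_rootSet]
  constructor
  · rintro rfl
    exact ⟨hP.ne_zero, minpoly.aeval _ _⟩
  · rintro ⟨-, h⟩
    exact (minpoly.eq_of_irreducible_of_monic hPi h hP).symm

variable {F : Type*} [Field F]

/-- The completely multiplicative weight `g ↦ χ (∏ α ∈ A, g(α))` on polynomials. -/
noncomputable def charWeight (χ : MulChar F ℂ) (A : Finset F) : F[X] →* ℂ where
  toFun g := χ (∏ α ∈ A, g.eval α)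
  map_one' := by simp
  map_mul' g h := by simp [prod_mul_distrib]

theorem charWeight_apply (χ : MulChar F ℂ) (A : Finset F) (g : F[X]) :
    charWeight χ A g = χ (∏ α ∈ A, g.eval α) := rfl

theorem lCoeff_charWeight_zero [Finite F] (χ : MulChar F ℂ) (A : Finset F) :
    lCoeff (charWeight χ A) 0 = 1 := by
  have : monics F 0 = {1} := by
    ext g
    rw [mem_monics, mem_singleton]
    constructor
    · rintro ⟨h1, h2⟩
      exact h1.natDegree_eq_zero.mp h2
    · rintro rfl
      exact ⟨monic_one, natDegree_one⟩
  rw [lCoeff, this, sum_singleton, map_one]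

theorem lCoeff_charWeight_eq_zero [Finite F] {χ : MulChar F ℂ} (hχ : χ ≠ 1) {A : Finset F}
    (hA : A.Nonempty) {n : ℕ} (hn : #A ≤ n) : lCoeff (charWeight χ A) n = 0 := by
  classical
  obtain ⟨u, hu⟩ := MulChar.ne_one_iff.mp hχ
  obtain ⟨α, hα⟩ := hA
  let B : F[X] := Lagrange.basis A id α
  have hBdeg : B.degree < n := by
    rw [Lagrange.degree_basis (Set.injOn_id _) hα]
    have : 0 < #A := card_pos.mpr ⟨α, hα⟩
    exact_mod_cast (by omega : #A - 1 < n)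
  have hBα : B.eval α = 1 := Lagrange.eval_basis_self (v := id) (Set.injOn_id _) hα
  have hBβ : ∀ β ∈ A, β ≠ α → B.eval β = 0 := fun β hβ hne =>
    Lagrange.eval_basis_of_ne (v := id) hne.symm hβ
  let T : F → F[X] → F[X] := fun t g => g + C ((t - 1) * g.eval α) * B
  have hTmem : ∀ t, ∀ g ∈ monics F n, T t g ∈ monics F n := by
    intro t g hg
    obtain ⟨hgm, hgn⟩ := mem_monics.mp hg
    have hd : (C ((t - 1) * g.eval α) * B).degree < g.degree := by
      rw [degree_eq_natDegree hgm.ne_zero, hgn]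
      rw [← smul_eq_C_mul]
      exact (degree_smul_le _ _).trans_lt hBdeg
    exact mem_monics.mpr ⟨hgm.add_of_left hd, (natDegree_add_eq_left_of_degree_lt hd).trans hgn⟩
  have hTα : ∀ t g, (T t g).eval α = t * g.eval α := by
    intro t g
    simp [T, hBα]
    ring
  have hTT : ∀ t s g, t * s = 1 → T t (T s g) = g := by
    intro t s g hts
    simp only [T] at hTα ⊢
    rw [hTα, add_assoc, ← add_mul, ← C_add]
    have : (s - 1) * eval α g + (t - 1) * (s * eval α g) = 0 := by linear_combination eval α g * hts
    rw [this]; simp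
  have hw : ∀ g, charWeight χ A (T u g) = χ u * charWeight χ A g := by
    intro g
    rw [charWeight_apply, charWeight_apply, ← map_mul, ← mul_prod_erase A _ hα,
      ← mul_prod_erase A (fun β => g.eval β) hα, hTα, mul_assoc]
    congr 3
    refine prod_congr rfl fun β hβ => ?_
    obtain ⟨hne, hβA⟩ := mem_erase.mp hβ
    simp [T, hBβ β hβA hne]
  have key : lCoeff (charWeight χ A) n = χ u * lCoeff (charWeight χ A) n := by
    conv_rhs => rw [lCoeff, mul_sum]
    rw [lCoeff]
    symm
    refine sum_nbij' (T u) (T (u⁻¹ : Fˣ)) (hTmem _) (hTmem _) ?_ ?_ ?_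
    · intro g _; exact hTT _ _ _ (by simp)
    · intro g _; exact hTT _ _ _ (by simp)
    · intro g _; exact (hw g).symm
  have : (1 - χ u) * lCoeff (charWeight χ A) n = 0 := by linear_combination key
  exact (mul_eq_zero.mp this).resolve_left (sub_ne_zero.mpr hu.symm)

theorem eulerPowerSum_charWeight [Finite F] {K : Type*} [Field K] [Fintype K] [Algebra F K]
    (χ : MulChar F ℂ) (A : Finset F) :
    eulerPowerSum (charWeight χ A) (Module.finrank F K) =
      ∑ x : K, χ (Algebra.norm F (∏ α ∈ A, (algebraMap F K α - x))) := by
  classical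
  have hfd : FiniteDimensional F K := Module.Finite.of_finite
  set n := Module.finrank F K with hn
  have hmaps : ∀ x ∈ (univ : Finset K),
      minpoly F x ∈ {P ∈ irreds F n | P.natDegree ∣ n} := by
    intro x _
    have hx : IsIntegral F x := Algebra.IsIntegral.isIntegral x
    rw [mem_filter, mem_irreds]
    exact ⟨⟨minpoly.monic hx, minpoly.natDegree_le x, minpoly.irreducible hx⟩,
      minpoly.degree_dvd hx⟩
  rw [← sum_fiberwise_of_maps_to hmaps, eulerPowerSum]
  refine sum_congr rfl fun P hP => ?_
  obtain ⟨hP1, hPd⟩ := mem_filter.mp hP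
  obtain ⟨hPm, -, hPi⟩ := mem_irreds.mp hP1
  trans ((#{x : K | minpoly F x = P} : ℕ) : ℂ) * charWeight χ A P ^ (n / P.natDegree)
  · rw [card_minpoly_eq hPm hPi hPd]
  rw [← nsmul_eq_mul, ← sum_const]
  refine sum_congr rfl fun x hx => ?_
  obtain rfl := (mem_filter.mp hx).2
  rw [charWeight_apply, ← map_pow, ← prod_pow]
  congr 1
  rw [map_prod]
  simp only [norm_algebraMap_sub, hn]

theorem eulerPowerSum_zero [Finite F] (w : F[X] →* ℂ) : eulerPowerSum w 0 = 0 := by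
  refine sum_eq_zero fun P hP => ?_
  obtain ⟨-, h, hPi⟩ := mem_irreds.mp (mem_filter.mp hP).1
  exact absurd hPi.natDegree_pos (by omega)

end CharacterWeight

section NormFibers

theorem le_div_add_mul_of_mul_le {N l m q J d c s : ℝ} (hl : 0 < l) (hm : 0 ≤ m) (hc : 0 ≤ c)
    (hs : 1 ≤ s) (hsq : s * s = q) (hsJ : s ≤ J) (hJl : J ≤ 2 * l) (hd : 1 ≤ d)
    (hlc : l + c = d * J) (h : N * l ≤ l * m + q * m + q * J) :
    N ≤ q / d + (2 * c + 3 * m) * s := by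
  refine le_of_mul_le_mul_right (h.trans ?_) hl
  have hq : q ≤ 2 * (s * l) := by nlinarith
  have hq0 : 0 ≤ q := by nlinarith
  have h1 : q * J = q / d * l + q / d * c := by
    rw [← mul_add, hlc]; field_simp
  have h2 : q / d * c ≤ 2 * (s * l) * c :=
    mul_le_mul_of_nonneg_right ((div_le_self hq0 hd).trans hq) hc
  have h3 : q * m ≤ 2 * (s * l) * m := mul_le_mul_of_nonneg_right hq hm
  have h4 : l * m ≤ s * (l * m) := le_mul_of_one_le_left (by positivity) hs
  rw [h1]
  linarith

theorem card_eval_pow_eq_le {K : Type*} [Field K] [Fintype K] [DecidableEq K] {Q d e n m : ℕ}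
    (hn : n ≠ 0) (hq : Fintype.card K = Q ^ n) (hQ : Q = d + 1) (hd : 0 < d)
    (hde : Q ^ n = d * e + 1)
    {f g : K[X]} (hf : f.Monic) (hfg : f = X * g) (hg : g.coeff 0 ≠ 0)
    (hm : f.natDegree = m) (c : K) :
    (#{x : K | f.eval x ^ e = c} : ℝ) ≤ (Q : ℝ) ^ n / d +
      (2 * ((Q : ℝ) ^ 3 * (d + d ^ 2 * m) + 1) + 3 * m) * √((Q : ℝ) ^ n) := by
  set C₁ : ℕ := Q ^ 3 * (d + d ^ 2 * m) + 1 with hC₁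
  set J : ℕ := Q ^ (n / 2 + 1) with hJ
  set q : ℕ := Q ^ n with hqdef
  have hQ1 : 1 ≤ Q := by omega
  have hC₁r : (Q : ℝ) ^ 3 * (d + d ^ 2 * m) + 1 = (C₁ : ℝ) := by rw [hC₁]; push_cast; rfl
  have hqr : (Q : ℝ) ^ n = (q : ℝ) := by rw [hqdef]; push_cast; rfl
  rw [hC₁r, hqr]
  have hq1 : 1 ≤ q := Nat.one_le_pow _ _ hQ1
  have hqJ : q ≤ J ^ 2 := by
    rw [hJ, ← pow_mul]
    exact Nat.pow_le_pow_right hQ1 (by omega)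
  have hJq : J ^ 2 ≤ Q ^ 2 * q := by
    rw [hJ, ← pow_mul, hqdef, ← pow_add]
    exact Nat.pow_le_pow_right hQ1 (by omega)
  have hQq : Q ≤ q := Nat.le_self_pow hn Q
  have he : 0 < e := by
    rcases Nat.eq_zero_or_pos e with rfl | h
    · omega
    · exact h
  have hqe : q ≤ Q * e := by
    have : d ≤ d * e := by omega
    have : 1 ≤ e := he
    rw [hQ, add_mul]; omega
  set s := √(q : ℝ) with hs
  have hss : s * s = q := Real.mul_self_sqrt (by positivity)
  have hs1 : 1 ≤ s := Real.one_le_sqrt.mpr (by exact_mod_cast hq1)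
  have hsJ : s ≤ J :=
    Real.sqrt_le_iff.mpr ⟨by positivity, by exact_mod_cast hqJ⟩
  rcases le_or_gt J (2 * C₁) with hsmall | hbig
  · have h1 : (#{x : K | f.eval x ^ e = c} : ℝ) ≤ q := by
      rw [← hq]; exact_mod_cast card_le_univ _
    have h2 : (J : ℝ) ≤ 2 * C₁ := by exact_mod_cast hsmall
    have h3 : (q : ℝ) ≤ 2 * C₁ * s := by
      rw [← hss]; exact mul_le_mul_of_nonneg_right (hsJ.trans h2) (by positivity)
    have h4 : 0 ≤ (q : ℝ) / d := by positivity
    have h5 : 0 ≤ 3 * (m : ℝ) * s := by positivity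
    rw [add_mul]
    linarith
  · have hdJ : J ≤ d * J := Nat.le_mul_of_pos_left _ hd
    obtain ⟨l, hl⟩ : ∃ l, l + C₁ = d * J := ⟨d * J - C₁, by omega⟩
    have hJs : (J : ℝ) ≤ Q * s := by
      refine le_of_sq_le_sq ?_ (by positivity)
      rw [mul_pow, sq s, hss]; exact_mod_cast hJq
    have hlq : l ≤ q := by
      have h1 : (Q : ℝ) ^ 3 ≤ C₁ := by
        rw [← hC₁r]
        have : (1 : ℝ) ≤ d := by exact_mod_cast hd
        have : (1 : ℝ) ≤ d + d ^ 2 * m := le_add_of_le_of_nonneg this (by positivity)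
        nlinarith [pow_pos (by exact_mod_cast hQ1 : (0 : ℝ) < Q) 3]
      have h2 : 2 * (C₁ : ℝ) < J := by exact_mod_cast hbig
      have hQ0 : (0 : ℝ) < Q := by exact_mod_cast hQ1
      have h3 : (Q : ℝ) ^ 2 ≤ s := by
        refine le_of_mul_le_mul_left ?_ hQ0
        nlinarith
      have h4 : (d : ℝ) ≤ Q := by rw [hQ]; push_cast; linarith
      have h5 : (d : ℝ) * J ≤ q := by
        calc (d : ℝ) * J ≤ Q * (Q * s) := by gcongr
          _ = Q ^ 2 * s := by ring
          _ ≤ s * s := by gcongr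
          _ = q := hss
      have h6 : d * J ≤ q := by exact_mod_cast h5
      omega
    have hJl : J ≤ 2 * l := by omega
    have hlJ : l * (e + J + l * m) < d * J * e := by
      have h1 : l ≤ d * J := by omega
      have h2 : l * (J + l * m) ≤ (d + d ^ 2 * m) * J ^ 2 := by
        calc l * (J + l * m) ≤ d * J * (J + d * J * m) := by gcongr
          _ = _ := by ring
      have h3 : (d + d ^ 2 * m) * J ^ 2 ≤ Q ^ 3 * (d + d ^ 2 * m) * e := by
        calc (d + d ^ 2 * m) * J ^ 2 ≤ (d + d ^ 2 * m) * (Q ^ 2 * (Q * e)) := by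
              gcongr; exact hJq.trans (by gcongr)
          _ = _ := by ring
      have h4 : C₁ * e = Q ^ 3 * (d + d ^ 2 * m) * e + e := by rw [hC₁]; ring
      calc l * (e + J + l * m) = l * e + l * (J + l * m) := by ring
        _ < l * e + C₁ * e := by omega
        _ = d * J * e := by rw [← add_mul, hl]
    have hst := stepanov hq hde he hf hfg hg hm (c := c) hlq hlJ
    have hl0 : 0 < l := by omega
    exact le_div_add_mul_of_mul_le (l := l) (J := J) (by exact_mod_cast hl0) (by positivity)
      (by positivity) hs1 hss hsJ (by exact_mod_cast hJl) (by exact_mod_cast hd)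
      (by exact_mod_cast hl) (by exact_mod_cast hst)

end NormFibers

section WeilBound

theorem norm_mulChar_le_one {F : Type*} [Field F] [Finite F] (χ : MulChar F ℂ) (a : F) :
    ‖χ a‖ ≤ 1 := by
  have := Fintype.ofFinite Fˣ
  rcases eq_or_ne a 0 with rfl | ha
  · rw [MulChar.map_zero, norm_zero]; exact zero_le_one
  · exact (Complex.norm_eq_one_of_mem_rootsOfUnity
      (χ.apply_mem_rootsOfUnity (Units.mk0 a ha))).le

theorem exists_norm_sum_mulChar_norm_le {F : Type} [Field F] [Fintype F] {χ : MulChar F ℂ}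
    (hχ : χ ≠ 1) {A : Finset F} (hA : 0 ∈ A) :
    ∃ C : ℝ, 0 ≤ C ∧ ∀ (K : Type) [Field K] [Fintype K] [Algebra F K],
      ‖∑ x : K, χ (Algebra.norm F (∏ α ∈ A, (algebraMap F K α - x)))‖ ≤
        C * √(Fintype.card K : ℝ) := by
  classical
  set Q := Fintype.card F with hQ
  obtain ⟨d, hd⟩ : ∃ d, Q = d + 1 := ⟨Q - 1, by have := Fintype.card_pos (α := F); omega⟩
  have hd0 : 0 < d := by have := Fintype.one_lt_card (α := F); omega
  set m := #A with hm
  set B : ℝ := 2 * ((Q : ℝ) ^ 3 * (d + d ^ 2 * m) + 1) + 3 * m with hB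
  have hB0 : 0 ≤ B := by positivity
  refine ⟨d * B + m, by positivity, fun K _ _ _ => ?_⟩
  have hfd : FiniteDimensional F K := Module.Finite.of_finite
  set n := Module.finrank F K with hn
  have hn0 : n ≠ 0 := Module.finrank_pos.ne'
  have hq : Fintype.card K = Q ^ n := Module.card_eq_pow_finrank
  have hdvd : d ∣ Q ^ n - 1 := by
    have := Nat.sub_dvd_pow_sub_pow Q 1 n
    rwa [one_pow, hd, Nat.add_sub_cancel, ← hd] at this
  obtain ⟨e, he⟩ := hdvd
  have hq1 : 1 ≤ Q ^ n := Nat.one_le_pow _ _ (by omega)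
  have hde : Q ^ n = d * e + 1 := by omega
  set f : K[X] := ∏ α ∈ A, (X + C (algebraMap F K α)) with hf
  have hfm : f.Monic := monic_prod_of_monic _ _ fun α _ => monic_X_add_C _
  have hfdeg : f.natDegree = m := by
    rw [hf, natDegree_prod_of_monic _ _ fun α _ => monic_X_add_C _]
    simp [hm]
  have hfg : f = X * ∏ α ∈ A.erase 0, (X + C (algebraMap F K α)) := by
    rw [hf, ← mul_prod_erase A _ hA]; simp
  have hg : (∏ α ∈ A.erase 0, (X + C (algebraMap F K α))).coeff 0 ≠ 0 := by
    rw [coeff_zero_eq_eval_zero, eval_prod, prod_ne_zero_iff]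
    intro α hα
    simpa using ne_of_mem_erase hα
  have hnorm : ∀ y : K, algebraMap F K (Algebra.norm F y) = y ^ e := by
    intro y
    rw [FiniteField.algebraMap_norm_eq_pow, Nat.card_eq_fintype_card, Nat.card_eq_fintype_card,
      hq, ← hQ, hde, hd]
    congr 1
    rw [Nat.add_sub_cancel, Nat.add_sub_cancel, Nat.mul_div_cancel_left _ hd0]
  have hreindex : ∑ x : K, χ (Algebra.norm F (∏ α ∈ A, (algebraMap F K α - x))) =
      ∑ x : K, χ (Algebra.norm F (f.eval x)) := by
    refine Fintype.sum_equiv (Equiv.neg K) _ _ fun x => ?_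
    congr 2
    rw [hf, eval_prod]
    refine prod_congr rfl fun α _ => ?_
    simp [sub_eq_neg_add]
  set N : F → ℕ := fun c => #{x : K | Algebra.norm F (f.eval x) = c} with hN
  set s := √((Q : ℝ) ^ n) with hs
  set T : ℝ := (Q : ℝ) ^ n / d + B * s with hT
  have hNle : ∀ c, (N c : ℝ) ≤ T := by
    intro c
    have := card_eval_pow_eq_le hn0 hq hd hd0 hde hfm hfg hg hfdeg (algebraMap F K c)
    refine le_trans (le_of_eq ?_) this
    simp only [hN, ← hnorm, (algebraMap F K).injective.eq_iff]
  have hN0 : N 0 ≤ m := by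
    rw [← hfdeg]
    refine le_trans (card_le_card ?_) (f.roots.toFinset_card_le.trans f.card_roots')
    intro x hx
    simp only [mem_filter, mem_univ, true_and, Algebra.norm_eq_zero_iff] at hx
    simp [hfm.ne_zero, hx]
  have hNsum : ∑ c, (N c : ℝ) = (Q : ℝ) ^ n := by
    have : ∑ c, N c = Fintype.card K :=
      (card_eq_sum_card_fiberwise (s := (univ : Finset K)) (t := univ) fun _ _ => by simp).symm
    rw [hq] at this
    exact_mod_cast this
  have hsum : ∑ x : K, χ (Algebra.norm F (f.eval x)) = ∑ c : F, χ c * ((N c : ℂ) - T) := by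
    have h1 : ∑ c : F, χ c * ((N c : ℂ) - T) = ∑ c : F, χ c * (N c : ℂ) := by
      simp only [mul_sub, sum_sub_distrib, ← sum_mul, MulChar.sum_eq_zero_of_ne_one hχ, zero_mul,
        sub_zero]
    rw [h1, ← sum_fiberwise_of_maps_to (s := (univ : Finset K)) (t := (univ : Finset F))
      (g := fun x => Algebra.norm F (f.eval x)) fun _ _ => mem_univ _]
    refine sum_congr rfl fun c _ => ?_
    rw [sum_congr rfl fun x hx => by rw [(mem_filter.mp hx).2], sum_const, nsmul_eq_mul, mul_comm]
  have hdc : ((univ.erase (0 : F)).card : ℝ) = d := by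
    rw [card_erase_of_mem (mem_univ _), card_univ, ← hQ, hd, Nat.add_sub_cancel]
  have hs1 : 1 ≤ s := Real.one_le_sqrt.mpr (by exact_mod_cast hq1)
  rw [hreindex, hsum, hq, Nat.cast_pow, ← hs, ← add_sum_erase _ _ (mem_univ (0 : F)),
    MulChar.map_zero, zero_mul, zero_add]
  calc ‖∑ c ∈ univ.erase (0 : F), χ c * ((N c : ℂ) - T)‖
      ≤ ∑ c ∈ univ.erase (0 : F), (T - N c) := by
        refine norm_sum_le_of_le _ fun c hc => ?_
        have h2 : ‖((N c : ℂ) - T)‖ = T - N c := by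
          have : ((N c : ℂ) - T) = ((N c - T : ℝ) : ℂ) := by push_cast; rfl
          rw [this, Complex.norm_real, Real.norm_eq_abs, abs_sub_comm, abs_of_nonneg]
          linarith [hNle c]
        rw [norm_mul, h2]
        exact mul_le_of_le_one_left (by linarith [hNle c]) (norm_mulChar_le_one χ c)
    _ = d * T - (Q ^ n - N 0) := by
        rw [sum_sub_distrib, sum_const, nsmul_eq_mul, hdc, ← hNsum,
          ← add_sum_erase _ _ (mem_univ (0 : F))]
        ring
    _ = d * B * s + N 0 := by
        rw [hT]; field_simp; ring
    _ ≤ d * B * s + m * s := by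
        have : (N 0 : ℝ) ≤ m := by exact_mod_cast hN0
        nlinarith [(Nat.cast_nonneg m : (0:ℝ) ≤ m)]
    _ = (d * B + m) * s := by ring

/-- The Weil bound for multiplicative character sums with squarefree argument. -/
theorem norm_sum_mulChar_prod_le {p : ℕ} [Fact p.Prime] {χ : MulChar (ZMod p) ℂ} (hχ : χ ≠ 1)
    {A : Finset (ZMod p)} (hA : 0 ∈ A) :
    ‖∑ x : ZMod p, χ (∏ α ∈ A, (x + α))‖ ≤ (#A - 1 : ℕ) * √(p : ℝ) := by
  obtain ⟨C, hC, hbound⟩ := exists_norm_sum_mulChar_norm_le hχ hA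
  have hp0 : (0 : ℝ) < p := by exact_mod_cast (Fact.out : p.Prime).pos
  have hS : ∀ n, ‖eulerPowerSum (charWeight χ A) n‖ ≤ C * √(p : ℝ) ^ n := by
    intro n
    rcases Nat.eq_zero_or_pos n with rfl | hn
    · rw [eulerPowerSum_zero, norm_zero]; positivity
    have := Fintype.ofFinite (GaloisField p n)
    have h := hbound (GaloisField p n)
    rw [← eulerPowerSum_charWeight, GaloisField.finrank p hn.ne', ← Nat.card_eq_fintype_card,
      GaloisField.card p n hn.ne', Nat.cast_pow, Real.sqrt_eq_rpow, ← Real.rpow_natCast,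
      ← Real.rpow_mul hp0.le, mul_comm (n : ℝ), Real.rpow_mul hp0.le, ← Real.sqrt_eq_rpow,
      Real.rpow_natCast] at h
    exact h
  have h1 := norm_powerSum_one_le (Real.sqrt_pos.mpr hp0) hC (lCoeff_charWeight_zero χ A)
    (card_pos.mpr ⟨0, hA⟩) (fun n hn => lCoeff_charWeight_eq_zero hχ ⟨0, hA⟩ hn)
    (eulerPowerSum_zero _) hS (natCast_mul_lCoeff _)
  have h2 := eulerPowerSum_charWeight (K := ZMod p) χ A
  rw [Module.finrank_self] at h2
  rw [h2] at h1
  convert h1 using 2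
  refine Fintype.sum_equiv (Equiv.neg (ZMod p)) _ _ fun x => ?_
  simp [Algebra.norm_self, add_comm]

end WeilBound

section CharacterSumFactorials

variable {p : ℕ}

/-- The product `(x + 1) (x + 2) ⋯ (x + k)`. -/
def risingProd (x : ZMod p) (k : ℕ) : ZMod p := ∏ i ∈ range k, (x + 1 + i)

theorem risingProd_add (x : ZMod p) (k r : ℕ) :
    risingProd x (k + r) = risingProd x k * risingProd (x + (k : ZMod p)) r := by
  rw [risingProd, prod_range_add]
  congr 1
  refine prod_congr rfl fun i _ => ?_
  push_cast; ring

theorem cast_factorial_add (n k : ℕ) :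
    (((n + k).factorial : ℕ) : ZMod p) = (n.factorial : ZMod p) * risingProd (n : ZMod p) k := by
  induction k with
  | zero => simp [risingProd]
  | succ k ih =>
    rw [← add_assoc, Nat.factorial_succ, Nat.cast_mul, ih, risingProd, risingProd,
      prod_range_succ]
    push_cast; ring

theorem sum_range_natCast [NeZero p] {M : Type*} [AddCommMonoid M] (g : ZMod p → M) :
    ∑ n ∈ range p, g (n : ZMod p) = ∑ x : ZMod p, g x := by
  refine sum_nbij' (fun n => (n : ZMod p)) ZMod.val (fun _ _ => mem_univ _)
    (fun x _ => mem_range.mpr x.val_lt) (fun n hn => ?_) (fun x _ => ?_) (fun _ _ => rfl)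
  · exact ZMod.val_cast_of_lt (mem_range.mp hn)
  · exact ZMod.natCast_zmod_val x

variable [Fact p.Prime]

theorem card_risingProd_eq_zero_le (k : ℕ) : #{x : ZMod p | risingProd x k = 0} ≤ k := by
  calc #{x : ZMod p | risingProd x k = 0} ≤ #((range k).image fun i : ℕ => -(1 + (i : ZMod p))) := by
        refine card_le_card fun x hx => ?_
        obtain ⟨i, hi, h⟩ := prod_eq_zero_iff.mp (mem_filter.mp hx).2
        exact mem_image.mpr ⟨i, hi, by linear_combination -h⟩
    _ ≤ k := card_image_le.trans (card_range k).le

theorem norm_sum_mulChar_risingProd_le {χ : MulChar (ZMod p) ℂ} (hχ : χ ≠ 1) {r : ℕ} (hr : 0 < r)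
    (hrp : r ≤ p) : ‖∑ x : ZMod p, χ (risingProd x r)‖ ≤ r * √(p : ℝ) := by
  have hinj : Set.InjOn (fun i : ℕ => (i : ZMod p)) (range r) := by
    intro i hi j hj hij
    rw [coe_range, Set.mem_Iio] at hi hj
    have := congrArg ZMod.val hij
    rwa [ZMod.val_cast_of_lt (by omega), ZMod.val_cast_of_lt (by omega)] at this
  have h := norm_sum_mulChar_prod_le hχ (A := (range r).image fun i : ℕ => (i : ZMod p))
    (mem_image.mpr ⟨0, mem_range.mpr hr, by simp⟩)
  rw [card_image_of_injOn hinj, card_range] at h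
  have h2 : ∑ x : ZMod p, χ (risingProd x r) =
      ∑ x : ZMod p, χ (∏ α ∈ (range r).image fun i : ℕ => (i : ZMod p), (x + α)) := by
    refine Fintype.sum_equiv (Equiv.addRight 1) _ _ fun x => ?_
    rw [prod_image hinj]
    rfl
  rw [h2]
  refine h.trans (mul_le_mul_of_nonneg_right ?_ (by positivity))
  exact_mod_cast Nat.sub_le r 1

theorem norm_mulChar_eq_one (χ : MulChar (ZMod p) ℂ) {a : ZMod p} (ha : a ≠ 0) : ‖χ a‖ = 1 :=
  DirichletCharacter.unit_norm_eq_one χ (Units.mk0 a ha)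

theorem norm_sum_mulChar_mul_conj_le_of_lt {χ : MulChar (ZMod p) ℂ} (hχ : χ ≠ 1) {k l K : ℕ}
    (hkl : k < l) (hl : l ≤ K) (hK : K ≤ p) :
    ‖∑ x : ZMod p, χ (risingProd x l) * (starRingEnd ℂ) (χ (risingProd x k))‖ ≤
      2 * K * √(p : ℝ) := by
  obtain ⟨r, rfl⟩ : ∃ r, l = k + r := ⟨l - k, by omega⟩
  have hs1 : 1 ≤ √(p : ℝ) :=
    Real.one_le_sqrt.mpr (by exact_mod_cast (Fact.out : p.Prime).one_lt.le)
  have hterm : ∀ x : ZMod p, χ (risingProd x (k + r)) * (starRingEnd ℂ) (χ (risingProd x k)) =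
      χ (risingProd (x + k) r) - if risingProd x k = 0 then χ (risingProd (x + k) r) else 0 := by
    intro x
    rw [risingProd_add, map_mul]
    split_ifs with h
    · simp [h, MulChar.map_zero]
    · have h2 : χ (risingProd x k) * (starRingEnd ℂ) (χ (risingProd x k)) = 1 := by
        rw [Complex.mul_conj, Complex.normSq_eq_norm_sq, norm_mulChar_eq_one χ h]; simp
      linear_combination χ (risingProd (x + k) r) * h2
  have hshift : ∑ x : ZMod p, χ (risingProd (x + k) r) = ∑ x : ZMod p, χ (risingProd x r) :=
    Fintype.sum_equiv (Equiv.addRight (k : ZMod p)) _ _ fun x => rfl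
  rw [sum_congr rfl fun x _ => hterm x, sum_sub_distrib, hshift, ← sum_filter]
  have h1 := norm_sum_mulChar_risingProd_le hχ (r := r) (by omega) (by omega)
  have h2 : ‖∑ x : ZMod p with risingProd x k = 0, χ (risingProd (x + k) r)‖ ≤ k := by
    refine (norm_sum_le_of_le _ fun x _ => norm_mulChar_le_one χ _).trans ?_
    rw [sum_const, nsmul_eq_mul, mul_one]
    exact_mod_cast card_risingProd_eq_zero_le k
  have h3 : (k : ℝ) ≤ K := by exact_mod_cast (by omega : k ≤ K)
  have h4 : (r : ℝ) ≤ K := by exact_mod_cast (by omega : r ≤ K)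
  calc _ ≤ r * √(p : ℝ) + k := (norm_sub_le _ _).trans (add_le_add h1 h2)
    _ ≤ K * √(p : ℝ) + K * √(p : ℝ) := by
      refine add_le_add (by gcongr) (h3.trans (le_mul_of_one_le_right (by positivity) hs1))
    _ = _ := by ring

theorem norm_sum_mulChar_mul_conj_le {χ : MulChar (ZMod p) ℂ} (hχ : χ ≠ 1) {k l K : ℕ}
    (hkl : k ≠ l) (hk : k ≤ K) (hl : l ≤ K) (hK : K ≤ p) :
    ‖∑ x : ZMod p, χ (risingProd x l) * (starRingEnd ℂ) (χ (risingProd x k))‖ ≤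
      2 * K * √(p : ℝ) := by
  rcases lt_or_gt_of_ne hkl with h | h
  · exact norm_sum_mulChar_mul_conj_le_of_lt hχ h hl hK
  · rw [← Complex.norm_conj, map_sum]
    simp only [map_mul, Complex.conj_conj]
    simp only [mul_comm ((starRingEnd ℂ) _)]
    exact norm_sum_mulChar_mul_conj_le_of_lt hχ h hk hK

theorem sum_norm_sq_sum_risingProd_le {χ : MulChar (ZMod p) ℂ} (hχ : χ ≠ 1) {K : ℕ} (hK : K ≤ p) :
    ∑ x : ZMod p, ‖∑ k ∈ range K, χ (risingProd x k)‖ ^ 2 ≤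
      K * p + 2 * K ^ 3 * √(p : ℝ) := by
  have hexp : ((∑ x : ZMod p, ‖∑ k ∈ range K, χ (risingProd x k)‖ ^ 2 : ℝ) : ℂ) =
      ∑ l ∈ range K, ∑ k ∈ range K,
        ∑ x : ZMod p, χ (risingProd x l) * (starRingEnd ℂ) (χ (risingProd x k)) := by
    push_cast
    rw [sum_congr rfl fun l _ => sum_comm, sum_comm]
    refine sum_congr rfl fun x _ => ?_
    rw [← Complex.mul_conj', map_sum, sum_mul_sum]
  have hterm : ∀ l ∈ range K, ∀ k ∈ range K,
      ‖∑ x : ZMod p, χ (risingProd x l) * (starRingEnd ℂ) (χ (risingProd x k))‖ ≤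
        (if l = k then (p : ℝ) else 0) + 2 * K * √(p : ℝ) := by
    intro l hl k hk
    rw [mem_range] at hl hk
    split_ifs with h
    · refine (norm_sum_le_of_le (f := fun x : ZMod p => χ (risingProd x l) *
        (starRingEnd ℂ) (χ (risingProd x k))) (n := fun _ => 1) _ fun x _ => ?_).trans ?_
      · rw [norm_mul, Complex.norm_conj]
        exact mul_le_one₀ (norm_mulChar_le_one χ _) (norm_nonneg _) (norm_mulChar_le_one χ _)
      · rw [sum_const, card_univ, ZMod.card, nsmul_eq_mul, mul_one]
        exact le_add_of_nonneg_right (by positivity)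
    · rw [zero_add]
      exact norm_sum_mulChar_mul_conj_le hχ (Ne.symm h) hk.le hl.le hK
  have hnn : 0 ≤ ∑ x : ZMod p, ‖∑ k ∈ range K, χ (risingProd x k)‖ ^ 2 := by positivity
  calc ∑ x : ZMod p, ‖∑ k ∈ range K, χ (risingProd x k)‖ ^ 2
      = ‖((∑ x : ZMod p, ‖∑ k ∈ range K, χ (risingProd x k)‖ ^ 2 : ℝ) : ℂ)‖ := by
        rw [Complex.norm_real, Real.norm_of_nonneg hnn]
    _ ≤ ∑ l ∈ range K, ∑ k ∈ range K, ((if l = k then (p : ℝ) else 0) + 2 * K * √(p : ℝ)) := by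
        rw [hexp]
        exact norm_sum_le_of_le _ fun l hl => norm_sum_le_of_le _ fun k hk => hterm l hl k hk
    _ = K * p + 2 * K ^ 3 * √(p : ℝ) := by
        have : ∀ l ∈ range K, ∑ k ∈ range K, ((if l = k then (p : ℝ) else 0) + 2 * K * √(p : ℝ)) =
            p + K * (2 * K * √(p : ℝ)) := by
          intro l hl
          rw [sum_add_distrib, sum_ite_eq, if_pos hl, sum_const, card_range, nsmul_eq_mul]
        rw [sum_congr rfl this, sum_const, card_range, nsmul_eq_mul]
        ring

theorem natCast_mul_sum_mulChar_factorial (χ : MulChar (ZMod p) ℂ) (K : ℕ) :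
    (K : ℂ) * ∑ n ∈ range p, χ (n.factorial : ZMod p) =
      ∑ k ∈ range K, ∑ n ∈ range k, χ (n.factorial : ZMod p) +
        ∑ n ∈ range p, χ (n.factorial : ZMod p) *
          ∑ k ∈ range K, χ (risingProd (n : ZMod p) k) := by
  have hz : ∀ j, χ (((p + j).factorial : ℕ) : ZMod p) = 0 := by
    intro j
    have : (((p + j).factorial : ℕ) : ZMod p) = 0 :=
      (ZMod.natCast_eq_zero_iff _ _).mpr
        (Nat.dvd_factorial (Fact.out : p.Prime).pos (Nat.le_add_right _ _))
    rw [this, MulChar.map_zero]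
  have hk : ∀ k, ∑ n ∈ range p, χ (n.factorial : ZMod p) = ∑ n ∈ range k, χ (n.factorial : ZMod p)
      + ∑ n ∈ range p, χ (n.factorial : ZMod p) * χ (risingProd (n : ZMod p) k) := by
    intro k
    have h1 := sum_range_add (fun n => χ (n.factorial : ZMod p)) k p
    rw [add_comm k p, sum_range_add, sum_congr rfl fun j _ => hz j, sum_const_zero, add_zero] at h1
    rw [h1]
    congr 1
    refine sum_congr rfl fun n _ => ?_
    rw [add_comm k n, cast_factorial_add, map_mul]
  simp only [mul_sum]
  rw [sum_comm (s := range p) (t := range K), ← sum_add_distrib, ← mul_sum,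
    sum_congr rfl fun k _ => (hk k).symm, sum_const, card_range, nsmul_eq_mul]

theorem norm_sum_mulChar_factorial_sq_le {χ : MulChar (ZMod p) ℂ} (hχ : χ ≠ 1) {t : ℝ}
    (ht : 1 ≤ t) (htp : t ^ 4 = p) :
    ‖∑ n ∈ Icc 1 (p - 1), χ (n.factorial : ZMod p)‖ ^ 2 ≤ 42 * t ^ 7 := by
  set K := ⌈t⌉₊ with hKdef
  have ht0 : 0 < t := by linarith
  have htK : t ≤ K := Nat.le_ceil t
  have hK2 : (K : ℝ) ≤ 2 * t := by
    have := Nat.ceil_lt_add_one ht0.le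
    linarith
  have hK1 : (1 : ℝ) ≤ K := ht.trans htK
  have hKp : K ≤ p := by
    refine Nat.ceil_le.mpr ?_
    rw [← htp]
    exact le_self_pow₀ ht (by norm_num)
  have hsqrt : √(p : ℝ) = t ^ 2 := by
    rw [← htp, Real.sqrt_eq_iff_mul_self_eq (by positivity) (by positivity)]; ring
  set S := ∑ n ∈ range p, χ (n.factorial : ZMod p) with hS
  set W : ZMod p → ℂ := fun x => ∑ k ∈ range K, χ (risingProd x k) with hW
  have hWsum : ∑ x, ‖W x‖ ^ 2 ≤ 3 * K ^ 3 * t ^ 2 := by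
    refine (sum_norm_sq_sum_risingProd_le hχ hKp).trans ?_
    rw [hsqrt, ← htp]
    have : t ^ 2 ≤ (K : ℝ) ^ 2 := by gcongr
    nlinarith [mul_le_mul_of_nonneg_left this (by positivity : 0 ≤ (K : ℝ) * t ^ 2)]
  have hcs : (∑ x, ‖W x‖) ^ 2 ≤ 3 * K ^ 3 * t ^ 6 := by
    have h := sq_sum_le_card_mul_sum_sq (s := (univ : Finset (ZMod p))) (f := fun x => ‖W x‖)
    rw [card_univ, ZMod.card, ← htp] at h
    calc _ ≤ _ := h
      _ ≤ t ^ 4 * (3 * K ^ 3 * t ^ 2) := by gcongr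
      _ = _ := by ring
  have hKS : K * ‖S‖ ≤ K ^ 2 + ∑ x, ‖W x‖ := by
    have h := natCast_mul_sum_mulChar_factorial χ K
    have h1 : (K : ℝ) * ‖S‖ = ‖(K : ℂ) * S‖ := by rw [norm_mul, Complex.norm_natCast]
    rw [h1, h]
    refine (norm_add_le _ _).trans (add_le_add ?_ ?_)
    · refine (norm_sum_le_of_le (n := fun _ => (K : ℝ)) _ fun k hk => ?_).trans ?_
      · refine (norm_sum_le_of_le (n := fun _ => (1 : ℝ)) _
          fun n _ => norm_mulChar_le_one χ _).trans ?_
        rw [sum_const, card_range, nsmul_eq_mul, mul_one]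
        exact_mod_cast (mem_range.mp hk).le
      · rw [sum_const, card_range, nsmul_eq_mul, sq]
    · rw [← sum_range_natCast fun x => ‖W x‖]
      refine norm_sum_le_of_le _ fun n _ => ?_
      rw [norm_mul]
      exact mul_le_of_le_one_left (norm_nonneg _) (norm_mulChar_le_one χ _)
  have hS2 : ‖S‖ ^ 2 ≤ 20 * t ^ 7 := by
    have h1 : (K * ‖S‖) ^ 2 ≤ K ^ 2 * (2 * K ^ 2 + 6 * K * t ^ 6) := by
      calc (K * ‖S‖) ^ 2 ≤ (K ^ 2 + ∑ x, ‖W x‖) ^ 2 := by gcongr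
        _ ≤ 2 * (((K : ℝ) ^ 2) ^ 2 + (∑ x, ‖W x‖) ^ 2) := add_sq_le
        _ ≤ 2 * (((K : ℝ) ^ 2) ^ 2 + 3 * K ^ 3 * t ^ 6) := by gcongr
        _ = _ := by ring
    rw [mul_pow] at h1
    have h2 := le_of_mul_le_mul_left h1 (by positivity)
    have h3 : t ^ 2 ≤ t ^ 7 := pow_le_pow_right₀ ht (by norm_num)
    calc ‖S‖ ^ 2 ≤ 2 * K ^ 2 + 6 * K * t ^ 6 := h2
      _ ≤ 2 * (2 * t) ^ 2 + 6 * (2 * t) * t ^ 6 := by gcongr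
      _ = 8 * t ^ 2 + 12 * t ^ 7 := by ring
      _ ≤ 20 * t ^ 7 := by linarith
  have hSS : ∑ n ∈ Icc 1 (p - 1), χ (n.factorial : ZMod p) = S - 1 := by
    have h1 : range p = insert 0 (Icc 1 (p - 1)) := by
      have := (Fact.out : p.Prime).pos
      ext n; simp only [mem_range, mem_insert, mem_Icc]; omega
    rw [hS, h1, sum_insert (by simp)]
    simp
  rw [hSS]
  calc ‖S - 1‖ ^ 2 ≤ (‖S‖ + ‖(1 : ℂ)‖) ^ 2 := by gcongr; exact norm_sub_le _ _
    _ ≤ 2 * (‖S‖ ^ 2 + ‖(1 : ℂ)‖ ^ 2) := add_sq_le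
    _ ≤ 42 * t ^ 7 := by
      have : 1 ≤ t ^ 7 := one_le_pow₀ ht
      rw [norm_one]; linarith

end CharacterSumFactorials

section Coincidences

theorem card_filter_apply_eq_apply {ι α : Type*} [DecidableEq α] {s : Finset ι} {t : Finset α}
    {f : ι → α} (hf : ∀ x ∈ s, f x ∈ t) :
    #{z ∈ s ×ˢ s | f z.1 = f z.2} = ∑ a ∈ t, #{x ∈ s | f x = a} ^ 2 := by
  rw [card_eq_sum_card_fiberwise (f := fun z => f z.1) (t := t)]
  · refine sum_congr rfl fun a _ => ?_
    rw [sq, ← card_product]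
    congr 1
    ext z
    simp only [mem_filter, mem_product]
    constructor
    · rintro ⟨⟨⟨h1, h2⟩, h3⟩, h4⟩
      exact ⟨⟨h1, h4⟩, h2, h3 ▸ h4⟩
    · rintro ⟨⟨h1, h4⟩, h2, h3⟩
      exact ⟨⟨⟨h1, h2⟩, h4.trans h3.symm⟩, h4⟩
  · intro z hz
    exact hf _ (mem_product.mp (mem_filter.mp hz).1).1

theorem card_filter_apply_eq_apply_le_mul {ι α : Type*} [DecidableEq α] {s : Finset ι}
    (f : ι → α) {b : ι → ℕ} {B : ℕ} (hb : ∀ x ∈ s, b x < B) :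
    #{z ∈ s ×ˢ s | f z.1 = f z.2} ≤
      B * #{z ∈ s ×ˢ s | f z.1 = f z.2 ∧ b z.1 = b z.2} := by
  have h1 := card_filter_apply_eq_apply (f := f) (t := s.image f)
    fun x hx => mem_image_of_mem f hx
  have h2 := card_filter_apply_eq_apply (f := fun x => (f x, b x)) (t := s.image f ×ˢ range B)
    fun x hx => mem_product.mpr ⟨mem_image_of_mem f hx, mem_range.mpr (hb x hx)⟩
  simp only [Prod.mk.injEq] at h2
  rw [h1, h2, sum_product, mul_sum]
  refine sum_le_sum fun a _ => ?_
  have h3 : #{x ∈ s | f x = a} = ∑ j ∈ range B, #{x ∈ s | f x = a ∧ b x = j} := by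
    rw [card_eq_sum_card_fiberwise (f := b) (t := range B)]
    · simp only [filter_filter]
    · intro x hx
      exact mem_coe.mpr (mem_range.mpr (hb x (mem_filter.mp hx).1))
  rw [h3]
  have := sq_sum_le_card_mul_sum_sq (s := range B) (f := fun j => #{x ∈ s | f x = a ∧ b x = j})
  simpa only [card_range, Prod.mk.injEq, Nat.cast_id] using this

variable {p : ℕ} [Fact p.Prime]

theorem card_risingProd_eq_one_le {r : ℕ} (hr : 0 < r) :
    #{x : ZMod p | risingProd x r = 1} ≤ r := by
  set f : (ZMod p)[X] := ∏ i ∈ range r, (X + C (1 + (i : ZMod p))) with hf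
  have hfm : f.Monic := monic_prod_of_monic _ _ fun i _ => monic_X_add_C _
  have hdeg : f.natDegree = r := by
    rw [hf, natDegree_prod_of_monic _ _ fun i _ => monic_X_add_C _]
    simp only [natDegree_X_add_C, sum_const, card_range, smul_eq_mul, mul_one]
  have heval : ∀ x, f.eval x = risingProd x r := by
    intro x
    rw [hf, eval_prod, risingProd]
    refine prod_congr rfl fun i _ => ?_
    simp [add_assoc]
  have hd1 : (f - C 1).natDegree = r := by rw [natDegree_sub_C, hdeg]
  have hne : f - C 1 ≠ 0 := by
    intro h
    rw [h, natDegree_zero] at hd1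
    omega
  refine le_trans (card_le_card ?_)
    (((f - C 1).roots.toFinset_card_le.trans (f - C 1).card_roots').trans hd1.le)
  intro x hx
  rw [mem_filter] at hx
  rw [Multiset.mem_toFinset, mem_roots hne, IsRoot, eval_sub, heval, hx.2, eval_C, sub_self]

theorem cast_factorial_ne_zero {n : ℕ} (hn : n < p) : (n.factorial : ZMod p) ≠ 0 := by
  rw [Ne, ZMod.natCast_eq_zero_iff, (Fact.out : p.Prime).dvd_factorial]
  omega

theorem card_factorial_add_eq_le (r : ℕ) :
    #{n ∈ range p | (((n + r).factorial : ℕ) : ZMod p) = n.factorial} ≤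
      if r = 0 then p else r := by
  split_ifs with h
  · exact (card_filter_le _ _).trans (card_range p).le
  · refine le_trans ?_ (card_risingProd_eq_one_le (p := p) (Nat.pos_of_ne_zero h))
    refine card_le_card_of_injOn (fun n => (n : ZMod p)) ?_ ?_
    · intro n hn
      obtain ⟨hn1, hn2⟩ := mem_filter.mp hn
      rw [cast_factorial_add] at hn2
      exact mem_coe.mpr (mem_filter.mpr ⟨mem_univ _,
        mul_left_cancel₀ (cast_factorial_ne_zero (mem_range.mp hn1)) (hn2.trans (mul_one _).symm)⟩)
    · intro i hi j hj hij
      have hi := mem_range.mp (mem_filter.mp hi).1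
      have hj := mem_range.mp (mem_filter.mp hj).1
      have := congrArg ZMod.val hij
      rwa [ZMod.val_cast_of_lt hi, ZMod.val_cast_of_lt hj] at this

theorem card_factorial_eq_factorial_close_le {R : ℕ} (hR : 0 < R) :
    #{z ∈ Icc 1 (p - 1) ×ˢ Icc 1 (p - 1) |
      (z.1.factorial : ZMod p) = z.2.factorial ∧ z.1 / R = z.2 / R} ≤ 2 * (p + R ^ 2) := by
  set G : ℕ → Finset ℕ := fun r =>
    {n ∈ range p | (((n + r).factorial : ℕ) : ZMod p) = n.factorial} with hG
  have hsub : ({z ∈ Icc 1 (p - 1) ×ˢ Icc 1 (p - 1) |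
      (z.1.factorial : ZMod p) = z.2.factorial ∧ z.1 / R = z.2 / R} : Finset (ℕ × ℕ)) ⊆
      ((range R).biUnion fun r => (G r).image fun n => (n, n + r)) ∪
        (range R).biUnion fun r => (G r).image fun n => (n + r, n) := by
    rintro ⟨n, m⟩ hz
    simp only [mem_filter, mem_product, mem_Icc] at hz
    obtain ⟨⟨hn, hm⟩, hfac, hdiv⟩ := hz
    have h1 := Nat.div_add_mod n R
    have h2 := Nat.div_add_mod m R
    have h3 := Nat.mod_lt n hR
    have h4 := Nat.mod_lt m hR
    rw [hdiv] at h1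
    rcases le_total n m with h | h
    · refine mem_union_left _ (mem_biUnion.mpr ⟨m - n, mem_range.mpr (by omega),
        mem_image.mpr ⟨n, mem_filter.mpr ⟨mem_range.mpr (by omega), ?_⟩, ?_⟩⟩)
      · rw [Nat.add_sub_cancel' h, hfac]
      · rw [Nat.add_sub_cancel' h]
    · refine mem_union_right _ (mem_biUnion.mpr ⟨n - m, mem_range.mpr (by omega),
        mem_image.mpr ⟨m, mem_filter.mpr ⟨mem_range.mpr (by omega), ?_⟩, ?_⟩⟩)
      · rw [Nat.add_sub_cancel' h, hfac]
      · rw [Nat.add_sub_cancel' h]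
  have hG : ∑ r ∈ range R, #(G r) ≤ p + R ^ 2 := by
    calc ∑ r ∈ range R, #(G r) ≤ ∑ r ∈ range R, ((if r = 0 then p else 0) + R) := by
          refine sum_le_sum fun r hr => (card_factorial_add_eq_le r).trans ?_
          have := mem_range.mp hr
          split_ifs <;> omega
      _ ≤ p + R ^ 2 := by
          rw [sum_add_distrib, sum_ite_eq', if_pos (mem_range.mpr hR), sum_const, card_range, sq,
            smul_eq_mul]
  have hU : ∀ φ : ℕ → ℕ → ℕ × ℕ, #((range R).biUnion fun r => (G r).image (φ r)) ≤ p + R ^ 2 :=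
    fun φ => (card_biUnion_le.trans (sum_le_sum fun r _ => card_image_le)).trans hG
  calc _ ≤ _ := card_le_card hsub
    _ ≤ _ := card_union_le _ _
    _ ≤ (p + R ^ 2) + (p + R ^ 2) := add_le_add (hU _) (hU _)
    _ = _ := by ring

theorem card_factorial_eq_factorial_le {t : ℝ} (ht : 1 ≤ t) (htp : t ^ 4 = p) :
    (#{z ∈ Icc 1 (p - 1) ×ˢ Icc 1 (p - 1) | (z.1.factorial : ZMod p) = z.2.factorial} : ℝ) ≤
      20 * t ^ 6 := by
  set R := ⌈t ^ 2⌉₊ with hR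
  have ht2 : 1 ≤ t ^ 2 := one_le_pow₀ ht
  have hR1 : t ^ 2 ≤ R := Nat.le_ceil _
  have hR2 : (R : ℝ) ≤ 2 * t ^ 2 := by
    have := Nat.ceil_lt_add_one (by positivity : 0 ≤ t ^ 2)
    linarith
  have hb : ∀ n ∈ Icc 1 (p - 1), n / R < p / R + 1 := by
    intro n hn
    rw [mem_Icc] at hn
    exact Nat.lt_succ_of_le (Nat.div_le_div_right (by omega))
  have h1 := card_filter_apply_eq_apply_le_mul (fun n : ℕ => (n.factorial : ZMod p)) hb
  have h2 := h1.trans (Nat.mul_le_mul_left _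
    (card_factorial_eq_factorial_close_le (Nat.ceil_pos.mpr (by positivity))))
  have h3 : ((p / R : ℕ) : ℝ) ≤ t ^ 2 := by
    refine Nat.cast_div_le.trans ?_
    rw [div_le_iff₀ (by linarith), ← htp]
    nlinarith
  calc _ ≤ (((p / R + 1) * (2 * (p + R ^ 2)) : ℕ) : ℝ) := by exact_mod_cast h2
    _ = ((p / R : ℕ) + 1) * (2 * (t ^ 4 + R ^ 2)) := by push_cast; rw [htp]
    _ ≤ (t ^ 2 + t ^ 2) * (2 * (t ^ 4 + (2 * t ^ 2) ^ 2)) := by gcongr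
    _ = 20 * t ^ 6 := by ring

end Coincidences

section Moments

variable {p : ℕ} [Fact p.Prime]

theorem sum_norm_sq_sum_mulChar {ι : Type*} (s : Finset ι) {F : ι → ZMod p}
    (hF : ∀ x ∈ s, F x ≠ 0) :
    ∑ χ : DirichletCharacter ℂ p, ‖∑ x ∈ s, χ (F x)‖ ^ 2 =
      (p - 1 : ℕ) * (#{z ∈ s ×ˢ s | F z.1 = F z.2} : ℝ) := by
  have h : ((∑ χ : DirichletCharacter ℂ p, ‖∑ x ∈ s, χ (F x)‖ ^ 2 : ℝ) : ℂ) =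
      (p - 1 : ℕ) * (#{z ∈ s ×ˢ s | F z.1 = F z.2} : ℂ) := by
    push_cast
    have h1 : ∀ χ : DirichletCharacter ℂ p, (‖∑ x ∈ s, χ (F x)‖ : ℂ) ^ 2 =
        ∑ x ∈ s, ∑ y ∈ s, χ (F x)⁻¹ * χ (F y) := by
      intro χ
      rw [← Complex.conj_mul', map_sum, sum_mul_sum]
      refine sum_congr rfl fun x _ => sum_congr rfl fun y _ => ?_
      rw [← MulChar.inv_apply', ← MulChar.star_apply']
      rfl
    rw [sum_congr rfl fun χ _ => h1 χ, sum_comm, card_filter, sum_product]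
    push_cast
    rw [mul_sum]
    refine sum_congr rfl fun x hx => ?_
    rw [sum_comm, mul_sum]
    refine sum_congr rfl fun y _ => ?_
    rw [DirichletCharacter.sum_char_inv_mul_char_eq ℂ (hF x hx).isUnit,
      Nat.totient_prime Fact.out]
    simp
  exact_mod_cast h

theorem sum_norm_sum_mulChar_pow_eight :
    ∑ χ : DirichletCharacter ℂ p, ‖∑ n ∈ Icc 1 (p - 1), χ (n.factorial : ZMod p)‖ ^ 8 =
      (p - 1 : ℕ) * (#{z ∈ (Fintype.piFinset fun _ : Fin 4 => Icc 1 (p - 1)) ×ˢ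
        (Fintype.piFinset fun _ : Fin 4 => Icc 1 (p - 1)) |
          ∏ i, ((z.1 i).factorial : ZMod p) = ∏ i, ((z.2 i).factorial : ZMod p)} : ℝ) := by
  have hF : ∀ x ∈ Fintype.piFinset fun _ : Fin 4 => Icc 1 (p - 1),
      ∏ i, ((x i).factorial : ZMod p) ≠ 0 := by
    intro x hx
    refine prod_ne_zero_iff.mpr fun i _ => cast_factorial_ne_zero ?_
    have h1 := mem_Icc.mp (Fintype.mem_piFinset.mp hx i)
    have := (Fact.out : p.Prime).pos
    omega
  rw [← sum_norm_sq_sum_mulChar _ hF]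
  refine sum_congr rfl fun χ _ => ?_
  have : ∑ x ∈ Fintype.piFinset fun _ : Fin 4 => Icc 1 (p - 1),
      χ (∏ i, ((x i).factorial : ZMod p)) =
        (∑ n ∈ Icc 1 (p - 1), χ (n.factorial : ZMod p)) ^ 4 := by
    simp only [map_prod]
    rw [← prod_univ_sum (fun _ : Fin 4 => Icc 1 (p - 1)) fun _ n => χ (n.factorial : ZMod p),
      prod_const, card_univ, Fintype.card_fin]
  rw [this, norm_pow, ← pow_mul]

theorem abs_card_sub_le {t : ℝ} (ht : 1 ≤ t) (htp : t ^ 4 = p) :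
    |(#{z ∈ (Fintype.piFinset fun _ : Fin 4 => Icc 1 (p - 1)) ×ˢ
        (Fintype.piFinset fun _ : Fin 4 => Icc 1 (p - 1)) |
          ∏ i, ((z.1 i).factorial : ZMod p) = ∏ i, ((z.2 i).factorial : ZMod p)} : ℝ) -
        (p : ℝ) ^ 7| ≤ (42 ^ 3 * 20 + 7) * t ^ 27 := by
  classical
  have hp1 := (Fact.out : p.Prime).one_lt
  set I : ℝ := (#{z ∈ (Fintype.piFinset fun _ : Fin 4 => Icc 1 (p - 1)) ×ˢ
        (Fintype.piFinset fun _ : Fin 4 => Icc 1 (p - 1)) |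
          ∏ i, ((z.1 i).factorial : ZMod p) = ∏ i, ((z.2 i).factorial : ZMod p)} : ℝ) with hI
  set d : ℝ := ((p - 1 : ℕ) : ℝ) with hd
  have hd0 : 0 < d := by rw [hd]; exact_mod_cast (by omega : 0 < p - 1)
  have hdp : (p : ℝ) = d + 1 := by
    rw [hd, Nat.cast_sub hp1.le]; push_cast; ring
  set S : DirichletCharacter ℂ p → ℂ := fun χ => ∑ n ∈ Icc 1 (p - 1), χ (n.factorial : ZMod p)
    with hS
  have hlt : ∀ n ∈ Icc 1 (p - 1), n < p := fun n hn => by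
    have := mem_Icc.mp hn
    omega
  have h8 : ∑ χ, ‖S χ‖ ^ 8 = d * I := sum_norm_sum_mulChar_pow_eight
  have h2 : ∑ χ, ‖S χ‖ ^ 2 ≤ d * (20 * t ^ 6) := by
    refine (sum_norm_sq_sum_mulChar (Icc 1 (p - 1)) (F := fun n => (n.factorial : ZMod p))
      fun n hn => cast_factorial_ne_zero (hlt n hn)).le.trans ?_
    exact mul_le_mul_of_nonneg_left (card_factorial_eq_factorial_le ht htp) hd0.le
  have hS1 : S 1 = d := by
    have : ∀ n ∈ Icc 1 (p - 1), (1 : DirichletCharacter ℂ p) (n.factorial : ZMod p) = 1 :=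
      fun n hn => MulChar.one_apply (cast_factorial_ne_zero (hlt n hn)).isUnit
    simp only [hS]
    rw [sum_congr rfl this, sum_const, Nat.card_Icc, nsmul_eq_mul, mul_one, hd]
    simp
  rw [← add_sum_erase _ _ (mem_univ 1)] at h8
  have hrest : ∑ χ ∈ univ.erase 1, ‖S χ‖ ^ 8 ≤ (42 * t ^ 7) ^ 3 * (d * (20 * t ^ 6)) := by
    calc ∑ χ ∈ univ.erase 1, ‖S χ‖ ^ 8 ≤ ∑ χ ∈ univ.erase 1, (42 * t ^ 7) ^ 3 * ‖S χ‖ ^ 2 := by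
          refine sum_le_sum fun χ hχ => ?_
          have := norm_sum_mulChar_factorial_sq_le (ne_of_mem_erase hχ) ht htp
          calc ‖S χ‖ ^ 8 = (‖S χ‖ ^ 2) ^ 3 * ‖S χ‖ ^ 2 := by ring
            _ ≤ _ := by gcongr
      _ ≤ (42 * t ^ 7) ^ 3 * ∑ χ, ‖S χ‖ ^ 2 := by
          rw [← mul_sum]
          refine mul_le_mul_of_nonneg_left ?_ (by positivity)
          exact sum_le_sum_of_subset_of_nonneg (erase_subset _ _) fun _ _ _ => by positivity
      _ ≤ _ := by gcongr
  have hrest0 : 0 ≤ ∑ χ ∈ univ.erase 1, ‖S χ‖ ^ 8 := by positivity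
  have hS1' : ‖S 1‖ = d := by
    rw [hS1, Complex.norm_real, Real.norm_of_nonneg hd0.le]
  rw [hS1'] at h8
  have hlow : d ^ 7 ≤ I := by
    refine le_of_mul_le_mul_left ?_ hd0
    linarith [pow_succ' d 7]
  have hup : I ≤ d ^ 7 + (42 * t ^ 7) ^ 3 * (20 * t ^ 6) := by
    refine le_of_mul_le_mul_left ?_ hd0
    linarith [pow_succ' d 7]
  have hp7 : (p : ℝ) ^ 7 ≤ d ^ 7 + 7 * t ^ 24 := by
    have h24 : t ^ 24 = (d + 1) ^ 6 := by rw [← hdp, ← htp]; ring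
    rw [h24, hdp]
    have : 0 ≤ d ^ 5 ∧ 0 ≤ d ^ 4 ∧ 0 ≤ d ^ 3 ∧ 0 ≤ d ^ 2 := by
      refine ⟨?_, ?_, ?_, ?_⟩ <;> positivity
    nlinarith
  have hp7' : d ^ 7 ≤ (p : ℝ) ^ 7 := by
    rw [hdp]; gcongr; linarith
  have h27 : t ^ 24 ≤ t ^ 27 := pow_le_pow_right₀ ht (by norm_num)
  have hring : (42 * t ^ 7) ^ 3 * (20 * t ^ 6) = 42 ^ 3 * 20 * t ^ 27 := by ring
  have ht27 : 0 ≤ t ^ 27 := by positivity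
  rw [abs_le]
  constructor <;> linarith

end Moments

end FactorialCongruence

/-- Asymptotic for `I_4(0, p-1)`: the number of solutions of
`n_1! n_2! n_3! n_4! ≡ n_5! n_6! n_7! n_8! (mod p)` with `1 ≤ n_i ≤ p - 1`
equals `p^7 (1 + O(p^{-1/4} (log p)^{3/2}))`. -/
theorem count_factorial_product_congruence_four :
    ∃ C : ℝ, 0 < C ∧ ∀ p : ℕ, p.Prime → Odd p →
      |((((Fintype.piFinset fun _ : Fin 4 => Finset.Icc 1 (p - 1)) ×ˢ
            (Fintype.piFinset fun _ : Fin 4 => Finset.Icc 1 (p - 1))).filter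
          fun nm => (∏ i, ((nm.1 i).factorial : ZMod p)) =
            ∏ i, ((nm.2 i).factorial : ZMod p)).card : ℝ) - (p : ℝ) ^ 7| ≤
        C * (p : ℝ) ^ ((7 : ℝ) - 1 / 4) * (Real.log p) ^ ((3 : ℝ) / 2) := by
  refine ⟨42 ^ 3 * 20 + 7, by norm_num, fun p hp hodd => ?_⟩
  have := Fact.mk hp
  have hp3 : 3 ≤ p := by
    have := hp.two_le
    obtain ⟨k, hk⟩ := hodd
    omega
  have hp3' : (3 : ℝ) ≤ p := by exact_mod_cast hp3
  have hp0 : (0 : ℝ) ≤ p := by positivity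
  have ht : 1 ≤ (p : ℝ) ^ (1 / 4 : ℝ) := Real.one_le_rpow (by linarith) (by norm_num)
  have htp : ((p : ℝ) ^ (1 / 4 : ℝ)) ^ 4 = p := by
    rw [← Real.rpow_natCast, ← Real.rpow_mul hp0]; norm_num
  have ht27 : ((p : ℝ) ^ (1 / 4 : ℝ)) ^ 27 = (p : ℝ) ^ ((7 : ℝ) - 1 / 4) := by
    rw [← Real.rpow_natCast, ← Real.rpow_mul hp0]; norm_num
  have hlog : 1 ≤ Real.log p := by
    rw [Real.le_log_iff_exp_le (by linarith)]
    exact Real.exp_one_lt_three.le.trans hp3'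
  have hlog' : 1 ≤ (Real.log p) ^ ((3 : ℝ) / 2) := Real.one_le_rpow hlog (by norm_num)
  refine (FactorialCongruence.abs_card_sub_le ht htp).trans ?_
  rw [ht27]
  exact le_mul_of_one_le_right (by positivity) hlog'
end

section
/- For all fixed integers ℓ, r with ℓ ≥ 2r ≥ 1 there exists a constant C = C(ℓ,r) > 0 such that for every odd prime p, all integers H, N with 0 ≤ H < H + N < p, and every a with a ≢ 0 (mod p), one has |F_ℓ(a,H,N) − N^{ℓ}/(p−1)| ≤ C · N^{3ℓ/4 + r/2 − 1 + 2^{−r}} · p^{(ℓ−2r)/8} · (log p)^{(ℓ−2r)/4}. -/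
section

open Polynomial

/-- Polynomials `X ^ (i * Q) * v ^ j`, with `v` of order exactly `D` at `0` and `Q = s * D + 1`, are
linearly independent over polynomials of degree less than `D`. -/
theorem sum_X_pow_mul_pow_mul_ne_zero {K : Type*} [Field K] {s D Q I : ℕ} (hQ : s * D + 1 = Q)
    {v w : K[X]} (hv : v = X ^ D * w) (hw : w.eval 0 ≠ 0)
    (r : Fin I × Fin s → K[X]) (hr : ∀ k, (r k).degree < D) (hne : r ≠ 0) :
    ∑ k : Fin I × Fin s, X ^ ((k.1 : ℕ) * Q) * v ^ (k.2 : ℕ) * r k ≠ 0 := by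
  classical
  intro h0
  obtain ⟨k₁, hk₁⟩ := Function.ne_iff.1 hne
  let n : Fin I × Fin s → ℕ := fun k => k.2 + k.1 * s
  obtain ⟨k₀, hk₀, hmin⟩ := (Finset.univ.filter fun k => r k ≠ 0).exists_min_image n
    ⟨k₁, by simpa using hk₁⟩
  simp only [Finset.mem_filter, Finset.mem_univ, true_and] at hk₀ hmin
  have ninj : ∀ k, n k = n k₀ → k = k₀ := by
    intro k hk
    have h2 := k.2.2
    have h3 := k₀.2.2
    have hs : 0 < s := by omega
    have e1 : (k.1 : ℕ) = k₀.1 := by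
      have := congrArg (· / s) hk
      simpa [n, Nat.add_mul_div_right _ _ hs, Nat.div_eq_of_lt h2, Nat.div_eq_of_lt h3] using this
    have e2 : (k.2 : ℕ) = k₀.2 := by simp only [n, e1] at hk; omega
    exact Prod.ext (Fin.ext e1) (Fin.ext e2)
  have ord : ∀ k : Fin I × Fin s, (k.1 : ℕ) * Q + D * k.2 = D * n k + k.1 := by
    intro k; simp only [n, ← hQ]; ring
  have term : ∀ k : Fin I × Fin s, X ^ ((k.1 : ℕ) * Q) * v ^ (k.2 : ℕ) * r k
      = X ^ (D * n k + k.1) * (w ^ (k.2 : ℕ) * r k) := by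
    intro k; rw [← ord, hv, mul_pow, ← pow_mul, pow_add]; ring
  have hdvd : (X : K[X]) ^ (D * n k₀ + k₀.1 + D) ∣ X ^ (D * n k₀ + k₀.1) *
      (w ^ (k₀.2 : ℕ) * r k₀) := by
    rw [← term, ← Finset.add_sum_erase _ _ (Finset.mem_univ k₀)] at *
    rw [eq_neg_of_add_eq_zero_left h0, dvd_neg]
    refine Finset.dvd_sum fun k hk => ?_
    rw [Finset.mem_erase] at hk
    by_cases hrk : r k = 0
    · simp [hrk]
    rw [term]
    refine dvd_mul_of_dvd_left (pow_dvd_pow _ ?_) _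
    have h1 := hmin k hrk
    have h2 : n k₀ < n k := lt_of_le_of_ne h1 fun h => hk.1 (ninj k h.symm)
    have h3 : (k₀.1 : ℕ) ≤ k.1 := by
      have a2 := k.2.2
      have a3 := k₀.2.2
      by_contra! hlt
      have : ((k.1 : ℕ) + 1) * s ≤ k₀.1 * s := Nat.mul_le_mul_right _ hlt
      simp only [n] at h2
      nlinarith
    nlinarith
  rw [pow_add, mul_dvd_mul_iff_left (pow_ne_zero _ X_ne_zero)] at hdvd
  have hco : IsCoprime ((X : K[X]) ^ D) (w ^ (k₀.2 : ℕ)) := by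
    refine IsCoprime.pow ?_
    refine (irreducible_X.coprime_iff_not_dvd).2 ?_
    rwa [X_dvd_iff, coeff_zero_eq_eval_zero]
  have := hco.dvd_of_dvd_mul_left hdvd
  refine hk₀ (eq_zero_of_dvd_of_degree_lt this ?_)
  simpa using hr k₀

theorem card_pow_eval_eq_le {K : Type*} [Field K] [Fintype K] [DecidableEq K] {s D Q m : ℕ}
    (hQ : s * D + 1 = Q) (p k : ℕ) [Fact p.Prime] [CharP K p] (hQp : Q = p ^ k)
    (hK : Fintype.card K = Q ^ 2)
    {g g₁ : K[X]} (hg : g = X * g₁) (hg₁ : g₁.eval 0 ≠ 0) (hm : g.natDegree = m)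
    (hQm : 2 * m + 6 ≤ Q) (c : K) (hc : c ≠ 0) :
    (Finset.univ.filter fun x : K => g.eval x ^ (D * (Q + 1)) = c).card
      ≤ D * Q + (2 * m + 4) * Q := by
  classical
  set I := D + m + 3 with hI
  have hs : 0 < s := by
    rcases Nat.eq_zero_or_pos s with h | h
    · subst h; omega
    · exact h
  have hD : 0 < D := by
    rcases Nat.eq_zero_or_pos D with h | h
    · subst h; omega
    · exact h
  have hDs : D ≤ s * D := Nat.le_mul_of_pos_left _ hs
  set v := g ^ D with hv
  have hvdeg : v.natDegree = D * m := by rw [hv, natDegree_pow, hm]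
  let B := D * Q + I + s * (D * m)
  let L : (Fin I × Fin s → Fin D → K) →ₗ[K] K[X] :=
    ∑ k : Fin I × Fin s, ∑ l : Fin D,
      (LinearMap.toSpanSingleton K K[X] (X ^ ((l : ℕ) * Q) * C (c ^ (k.2 : ℕ)) * X ^ (k.1 : ℕ) *
        v ^ (s - 1 - k.2))).comp ((LinearMap.proj (R := K) (φ := fun _ : Fin D => K) l).comp
          (LinearMap.proj (φ := fun _ : Fin I × Fin s => Fin D → K) k))
  have hL : ∀ b, L b = ∑ k : Fin I × Fin s, ∑ l : Fin D,
      b k l • (X ^ ((l : ℕ) * Q) * C (c ^ (k.2 : ℕ)) * X ^ (k.1 : ℕ) * v ^ (s - 1 - k.2)) := by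
    intro b; simp [L, LinearMap.sum_apply]
  have hLdeg : ∀ b, L b ∈ degreeLT K B := by
    intro b
    rw [hL]
    refine Submodule.sum_mem _ fun k _ => Submodule.sum_mem _ fun l _ => Submodule.smul_mem _ _ ?_
    rw [mem_degreeLT]
    refine lt_of_le_of_lt degree_le_natDegree (Nat.cast_lt.2 ?_)
    have h1 : (X ^ ((l : ℕ) * Q) * C (c ^ (k.2 : ℕ)) * X ^ (k.1 : ℕ) * v ^ (s - 1 - k.2)).natDegree
        ≤ (l : ℕ) * Q + 0 + k.1 + (s - 1 - k.2) * (D * m) := by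
      refine natDegree_mul_le_of_le (natDegree_mul_le_of_le (natDegree_mul_le_of_le ?_ ?_) ?_) ?_
      · simp
      · simp
      · simp
      · rw [natDegree_pow, hvdeg]
    refine lt_of_le_of_lt h1 ?_
    have h2 : (l : ℕ) * Q ≤ D * Q := Nat.mul_le_mul_right _ l.2.le
    have h3 : (s - 1 - k.2) * (D * m) ≤ s * (D * m) := Nat.mul_le_mul_right _ (by omega)
    have h4 := k.1.2
    simp only [B]
    omega
  obtain ⟨b, hb, hb0⟩ : ∃ b, L b = 0 ∧ b ≠ 0 := by
    let L' := L.codRestrict (degreeLT K B) hLdeg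
    have hlt : Module.finrank K (degreeLT K B) < Module.finrank K (Fin I × Fin s → Fin D → K) := by
      rw [(degreeLTEquiv K B).finrank_eq]
      simp only [Module.finrank_pi_fintype, Module.finrank_self, mul_one, Finset.sum_const,
        Finset.card_univ, Fintype.card_prod, Fintype.card_fin, smul_eq_mul, B]
      zify at *
      have e : (I : ℤ) * s * D = I * (Q - 1) := by rw [← hQ]; ring
      have e2 : (s : ℤ) * (D * m) = m * (Q - 1) := by rw [← hQ]; ring
      rw [e, e2, hI]
      nlinarith
    obtain ⟨b, hb, hb0⟩ := (Submodule.ne_bot_iff _).1 (LinearMap.ker_ne_bot_of_finrank_lt (f := L') hlt)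
    refine ⟨b, ?_, hb0⟩
    have := congrArg Subtype.val (LinearMap.mem_ker.1 hb)
    simpa [L'] using this
  let r : Fin I × Fin s → K[X] := fun k => ∑ l : Fin D, C (b k l ^ Q) * X ^ (l : ℕ)
  have hQ0 : Q ≠ 0 := by omega
  have hr : ∀ k, (r k).degree < D := fun k => degree_sum_fin_lt _
  have hrne : r ≠ 0 := by
    intro h
    refine hb0 (funext fun k => funext fun l => ?_)
    have h1 := congrArg (fun f => (f k).coeff l) h
    simp only [r, finsetSum_coeff, coeff_C_mul, coeff_X_pow, Pi.zero_apply, coeff_zero] at h1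
    rw [Finset.sum_eq_single l] at h1
    · simpa [hQ0] using h1
    · intro l' _ hl'
      rw [if_neg (fun h => hl' (Fin.ext h.symm)), mul_zero]
    · simp
  let H : K[X] := ∑ k : Fin I × Fin s, X ^ ((k.1 : ℕ) * Q) * v ^ (k.2 : ℕ) * r k
  have hH : H ≠ 0 := sum_X_pow_mul_pow_mul_ne_zero hQ (w := g₁ ^ D) (by rw [hv, hg, mul_pow])
    (by simpa using fun h => absurd h hg₁) r hr hrne
  have hHdeg : H.natDegree ≤ D * Q + (2 * m + 4) * Q := by
    refine natDegree_sum_le_of_forall_le _ _ fun k _ => ?_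
    have h1 : (X ^ ((k.1 : ℕ) * Q) * v ^ (k.2 : ℕ) * r k).natDegree
        ≤ (k.1 : ℕ) * Q + k.2 * (D * m) + D := by
      refine natDegree_mul_le_of_le (natDegree_mul_le_of_le ?_ ?_) ?_
      · simp
      · rw [natDegree_pow, hvdeg]
      · exact natDegree_le_of_degree_le (hr k).le
    refine h1.trans ?_
    have h2 : (k.1 : ℕ) * Q ≤ (D + m + 2) * Q := Nat.mul_le_mul_right _ (by have := k.1.2; omega)
    have h3 : (k.2 : ℕ) * (D * m) ≤ s * (D * m) := Nat.mul_le_mul_right _ k.2.2.le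
    have h4 : s * (D * m) ≤ Q * m := by rw [← hQ]; nlinarith
    nlinarith
  have hroot : ∀ x : K, g.eval x ^ (D * (Q + 1)) = c → H.eval x = 0 := by
    intro x hx
    have hvx : v.eval x ^ (Q + 1) = c := by rw [hv, eval_pow, ← pow_mul, hx]
    have hv0 : v.eval x ≠ 0 := by
      intro h; rw [h] at hvx; exact hc (by rw [← hvx]; simp)
    have hq : ∀ y : K, (y ^ Q) ^ Q = y := by
      intro y; rw [← pow_mul, ← pow_two, ← hK, FiniteField.pow_card]
    have hfrob : ∀ {ι : Type} (S : Finset ι) (f : ι → K), (∑ i ∈ S, f i) ^ Q = ∑ i ∈ S, f i ^ Q := by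
      intro ι S f; rw [hQp]; exact sum_pow_char_pow p k S f
    have key : v.eval x ^ (s - 1) * H.eval x ^ Q = (L b).eval x := by
      rw [hL]
      simp only [H, r, eval_finsetSum, eval_mul, eval_pow, eval_X, eval_C, hfrob, mul_pow, hq,
        eval_smul, smul_eq_mul, Finset.mul_sum]
      refine Finset.sum_congr rfl fun k _ => Finset.sum_congr rfl fun l _ => ?_
      have hj : s - 1 = (s - 1 - k.2) + k.2 := by have := k.2.2; omega
      have e1 : (x ^ ((k.1 : ℕ) * Q)) ^ Q = x ^ (k.1 : ℕ) := by
        rw [mul_comm, pow_mul, pow_right_comm, hq]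
      have e2 : (x ^ (l : ℕ)) ^ Q = x ^ ((l : ℕ) * Q) := by rw [pow_mul]
      have e3 : v.eval x ^ (s - 1) * (v.eval x ^ (k.2 : ℕ)) ^ Q
          = v.eval x ^ (s - 1 - k.2) * c ^ (k.2 : ℕ) := by
        rw [← hvx, ← pow_mul, ← pow_mul, ← pow_add, ← pow_add]
        congr 1
        conv_lhs => rw [hj]
        ring
      rw [e1, e2]
      linear_combination (x ^ (k.1 : ℕ) * b k l * x ^ ((l : ℕ) * Q)) * e3
    rw [hb, eval_zero] at key
    rcases mul_eq_zero.1 key with h | h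
    · exact absurd h (pow_ne_zero _ hv0)
    · exact pow_eq_zero_iff hQ0 |>.1 h
  refine le_trans ?_ ((card_roots' H).trans hHdeg)
  refine le_trans (Finset.card_le_card (t := H.roots.toFinset) ?_) (Multiset.toFinset_card_le _)
  intro x hx
  rw [Finset.mem_filter] at hx
  simpa [hH] using hroot x hx.2

theorem norm_sum_mulChar_norm_eval_le {p k : ℕ} [Fact p.Prime] {K : Type*} [Field K] [Fintype K]
    [Algebra (ZMod p) K] (hK : Fintype.card K = (p ^ k) ^ 2)
    {χ : MulChar (ZMod p) ℂ} (hχ : χ ≠ 1) {g g₁ : K[X]} (hg : g = X * g₁) (hg₁ : g₁.eval 0 ≠ 0)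
    (hm : 2 * g.natDegree + 6 ≤ p ^ k) :
    ‖∑ x : K, χ (Algebra.norm (ZMod p) (g.eval x))‖
      ≤ p ^ k * (p * (2 * g.natDegree + 4) + g.natDegree) := by
  classical
  have : CharP K p := charP_of_injective_algebraMap (algebraMap (ZMod p) K).injective p
  have hp : 1 < p := (Fact.out : p.Prime).one_lt
  set Q := p ^ k with hQdef
  set m := g.natDegree with hmdef
  obtain ⟨D, hD⟩ : p - 1 ∣ Q - 1 := by
    simpa [hQdef] using Nat.sub_dvd_pow_sub_pow p 1 k
  have hQ : (p - 1) * D + 1 = Q := by omega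
  have hexp : (Nat.card K - 1) / (Nat.card (ZMod p) - 1) = D * (Q + 1) := by
    rw [Nat.card_eq_fintype_card, Nat.card_zmod, hK]
    refine Nat.div_eq_of_eq_mul_right (by omega) ?_
    rw [← mul_assoc, ← hD, mul_comm, ← Nat.sq_sub_sq, one_pow]
  let n : ZMod p → ℕ := fun c => (Finset.univ.filter fun x : K =>
    Algebra.norm (ZMod p) (g.eval x) = c).card
  set U : ℕ := D * Q + (2 * m + 4) * Q with hU
  have hn : ∀ c, c ≠ 0 → n c ≤ U := by
    intro c hc
    have hc' : algebraMap (ZMod p) K c ≠ 0 := by simpa using hc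
    refine le_trans (Finset.card_le_card fun x hx => ?_)
      (card_pow_eval_eq_le hQ p k hQdef hK hg hg₁ hmdef.symm hm _ hc')
    simp only [Finset.mem_filter, Finset.mem_univ, true_and] at hx ⊢
    rw [← hexp, ← FiniteField.algebraMap_norm_eq_pow, hx]
  have hg0 : g ≠ 0 := by
    rintro rfl
    have h := mul_eq_zero.1 hg.symm
    rcases h with h | h
    · exact X_ne_zero h
    · exact hg₁ (by simp [h])
  have hn0 : n 0 ≤ m := by
    refine le_trans ?_ (card_roots' g)
    refine le_trans (Finset.card_le_card (t := g.roots.toFinset) fun x hx => ?_)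
      (Multiset.toFinset_card_le _)
    simp only [Finset.mem_filter, Finset.mem_univ, true_and, Algebra.norm_eq_zero_iff] at hx
    simpa [hg0] using hx
  have htot : ∑ c, n c = Q ^ 2 := by
    rw [← hK, ← Finset.card_univ]
    exact (Finset.card_eq_sum_card_fiberwise fun x _ => Finset.mem_univ _).symm
  have hsum : ∑ x : K, χ (Algebra.norm (ZMod p) (g.eval x)) = ∑ c, χ c * ((n c : ℂ) - U) := by
    simp only [mul_sub, Finset.sum_sub_distrib, ← Finset.sum_mul,
      MulChar.sum_eq_zero_of_ne_one hχ, zero_mul, sub_zero]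
    rw [← Finset.sum_fiberwise_of_maps_to (t := Finset.univ)
      (g := fun x => Algebra.norm (ZMod p) (g.eval x)) (fun _ _ => Finset.mem_univ _)]
    refine Finset.sum_congr rfl fun c _ => ?_
    rw [Finset.sum_congr rfl (g := fun _ => χ c)]
    · simp [n, mul_comm]
    · intro x hx; simp only [Finset.mem_filter] at hx; rw [hx.2]
  rw [hsum, ← Finset.add_sum_erase _ _ (Finset.mem_univ (0 : ZMod p))]
  simp only [MulChar.map_zero, zero_mul, zero_add]
  have hb : ∀ c ∈ Finset.univ.erase (0 : ZMod p),
      ‖χ c * ((n c : ℂ) - U)‖ ≤ (U : ℝ) - n c := by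
    intro c hc
    rw [Finset.mem_erase] at hc
    have h1 : ‖χ c‖ ≤ 1 := DirichletCharacter.norm_le_one χ c
    have h2 : ‖(n c : ℂ) - U‖ = (U : ℝ) - n c := by
      have : (n c : ℂ) - U = ((n c - U : ℝ) : ℂ) := by push_cast; rfl
      rw [this, Complex.norm_real, Real.norm_eq_abs, abs_sub_comm, abs_of_nonneg]
      have := hn c hc.1
      rw [sub_nonneg]; exact_mod_cast this
    rw [norm_mul, h2]
    have : 0 ≤ (U : ℝ) - n c := by rw [← h2]; positivity
    nlinarith
  refine (norm_sum_le_of_le _ hb).trans ?_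
  rw [Finset.sum_sub_distrib, Finset.sum_const, Finset.card_erase_of_mem (Finset.mem_univ _),
    Finset.card_univ, ZMod.card, nsmul_eq_mul]
  have h3 : (∑ c ∈ Finset.univ.erase (0 : ZMod p), (n c : ℝ)) = (Q : ℝ) ^ 2 - n 0 := by
    rw [eq_sub_iff_add_eq, add_comm,
      Finset.add_sum_erase _ (fun c => (n c : ℝ)) (Finset.mem_univ (0 : ZMod p))]
    exact_mod_cast htot
  rw [h3, hU]
  have hQ' : ((p - 1 : ℕ) : ℝ) * D + 1 = Q := by exact_mod_cast hQ
  have hn0' : (n 0 : ℝ) ≤ m := by exact_mod_cast hn0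
  have hQ1 : (1 : ℝ) ≤ Q := by exact_mod_cast (by omega : 1 ≤ Q)
  have hp1 : ((p - 1 : ℕ) : ℝ) = p - 1 := by rw [Nat.cast_sub hp.le]; simp
  have hQc : (p : ℝ) ^ k = Q := by rw [hQdef]; push_cast; rfl
  rw [hp1] at hQ' ⊢
  rw [hQc]
  push_cast
  have hm0 : (0 : ℝ) ≤ m := by positivity
  have hD0 : (0 : ℝ) ≤ D := by positivity
  have e1 : ((p : ℝ) - 1) * (D * Q + (2 * m + 4) * Q)
      = (Q - 1) * Q + (p - 1) * ((2 * m + 4) * Q) := by rw [← hQ']; ring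
  rw [e1]
  nlinarith [mul_nonneg hm0 (sub_nonneg.2 hQ1)]

theorem norm_sum_mulChar_norm_prod_artinSchreier_le {p k : ℕ} [Fact p.Prime] {K : Type*} [Field K]
    [Fintype K] [Algebra (ZMod p) K] (hK : Fintype.card K = (p ^ k) ^ 2)
    {χ : MulChar (ZMod p) ℂ} (hχ : χ ≠ 1) (S : Finset (ZMod p)) (hS : 0 ∈ S)
    (hm : 2 * (S.card * p) + 6 ≤ p ^ k) :
    ‖∑ x : K, χ (Algebra.norm (ZMod p) (∏ b ∈ S, (x ^ p - x - algebraMap (ZMod p) K b)))‖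
      ≤ p ^ k * (p * (2 * (S.card * p) + 4) + S.card * p) := by
  classical
  have hp : 1 < p := (Fact.out : p.Prime).one_lt
  let g : K[X] := ∏ b ∈ S, (X ^ p - X - C (algebraMap (ZMod p) K b))
  let g₁ : K[X] := (X ^ (p - 1) - 1) * ∏ b ∈ S.erase 0, (X ^ p - X - C (algebraMap (ZMod p) K b))
  have hg : g = X * g₁ := by
    simp only [g, g₁]
    rw [← Finset.mul_prod_erase _ _ hS, ← mul_assoc]
    congr 1
    have : (X : K[X]) ^ p = X ^ (p - 1) * X := by rw [← pow_succ, Nat.sub_add_cancel hp.le]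
    rw [this]
    simp; ring
  have hg₁ : g₁.eval 0 ≠ 0 := by
    simp only [g₁, eval_mul, eval_prod, eval_sub, eval_pow, eval_X, eval_C, eval_one]
    refine mul_ne_zero ?_ (Finset.prod_ne_zero_iff.2 fun b hb => ?_)
    · rw [zero_pow (by omega)]; simp
    · rw [zero_pow (by omega)]; simpa using Finset.ne_of_mem_erase hb
  have hdeg : g.natDegree = S.card * p := by
    simp only [g]
    have h1 : ∀ b ∈ S, (X ^ p - X - C (algebraMap (ZMod p) K b)).natDegree = p := by
      intro b _
      rw [natDegree_sub_C, FiniteField.X_pow_card_sub_X_natDegree_eq K hp]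
    rw [natDegree_prod, Finset.sum_congr rfl h1]
    · simp
    · intro b hb h0
      have := h1 b hb
      rw [h0, natDegree_zero] at this
      omega
  have := norm_sum_mulChar_norm_eval_le hK hχ hg hg₁ (by rwa [hdeg])
  rw [hdeg] at this
  simpa [g, eval_prod] using this

/-- If the power sums of finitely many complex numbers are `O(R ^ n)`, then the numbers have absolute
value at most `R`. -/
theorem norm_le_of_forall_norm_sum_pow_le {ι : Type*} [Fintype ι] {μ : ι → ℂ} {R B : ℝ} {n₀ : ℕ}
    (hR : 0 < R) (h : ∀ n, n₀ ≤ n → ‖∑ i, μ i ^ n‖ ≤ B * R ^ n) (i₀ : ι) : ‖μ i₀‖ ≤ R := by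
  classical
  let E : ℂ[X] := ∏ ν ∈ (Finset.univ.image μ).erase (μ i₀), (X - C ν)
  have hE : ∀ i, E.eval (μ i) = if μ i = μ i₀ then E.eval (μ i₀) else 0 := by
    intro i
    split_ifs with hi
    · rw [hi]
    · simp only [E, eval_prod, eval_sub, eval_X, eval_C]
      exact Finset.prod_eq_zero (i := μ i) (Finset.mem_erase.2 ⟨hi, by simp⟩) (sub_self _)
  have hE0 : E.eval (μ i₀) ≠ 0 := by
    simp only [E, eval_prod, eval_sub, eval_X, eval_C]
    refine Finset.prod_ne_zero_iff.2 fun ν hν => ?_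
    rw [sub_ne_zero]
    exact (Finset.ne_of_mem_erase hν).symm
  set A : ℂ := (Finset.univ.filter fun i => μ i = μ i₀).card * E.eval (μ i₀) with hA
  have hA0 : A ≠ 0 := by
    refine mul_ne_zero (Nat.cast_ne_zero.2 (Finset.card_ne_zero_of_mem (a := i₀) ?_)) hE0
    simp
  have key : ∀ n, A * μ i₀ ^ n
      = ∑ k ∈ Finset.range (E.natDegree + 1), E.coeff k * ∑ i, μ i ^ (n + k) := by
    intro n
    simp_rw [Finset.mul_sum]
    rw [Finset.sum_comm]
    have : ∀ i, ∑ k ∈ Finset.range (E.natDegree + 1), E.coeff k * μ i ^ (n + k)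
        = if μ i = μ i₀ then μ i₀ ^ n * E.eval (μ i₀) else 0 := by
      intro i
      trans μ i ^ n * E.eval (μ i)
      · rw [eval_eq_sum_range, Finset.mul_sum]
        exact Finset.sum_congr rfl fun k _ => by rw [pow_add]; ring
      · rw [hE]; split_ifs with hi
        · rw [hi]
        · simp
    rw [Finset.sum_congr rfl fun i _ => this i, ← Finset.sum_filter, Finset.sum_const, nsmul_eq_mul,
      hA]
    ring
  set B' := ∑ k ∈ Finset.range (E.natDegree + 1), ‖E.coeff k‖ * (B * R ^ k) with hB'
  have hle : ∀ n, n₀ ≤ n → (‖μ i₀‖ / R) ^ n ≤ B' / ‖A‖ := by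
    intro n hn
    rw [div_pow, div_le_div_iff₀ (by positivity) (by positivity), mul_comm, ← norm_pow, ← norm_mul,
      key, hB', Finset.sum_mul]
    refine norm_sum_le_of_le _ fun k _ => ?_
    rw [norm_mul, mul_assoc]
    refine mul_le_mul_of_nonneg_left ((h (n + k) (by omega)).trans (le_of_eq ?_)) (norm_nonneg _)
    rw [pow_add]; ring
  by_contra! hlt
  have h1 : 1 < ‖μ i₀‖ / R := (one_lt_div hR).2 hlt
  obtain ⟨n, hn⟩ := pow_unbounded_of_one_lt (B' / ‖A‖) h1
  have h2 := hle (max n n₀) (le_max_right _ _)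
  have h3 := pow_le_pow_right₀ h1.le (le_max_left n n₀)
  linarith

theorem exists_eq_neg_sum_pow_of_recurrence {a c : ℕ → ℂ} {d : ℕ} (ha : a 0 = 1)
    (had : ∀ n, d < n → a n = 0) (hrec : ∀ n, n * a n = ∑ k ∈ Finset.Icc 1 n, c k * a (n - k)) :
    ∃ ω : Fin d → ℂ, ∀ k, 1 ≤ k → c k = -∑ i, ω i ^ k := by
  classical
  let P : ℂ[X] := X ^ d + ∑ i : Fin d, C (a (d - i)) * X ^ (i : ℕ)
  have hlt := degree_sum_fin_lt fun i : Fin d => a (d - i)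
  have hP : P.Monic := monic_X_pow_add hlt
  have hPd : P.natDegree = d := by
    refine natDegree_eq_of_degree_eq_some ?_
    simp only [P]
    rw [degree_add_eq_left_of_degree_lt (by simpa using hlt)]; simp
  have hcoeff : ∀ i, i ≤ d → P.coeff (d - i) = a i := by
    intro i hi
    simp only [P, coeff_add, coeff_X_pow, finsetSum_coeff, coeff_C_mul]
    rcases Nat.eq_zero_or_pos i with rfl | hi0
    · simp only [Nat.sub_zero, if_true, ha]
      rw [Finset.sum_eq_zero]; · simp
      intro j _; rw [if_neg (by omega)]; simp
    · rw [if_neg (by omega), zero_add, Finset.sum_eq_single ⟨d - i, by omega⟩]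
      · simp only [if_true, mul_one]; congr 1; omega
      · intro j _ hj; rw [if_neg (fun h => hj (Fin.ext h.symm))]; simp
      · simp
  have hcard : P.roots.card = d := by rw [IsAlgClosed.card_roots_eq_natDegree, hPd]
  obtain ⟨ω, hω⟩ : ∃ ω : Fin d → ℂ, Multiset.map ω Finset.univ.val = P.roots := by
    obtain ⟨l, hl⟩ := Quot.exists_rep P.roots
    change (l : Multiset ℂ) = _ at hl
    have hlen : l.length = d := by rw [← hcard, ← hl]; simp
    subst hlen
    exact ⟨l.get, by rw [← hl, Fin.univ_val_map]; simp⟩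
  have hes : ∀ i, MvPolynomial.aeval ω (MvPolynomial.esymm (Fin d) ℂ i) = (-1) ^ i * a i := by
    intro i
    rw [MvPolynomial.aeval_esymm_eq_multiset_esymm, hω]
    rcases le_or_gt i d with hi | hi
    · rw [← hcoeff i hi, coeff_eq_esymm_roots_of_card (by rw [hcard, hPd]) (by omega), hPd,
        hP.leadingCoeff, Nat.sub_sub_self hi, one_mul, ← mul_assoc, ← pow_add, ← two_mul, pow_mul]
      simp
    · rw [had i hi, mul_zero, Multiset.esymm, Multiset.powersetCard_eq_empty _ (by omega)]
      simp
  have hnewton : ∀ n, n * a n = ∑ k ∈ Finset.Icc 1 n, (-∑ i, ω i ^ k) * a (n - k) := by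
    intro n
    have h1 := congrArg (MvPolynomial.aeval ω) (MvPolynomial.mul_esymm_eq_sum (Fin d) ℂ n)
    simp only [map_mul, map_natCast, map_sum, map_pow, map_neg, map_one, hes,
      MvPolynomial.psum, MvPolynomial.aeval_X] at h1
    have h2 : ∑ x ∈ Finset.HasAntidiagonal.antidiagonal n with x.1 < n,
        (-1 : ℂ) ^ x.1 * ((-1) ^ x.1 * a x.1) * ∑ i, ω i ^ x.2
        = ∑ k ∈ Finset.Icc 1 n, (∑ i, ω i ^ k) * a (n - k) := by
      refine Finset.sum_bij (fun x _ => x.2) ?_ ?_ ?_ ?_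
      · intro x hx; simp only [Finset.mem_filter, Finset.HasAntidiagonal.mem_antidiagonal, Finset.mem_Icc] at *; omega
      · intro x hx y hy h
        simp only [Finset.mem_filter, Finset.HasAntidiagonal.mem_antidiagonal] at *
        exact Prod.ext (by omega) h
      · intro k hk
        rw [Finset.mem_Icc] at hk
        exact ⟨(n - k, k), by simp only [Finset.mem_filter, Finset.HasAntidiagonal.mem_antidiagonal]; omega, rfl⟩
      · intro x hx
        simp only [Finset.mem_filter, Finset.HasAntidiagonal.mem_antidiagonal] at hx
        rw [← mul_assoc, ← mul_pow, show n - x.2 = x.1 by omega]; simp [mul_comm]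
    rw [h2] at h1
    simp only [neg_mul, Finset.sum_neg_distrib]
    have h3 : ((-1 : ℂ) ^ n) * (-1) ^ n = 1 := by rw [← mul_pow]; simp
    linear_combination (-1) ^ n * h1 + (-(n * a n) -
      (∑ k ∈ Finset.Icc 1 n, (∑ i, ω i ^ k) * a (n - k))) * h3
  refine ⟨ω, fun k => ?_⟩
  induction k using Nat.strong_induction_on with
  | _ k ih =>
    intro hk
    have h := (hrec k).symm.trans (hnewton k)
    rw [← Finset.add_sum_erase _ _ (Finset.mem_Icc.2 ⟨hk, le_refl k⟩),
      ← Finset.add_sum_erase (Finset.Icc 1 k) (fun k' => (-∑ i, ω i ^ k') * a (k - k'))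
        (Finset.mem_Icc.2 ⟨hk, le_refl k⟩), Nat.sub_self, ha, mul_one, mul_one] at h
    rw [Finset.sum_congr rfl fun j hj => ?_] at h
    · exact add_right_cancel h
    · rw [Finset.mem_erase, Finset.mem_Icc] at hj
      rw [ih j (by omega) hj.2.1]

/-- The finite set of monic polynomials of degree `n` over a finite field. -/
noncomputable def monicsOfDegree (F : Type*) [Field F] [Finite F] (n : ℕ) : Finset F[X] :=
  haveI : Finite ({ h : F[X] | h.Monic ∧ h.natDegree = n } : Set F[X]) :=
    haveI : Finite (degreeLT F n) := .of_equiv _ (degreeLTEquiv F n).toEquiv.symm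
    .of_equiv _ (monicEquivDegreeLT n).symm
  (Set.finite_coe_iff.1 this).toFinset

theorem mem_monicsOfDegree {F : Type*} [Field F] [Finite F] {n : ℕ} {h : F[X]} :
    h ∈ monicsOfDegree F n ↔ h.Monic ∧ h.natDegree = n := by
  simp [monicsOfDegree]

theorem card_filter_minpoly_eq {F L : Type*} [Field F] [Field L] [Algebra F L] [Fintype L]
    [DecidableEq F[X]] {P : F[X]} (hP : Irreducible P) (hm : P.Monic)
    (hd : P.natDegree ∣ Module.finrank F L) :
    (Finset.univ.filter fun α : L => minpoly F α = P).card = P.natDegree := by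
  classical
  have : Finite F := .of_injective _ (algebraMap F L).injective
  have : Fact (Irreducible P) := ⟨hP⟩
  have : Module.Finite F (AdjoinRoot P) := (AdjoinRoot.powerBasis hP.ne_zero).finite
  have hr : Module.finrank F (AdjoinRoot P) = P.natDegree :=
    (AdjoinRoot.powerBasis hP.ne_zero).finrank
  have h1 := FiniteField.natCard_algHom_of_finrank_dvd (F := F) (K := AdjoinRoot P) (L := L)
    (by rwa [hr])
  rw [hr, Nat.card_congr (AdjoinRoot.equiv L F P hP.ne_zero)] at h1
  rw [← h1, ← Fintype.card_subtype, ← Nat.card_eq_fintype_card]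
  refine Nat.card_congr (Equiv.subtypeEquivRight fun α => ?_)
  rw [mem_aroots]
  refine ⟨fun h => ⟨hP.ne_zero, h ▸ minpoly.aeval F α⟩, fun h => ?_⟩
  exact (minpoly.eq_of_irreducible_of_monic hP h.2 hm).symm

open UniqueFactorizationMonoid Classical in
theorem sum_card_filter_minpoly_pow_dvd {F : Type*} [Field F]
    {L : ℕ → Type*} [∀ k, Field (L k)] [∀ k, Fintype (L k)] [∀ k, Algebra F (L k)]
    (hL : ∀ k, k ≠ 0 → Module.finrank F (L k) = k) {n : ℕ} {h : F[X]} (hm : h.Monic)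
    (hn : h.natDegree = n) :
    ∑ k ∈ Finset.Icc 1 n, (Finset.univ.filter fun α : L k =>
      minpoly F α ^ (k / (minpoly F α).natDegree) ∣ h).card = n := by
  classical
  set S := (normalizedFactors h).toFinset with hS
  have hmem : ∀ {P}, P ∈ S ↔ Irreducible P ∧ P.Monic ∧ P ∣ h := by
    intro P
    rw [hS, Multiset.mem_toFinset, Polynomial.mem_normalizedFactors_iff hm.ne_zero]
  have step : ∀ k ∈ Finset.Icc 1 n, (Finset.univ.filter fun α : L k =>
      minpoly F α ^ (k / (minpoly F α).natDegree) ∣ h).card =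
      ∑ P ∈ S, if P.natDegree ∣ k ∧ P ^ (k / P.natDegree) ∣ h then P.natDegree else 0 := by
    intro k hk
    rw [Finset.mem_Icc] at hk
    have hk0 : k ≠ 0 := by omega
    have : FiniteDimensional F (L k) := Module.Finite.of_finite
    have hdvd : ∀ α : L k, (minpoly F α).natDegree ∣ k := fun α => by
      have := minpoly.degree_dvd (K := F) (Algebra.IsIntegral.isIntegral (R := F) α)
      rwa [hL k hk0] at this
    rw [Finset.card_eq_sum_card_fiberwise (f := fun α => minpoly F α) (t := S)]
    · refine Finset.sum_congr rfl fun P hP => ?_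
      obtain ⟨hPi, hPm, hPd⟩ := hmem.1 hP
      split_ifs with hc
      · rw [← card_filter_minpoly_eq (L := L k) hPi hPm (by rw [hL k hk0]; exact hc.1),
          Finset.filter_filter]
        congr 1
        ext α
        simp only [Finset.mem_filter, Finset.mem_univ, true_and]
        exact ⟨fun h => h.2, fun h => ⟨h ▸ hc.2, h⟩⟩
      · rw [Finset.card_eq_zero, Finset.filter_filter, Finset.filter_eq_empty_iff]
        rintro α - ⟨h1, rfl⟩
        exact hc ⟨hdvd α, h1⟩
    · intro α hα
      simp only [Finset.coe_filter, Finset.mem_univ, true_and, Set.mem_ofPred_eq] at hα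
      have hi := Algebra.IsIntegral.isIntegral (R := F) α
      refine hmem.2 ⟨minpoly.irreducible hi, minpoly.monic hi, (dvd_pow_self _ ?_).trans hα⟩
      exact (Nat.div_pos (Nat.le_of_dvd (by omega) (hdvd α)) (minpoly.natDegree_pos hi)).ne'
  rw [Finset.sum_congr rfl step, Finset.sum_comm]
  have hprod : (normalizedFactors h).prod = h := by
    have := prod_normalizedFactors_eq hm.ne_zero
    rwa [hm.normalize_eq_self] at this
  have hdeg : n = ∑ P ∈ S, (normalizedFactors h).count P * P.natDegree := by
    rw [← hn]
    conv_lhs => rw [← hprod]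
    rw [natDegree_multiset_prod_of_monic, Finset.sum_multiset_map_count]
    · simp [hS]
    · intro P hP
      exact ((Polynomial.mem_normalizedFactors_iff hm.ne_zero).1 hP).2.1
  conv_rhs => rw [hdeg]
  refine Finset.sum_congr rfl fun P hP => ?_
  obtain ⟨hPi, hPm, hPd⟩ := hmem.1 hP
  have hd0 : 0 < P.natDegree := hPi.natDegree_pos
  have hpow : ∀ j, P ^ j ∣ h ↔ j ≤ (normalizedFactors h).count P := by
    intro j
    rw [pow_dvd_iff_le_emultiplicity,
      emultiplicity_eq_count_normalizedFactors hPi hm.ne_zero, hPm.normalize_eq_self,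
      Nat.cast_le]
  have hle : ∀ j, P ^ j ∣ h → j * P.natDegree ≤ n := by
    intro j hj
    rw [← hn, ← natDegree_pow]
    exact natDegree_le_of_dvd hj hm.ne_zero
  rw [← Finset.sum_filter, Finset.sum_const, smul_eq_mul]
  congr 1
  rw [← Nat.add_sub_cancel ((normalizedFactors h).count P) 1, ← Nat.card_Icc]
  symm
  refine Finset.card_bij (fun j _ => j * P.natDegree) ?_ ?_ ?_
  · intro j hj
    rw [Finset.mem_Icc] at hj
    have := (hpow j).2 hj.2
    simp only [Finset.mem_filter, Finset.mem_Icc, dvd_mul_left, true_and, Nat.mul_div_cancel _ hd0]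
    exact ⟨⟨Nat.mul_pos hj.1 hd0, hle j this⟩, this⟩
  · intro i _ j _ hij
    exact Nat.eq_of_mul_eq_mul_right hd0 hij
  · intro k hk
    simp only [Finset.mem_filter, Finset.mem_Icc] at hk
    obtain ⟨⟨hk1, hk2⟩, ⟨c, rfl⟩, hk3⟩ := hk
    rw [Nat.mul_div_cancel_left _ hd0, hpow] at hk3
    refine ⟨c, Finset.mem_Icc.2 ⟨?_, hk3⟩, mul_comm _ _⟩
    rcases c with - | c
    · simp at hk1
    · omega

theorem natCast_mul_sum_monicsOfDegree {F : Type*} [Field F] [Finite F]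
    {L : ℕ → Type*} [∀ k, Field (L k)] [∀ k, Fintype (L k)] [∀ k, Algebra F (L k)]
    (hL : ∀ k, k ≠ 0 → Module.finrank F (L k) = k) {lam : F[X] → ℂ}
    (hlam : ∀ g h : F[X], g.Monic → h.Monic → lam (g * h) = lam g * lam h) (n : ℕ) :
    n * ∑ h ∈ monicsOfDegree F n, lam h = ∑ k ∈ Finset.Icc 1 n,
      (∑ α : L k, lam (minpoly F α ^ (k / (minpoly F α).natDegree))) *
        ∑ h ∈ monicsOfDegree F (n - k), lam h := by
  classical
  have h1 : ∀ h ∈ monicsOfDegree F n, (n : ℂ) * lam h = ∑ k ∈ Finset.Icc 1 n, ∑ α : L k,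
      if minpoly F α ^ (k / (minpoly F α).natDegree) ∣ h then lam h else 0 := by
    intro h hh
    rw [mem_monicsOfDegree] at hh
    conv_lhs => rw [← sum_card_filter_minpoly_pow_dvd hL hh.1 hh.2]
    rw [Nat.cast_sum, Finset.sum_mul]
    refine Finset.sum_congr rfl fun k _ => ?_
    rw [← Finset.sum_filter, Finset.sum_const, nsmul_eq_mul]
  rw [Finset.mul_sum, Finset.sum_congr rfl h1, Finset.sum_comm]
  refine Finset.sum_congr rfl fun k hk => ?_
  rw [Finset.sum_comm, Finset.sum_mul]
  refine Finset.sum_congr rfl fun α _ => ?_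
  rw [Finset.mem_Icc] at hk
  have hk0 : k ≠ 0 := by omega
  have : FiniteDimensional F (L k) := Module.Finite.of_finite
  have hi := Algebra.IsIntegral.isIntegral (R := F) α
  have hdvd : (minpoly F α).natDegree ∣ k := by
    have := minpoly.degree_dvd (K := F) hi
    rwa [hL k hk0] at this
  set Q := minpoly F α ^ (k / (minpoly F α).natDegree) with hQ
  have hQm : Q.Monic := (minpoly.monic hi).pow _
  have hQd : Q.natDegree = k := by
    rw [hQ, natDegree_pow, Nat.div_mul_cancel hdvd]
  rw [← Finset.sum_filter, Finset.mul_sum]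
  symm
  refine Finset.sum_bij (fun g _ => Q * g) ?_ ?_ ?_ ?_
  · intro g hg
    rw [mem_monicsOfDegree] at hg
    simp only [Finset.mem_filter, mem_monicsOfDegree, dvd_mul_right, and_true]
    refine ⟨hQm.mul hg.1, ?_⟩
    rw [hQm.natDegree_mul hg.1, hQd, hg.2]
    omega
  · intro g _ g' _ h
    exact mul_left_cancel₀ hQm.ne_zero h
  · intro h hh
    simp only [Finset.mem_filter, mem_monicsOfDegree] at hh
    obtain ⟨⟨hm, hn⟩, g, rfl⟩ := hh
    have hg := hQm.of_mul_monic_left hm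
    refine ⟨g, mem_monicsOfDegree.2 ⟨hg, ?_⟩, rfl⟩
    rw [hQm.natDegree_mul hg, hQd] at hn
    omega
  · intro g hg
    rw [hlam _ _ hQm (mem_monicsOfDegree.1 hg).1]

/-- The completely multiplicative weight on monic polynomials attached to a multiplicative character,
an additive character and a finite set of shifts. -/
noncomputable def charWeight {F : Type*} [Field F] (χ : MulChar F ℂ) (ψ : AddChar F ℂ)
    (S : Finset F) (h : F[X]) : ℂ :=
  χ (∏ b ∈ S, (-1) ^ h.natDegree * h.eval b) * ψ (-h.nextCoeff)

theorem charWeight_mul {F : Type*} [Field F] (χ : MulChar F ℂ) (ψ : AddChar F ℂ) (S : Finset F)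
    (g h : F[X]) (hg : g.Monic) (hh : h.Monic) :
    charWeight χ ψ S (g * h) = charWeight χ ψ S g * charWeight χ ψ S h := by
  have e : ∏ b ∈ S, ((-1) ^ (g * h).natDegree * (g * h).eval b) =
      (∏ b ∈ S, ((-1) ^ g.natDegree * g.eval b)) * ∏ b ∈ S, ((-1) ^ h.natDegree * h.eval b) := by
    rw [← Finset.prod_mul_distrib]
    refine Finset.prod_congr rfl fun b _ => ?_
    rw [hg.natDegree_mul hh, eval_mul]
    ring
  rw [charWeight, charWeight, charWeight, e, map_mul, hg.nextCoeff_mul hh, neg_add,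
    AddChar.map_add_eq_mul]
  ring

theorem sum_charWeight_eq_zero {F : Type*} [Field F] [Finite F] {χ : MulChar F ℂ} (hχ : χ ≠ 1)
    (ψ : AddChar F ℂ) {S : Finset F} (hS : S.Nonempty) {n : ℕ} (hn : S.card < n) :
    ∑ h ∈ monicsOfDegree F n, charWeight χ ψ S h = 0 := by
  classical
  obtain ⟨b₀, hb₀⟩ := hS
  obtain ⟨w, hw⟩ := MulChar.ne_one_iff.1 hχ
  set B : F[X] := Lagrange.basis S id b₀ with hB
  have hBd : B.natDegree + 1 < n := by
    have := Lagrange.natDegree_basis (s := S) (v := id) (Function.injective_id.injOn) hb₀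
    rw [← hB] at this
    have hpos := Finset.card_pos.2 ⟨b₀, hb₀⟩
    omega
  have hB0 : B.eval b₀ = 1 := Lagrange.eval_basis_self (v := id) Function.injective_id.injOn hb₀
  have hB1 : ∀ b ∈ S, b ≠ b₀ → B.eval b = 0 := fun b hb hne =>
    Lagrange.eval_basis_of_ne (v := id) hne.symm hb
  let T : Fˣ → F[X] → F[X] := fun v h => h + C ((v - 1) * h.eval b₀) * B
  have hdeg : ∀ (c : F), (C c * B).natDegree + 1 < n := fun c =>
    lt_of_le_of_lt (Nat.add_le_add_right (natDegree_C_mul_le _ _) 1) hBd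
  have hTm : ∀ v, ∀ h ∈ monicsOfDegree F n, T v h ∈ monicsOfDegree F n := by
    intro v h hh
    rw [mem_monicsOfDegree] at hh ⊢
    have hlt : (C ((v - 1) * h.eval b₀) * B).natDegree < h.natDegree := by
      have := hdeg ((v - 1) * h.eval b₀)
      omega
    refine ⟨hh.1.add_of_left (degree_lt_degree hlt), ?_⟩
    rw [natDegree_add_eq_left_of_natDegree_lt hlt, hh.2]
  have hTe : ∀ v h, (T v h).eval b₀ = v * h.eval b₀ := by
    intro v h
    simp only [T, eval_add, eval_mul, eval_C, hB0]
    ring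
  have hTe' : ∀ v h, ∀ b ∈ S, b ≠ b₀ → (T v h).eval b = h.eval b := by
    intro v h b hb hne
    simp only [T, eval_add, eval_mul, eval_C, hB1 b hb hne]
    ring
  have hTT : ∀ v u h, T v (T u h) = T (v * u) h := by
    intro v u h
    have : T v (T u h) = T u h + C ((v - 1) * (T u h).eval b₀) * B := rfl
    rw [this, hTe]
    simp only [T, Units.val_mul, C_mul, C_sub, C_1]
    ring
  have hT1 : ∀ h, T 1 h = h := fun h => by simp [T]
  have key : ∀ h ∈ monicsOfDegree F n, charWeight χ ψ S (T w h) = χ w * charWeight χ ψ S h := by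
    intro h hh
    have h1 := mem_monicsOfDegree.1 hh
    have h2 := mem_monicsOfDegree.1 (hTm w h hh)
    have e1 : (T w h).nextCoeff = h.nextCoeff := by
      have hn0 : 0 < n := by omega
      rw [nextCoeff_of_natDegree_pos (by omega), nextCoeff_of_natDegree_pos (by omega), h1.2, h2.2]
      simp only [T, coeff_add]
      rw [add_eq_left, coeff_eq_zero_of_natDegree_lt]
      have := hdeg ((w - 1) * h.eval b₀)
      omega
    have e2 : ∏ b ∈ S, ((-1) ^ (T w h).natDegree * (T w h).eval b) =
        w * ∏ b ∈ S, ((-1) ^ h.natDegree * h.eval b) := by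
      rw [← Finset.mul_prod_erase _ _ hb₀, ← Finset.mul_prod_erase _ _ hb₀, hTe, h1.2, h2.2]
      rw [Finset.prod_congr rfl fun b hb => by
        rw [hTe' w h b (Finset.mem_of_mem_erase hb) (Finset.ne_of_mem_erase hb)]]
      ring
    rw [charWeight, charWeight, e1, e2, map_mul]
    ring
  have e : ∑ h ∈ monicsOfDegree F n, charWeight χ ψ S h =
      χ w * ∑ h ∈ monicsOfDegree F n, charWeight χ ψ S h := by
    rw [Finset.mul_sum, ← Finset.sum_congr rfl key]
    symm
    refine Finset.sum_nbij' (T w) (T w⁻¹) (hTm w) (hTm _) ?_ ?_ fun _ _ => rfl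
    · intro h _
      rw [hTT, inv_mul_cancel, hT1]
    · intro h _
      rw [hTT, mul_inv_cancel, hT1]
  have : (χ w - 1) * ∑ h ∈ monicsOfDegree F n, charWeight χ ψ S h = 0 := by
    rw [sub_mul, ← e]
    ring
  exact (mul_eq_zero.1 this).resolve_left (sub_ne_zero.2 hw)

theorem charWeight_minpoly_pow {F L : Type*} [Field F] [Field L] [Algebra F L]
    [FiniteDimensional F L] (χ : MulChar F ℂ) (ψ : AddChar F ℂ) (S : Finset F) (α : L) :
    charWeight χ ψ S (minpoly F α ^ (Module.finrank F L / (minpoly F α).natDegree)) =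
      χ (Algebra.norm F (∏ b ∈ S, (α - algebraMap F L b))) * ψ (Algebra.trace F L α) := by
  have hi := Algebra.IsIntegral.isIntegral (R := F) α
  have hpos := minpoly.natDegree_pos hi
  have hfin : ∀ β : L, (minpoly F β).natDegree = (minpoly F α).natDegree →
      Module.finrank (IntermediateField.adjoin F {β}) L =
      Module.finrank F L / (minpoly F α).natDegree := by
    intro β hβ
    have := Module.finrank_mul_finrank F (IntermediateField.adjoin F {β}) L
    rw [IntermediateField.adjoin.finrank (Algebra.IsIntegral.isIntegral (R := F) β), hβ] at this
    rw [← this, Nat.mul_div_cancel_left _ hpos]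
  have hnorm : ∀ b : F, Algebra.norm F (α - algebraMap F L b) =
      ((-1) ^ (minpoly F α).natDegree * (minpoly F α).eval b) ^
        (Module.finrank F L / (minpoly F α).natDegree) := by
    intro b
    have hβ := Algebra.IsIntegral.isIntegral (R := F) (α - algebraMap F L b)
    have hd : (minpoly F (α - algebraMap F L b)).natDegree = (minpoly F α).natDegree := by
      rw [minpoly.sub_algebraMap, natDegree_comp, natDegree_X_add_C, mul_one]
    rw [Algebra.norm_eq_norm_adjoin, hfin _ hd, ← IntermediateField.adjoin.powerBasis_gen hβ,
      Algebra.PowerBasis.norm_gen_eq_coeff_zero_minpoly, IntermediateField.adjoin.powerBasis_dim,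
      IntermediateField.adjoin.powerBasis_gen hβ, IntermediateField.minpoly_gen, hd,
      minpoly.sub_algebraMap, coeff_zero_eq_eval_zero, eval_comp]
    simp
  rw [charWeight]
  congr 2
  · rw [map_prod]
    refine Finset.prod_congr rfl fun b _ => ?_
    rw [hnorm, natDegree_pow, eval_pow, mul_pow, ← pow_mul, mul_comm (Module.finrank F L / _)]
  · rw [trace_eq_finrank_mul_minpoly_nextCoeff, (minpoly.monic hi).nextCoeff_pow, hfin α rfl,
      nsmul_eq_mul]
    ring

theorem exists_sum_mulChar_addChar_eq_neg_sum_pow {F : Type*} [Field F] [Finite F]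
    {L : ℕ → Type*} [∀ k, Field (L k)] [∀ k, Fintype (L k)] [∀ k, Algebra F (L k)]
    (hL : ∀ k, k ≠ 0 → Module.finrank F (L k) = k) {χ : MulChar F ℂ} (hχ : χ ≠ 1)
    (ψ : AddChar F ℂ) {S : Finset F} (hS : S.Nonempty) :
    ∃ ω : Fin S.card → ℂ, ∀ k, 1 ≤ k →
      ∑ α : L k, χ (Algebra.norm F (∏ b ∈ S, (α - algebraMap F (L k) b))) *
        ψ (Algebra.trace F (L k) α) = -∑ i, ω i ^ k := by
  classical
  have h0 : monicsOfDegree F 0 = {1} := by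
    ext h
    rw [mem_monicsOfDegree, Finset.mem_singleton]
    constructor
    · rintro ⟨h1, h2⟩
      exact h1.natDegree_eq_zero.1 h2
    · rintro rfl
      exact ⟨monic_one, natDegree_one⟩
  obtain ⟨ω, hω⟩ := exists_eq_neg_sum_pow_of_recurrence
    (a := fun n => ∑ h ∈ monicsOfDegree F n, charWeight χ ψ S h)
    (c := fun k => ∑ α : L k,
      charWeight χ ψ S (minpoly F α ^ (k / (minpoly F α).natDegree))) (d := S.card)
    (by simp [h0, charWeight, nextCoeff])
    (fun n hn => sum_charWeight_eq_zero hχ ψ hS hn)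
    (natCast_mul_sum_monicsOfDegree hL (charWeight_mul χ ψ S))
  refine ⟨ω, fun k hk => ?_⟩
  rw [← hω k hk]
  refine Finset.sum_congr rfl fun α _ => ?_
  have : FiniteDimensional F (L k) := Module.Finite.of_finite
  have := charWeight_minpoly_pow χ ψ S α
  rw [hL k (by omega)] at this
  exact this.symm

noncomputable instance (p : ℕ) [Fact p.Prime] (k : ℕ) : Fintype (GaloisField p k) :=
  Fintype.ofFinite _

theorem card_filter_trace_eq_zero {p : ℕ} [Fact p.Prime] {L : Type*} [Field L] [Fintype L]
    [Algebra (ZMod p) L] :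
    p * (Finset.univ.filter fun x : L => Algebra.trace (ZMod p) L x = 0).card =
      Fintype.card L := by
  classical
  have : FiniteDimensional (ZMod p) L := Module.Finite.of_finite
  have h := Submodule.card_eq_card_quotient_mul_card (LinearMap.ker (Algebra.trace (ZMod p) L))
  rw [Nat.card_congr (LinearMap.quotKerEquivOfSurjective _
    (Algebra.trace_surjective (ZMod p) L)).toEquiv, Nat.card_zmod, Nat.card_eq_fintype_card] at h
  rw [h, mul_comm, ← Fintype.card_subtype, ← Nat.card_eq_fintype_card]
  rfl

/-- The Artin-Schreier map is `p`-to-one onto the trace zero elements. -/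
theorem sum_artinSchreier {p : ℕ} [Fact p.Prime] {L : Type*} [Field L] [Fintype L]
    [Algebra (ZMod p) L] (g : L → ℂ) :
    ∑ z : L, g (z ^ p - z) =
      p * ∑ x ∈ Finset.univ.filter fun x : L => Algebra.trace (ZMod p) L x = 0, g x := by
  classical
  have : FiniteDimensional (ZMod p) L := Module.Finite.of_finite
  have hp : p.Prime := Fact.out
  set Z := Finset.univ.filter fun x : L => Algebra.trace (ZMod p) L x = 0 with hZ
  have hmaps : ∀ z ∈ (Finset.univ : Finset L), z ^ p - z ∈ Z := by
    intro z _
    rw [hZ, Finset.mem_filter, map_sub, sub_eq_zero]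
    refine ⟨Finset.mem_univ _, ?_⟩
    have h := Algebra.trace_eq_of_algEquiv (FiniteField.frobeniusAlgEquivOfAlgebraic (ZMod p) L) z
    rwa [FiniteField.coe_frobeniusAlgEquivOfAlgebraic, ZMod.card] at h
  have hle : ∀ x ∈ Z, (Finset.univ.filter fun z : L => z ^ p - z = x).card ≤ p := by
    intro x _
    have hd : (X ^ p - X - C x : L[X]).natDegree = p := by
      rw [natDegree_sub_C, natDegree_sub_eq_left_of_natDegree_lt] <;>
        simp [hp.one_lt]
    have h0 : (X ^ p - X - C x : L[X]) ≠ 0 := by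
      intro h
      rw [h, natDegree_zero] at hd
      exact hp.ne_zero hd.symm
    calc _ ≤ (X ^ p - X - C x : L[X]).roots.toFinset.card := by
          refine Finset.card_le_card fun z hz => ?_
          rw [Finset.mem_filter] at hz
          rw [Multiset.mem_toFinset, mem_roots h0, IsRoot.def]
          simp [hz.2]
      _ ≤ _ := (Multiset.toFinset_card_le _).trans ((card_roots' _).trans hd.le)
  have heq : ∀ x ∈ Z, (Finset.univ.filter fun z : L => z ^ p - z = x).card = p := by
    rw [← Finset.sum_eq_sum_iff_of_le hle, ← Finset.card_eq_sum_card_fiberwise hmaps,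
      Finset.sum_const, smul_eq_mul, mul_comm, card_filter_trace_eq_zero, Finset.card_univ]
  rw [← Finset.sum_fiberwise_of_maps_to hmaps, Finset.mul_sum]
  refine Finset.sum_congr rfl fun x hx => ?_
  rw [Finset.sum_congr rfl (g := fun _ => g x), Finset.sum_const, heq x hx, nsmul_eq_mul]
  intro z hz
  rw [(Finset.mem_filter.1 hz).2]

theorem sum_addChar_sum_mulChar_norm {p : ℕ} [Fact p.Prime] {L : Type*} [Field L] [Fintype L]
    [Algebra (ZMod p) L] (χ : MulChar (ZMod p) ℂ) (S : Finset (ZMod p)) :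
    ∑ ψ : AddChar (ZMod p) ℂ, ∑ α : L, χ (Algebra.norm (ZMod p)
        (∏ b ∈ S, (α - algebraMap (ZMod p) L b))) * ψ (Algebra.trace (ZMod p) L α) =
      ∑ z : L, χ (Algebra.norm (ZMod p) (∏ b ∈ S, (z ^ p - z - algebraMap (ZMod p) L b))) := by
  classical
  rw [sum_artinSchreier fun x => χ (Algebra.norm (ZMod p)
        (∏ b ∈ S, (x - algebraMap (ZMod p) L b))), Finset.sum_comm, Finset.mul_sum,
        Finset.sum_filter]
  refine Finset.sum_congr rfl fun x _ => ?_
  rw [← Finset.mul_sum, AddChar.sum_apply_eq_ite, ZMod.card]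
  split_ifs
  · ring
  · rw [mul_zero]

theorem norm_sum_mulChar_mul_addChar_le_of_zero_mem {p : ℕ} [Fact p.Prime]
    {χ : MulChar (ZMod p) ℂ} (hχ : χ ≠ 1) (ψ : AddChar (ZMod p) ℂ) {S : Finset (ZMod p)}
    (hS : 0 ∈ S) :
    ‖∑ x : ZMod p, χ (∏ b ∈ S, (x - b)) * ψ x‖ ≤ S.card * √p := by
  classical
  have hp : p.Prime := Fact.out
  have hp0 : (0 : ℝ) < p := by exact_mod_cast hp.pos
  choose ω hω using fun ψ : AddChar (ZMod p) ℂ =>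
    exists_sum_mulChar_addChar_eq_neg_sum_pow (L := fun k => GaloisField p k)
      (fun k hk => GaloisField.finrank p hk) hχ ψ ⟨0, hS⟩
  obtain ⟨n₀, hn₀⟩ := pow_unbounded_of_one_lt (2 * (S.card * p) + 6) hp.one_lt
  have hbd : ∀ n, max n₀ 1 ≤ n → ‖∑ i : AddChar (ZMod p) ℂ × Fin S.card, (ω i.1 i.2 ^ 2) ^ n‖ ≤
      ((p * (2 * (S.card * p) + 4) + S.card * p : ℕ) : ℝ) * (p : ℝ) ^ n := by
    intro n hn
    have hn1 : 1 ≤ n := (le_max_right _ _).trans hn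
    have hc : Fintype.card (GaloisField p (2 * n)) = (p ^ n) ^ 2 := by
      rw [← Nat.card_eq_fintype_card, GaloisField.card p _ (by omega), ← pow_mul, mul_comm]
    have h := norm_sum_mulChar_norm_prod_artinSchreier_le hc hχ S hS
      (hn₀.le.trans (Nat.pow_le_pow_right hp.pos ((le_max_left _ _).trans hn)))
    rw [← sum_addChar_sum_mulChar_norm, Finset.sum_congr rfl fun ψ _ => hω ψ (2 * n) (by omega),
      Finset.sum_neg_distrib, norm_neg] at h
    rw [Fintype.sum_prod_type]
    simp only [← pow_mul]
    refine h.trans (le_of_eq ?_)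
    push_cast
    ring
  have hω2 : ∀ i, ‖ω ψ i‖ ≤ √p := by
    intro i
    have := norm_le_of_forall_norm_sum_pow_le hp0 hbd (ψ, i)
    rw [norm_pow] at this
    exact Real.le_sqrt_of_sq_le this
  have h1 := hω ψ 1 le_rfl
  have h2 : ∑ x : ZMod p, χ (∏ b ∈ S, (x - b)) * ψ x = -∑ i, ω ψ i ^ 1 := by
    rw [← h1]
    refine (Fintype.sum_equiv (GaloisField.equivZmodP p).toEquiv _ _ fun α => ?_).symm
    have e1 := Algebra.trace_eq_of_algEquiv (GaloisField.equivZmodP p) α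
    rw [Algebra.trace_self_apply] at e1
    have e2 := Algebra.norm_eq_of_algEquiv (GaloisField.equivZmodP p)
      (∏ b ∈ S, (α - algebraMap (ZMod p) (GaloisField p 1) b))
    rw [Algebra.norm_self, MonoidHom.id_apply] at e2
    rw [← e1, ← e2, map_prod]
    simp
  rw [h2, norm_neg]
  refine (norm_sum_le _ _).trans ?_
  simp only [pow_one]
  refine (Finset.sum_le_sum fun i _ => hω2 i).trans ?_
  simp

/-- Weil's bound for mixed character sums with a product of distinct linear factors. -/
theorem norm_sum_mulChar_mul_addChar_le {p : ℕ} [Fact p.Prime]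
    {χ : MulChar (ZMod p) ℂ} (hχ : χ ≠ 1) (ψ : AddChar (ZMod p) ℂ) {S : Finset (ZMod p)}
    (hS : S.Nonempty) :
    ‖∑ x : ZMod p, χ (∏ b ∈ S, (x - b)) * ψ x‖ ≤ S.card * √p := by
  classical
  obtain ⟨b₀, hb₀⟩ := hS
  have hinj : Function.Injective fun b : ZMod p => b - b₀ := sub_left_injective
  have h := norm_sum_mulChar_mul_addChar_le_of_zero_mem hχ ψ (S := S.image fun b => b - b₀)
    (Finset.mem_image.2 ⟨b₀, hb₀, sub_self _⟩)
  rw [Finset.card_image_of_injective _ hinj] at h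
  have e : ∑ x : ZMod p, χ (∏ b ∈ S, (x - b)) * ψ x =
      (∑ x : ZMod p, χ (∏ b ∈ S.image fun b => b - b₀, (x - b)) * ψ x) * ψ b₀ := by
    rw [Finset.sum_mul, ← Equiv.sum_comp (Equiv.addRight b₀)]
    refine Finset.sum_congr rfl fun x _ => ?_
    rw [Finset.prod_image hinj.injOn, Equiv.coe_addRight, AddChar.map_add_eq_mul, ← mul_assoc]
    congr 4
    ext b
    ring
  rw [e, norm_mul, AddChar.norm_apply, mul_one]
  exact h

theorem norm_sum_Ico_pow_le {ζ : ℂ} (h1 : ‖ζ‖ = 1) (hζ : ζ ≠ 1) (u v : ℕ) :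
    ‖∑ n ∈ Finset.Ico u v, ζ ^ n‖ ≤ 2 / ‖ζ - 1‖ := by
  have hpos : 0 < ‖ζ - 1‖ := norm_pos_iff.2 (sub_ne_zero.2 hζ)
  rcases le_total u v with h | h
  · rw [geom_sum_Ico hζ h, norm_div]
    gcongr
    refine (norm_sub_le _ _).trans ?_
    rw [norm_pow, norm_pow, h1, one_pow, one_pow]
    norm_num
  · rw [Finset.Ico_eq_empty_of_le h, Finset.sum_empty, norm_zero]
    positivity

theorem two_div_norm_stdAddChar_sub_one_le {p : ℕ} [NeZero p] {t : ℕ} (ht : 0 < t) (htp : t < p) :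
    2 / ‖ZMod.stdAddChar (t : ZMod p) - 1‖ ≤ p / 2 * (1 / (t : ℝ) + 1 / ((p - t : ℕ) : ℝ)) := by
  have hp : (0 : ℝ) < p := by exact_mod_cast (by omega : 0 < p)
  have ht' : (0 : ℝ) < t := by exact_mod_cast ht
  have hpt : (0 : ℝ) < (p - t : ℕ) := by exact_mod_cast (by omega : 0 < p - t)
  have hadd : (t : ℝ) + (p - t : ℕ) = p := by exact_mod_cast (by omega : t + (p - t) = p)
  have hn : ‖ZMod.stdAddChar (t : ZMod p) - 1‖ = 2 * Real.sin (Real.pi * t / p) := by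
    have e : (ZMod.stdAddChar (t : ZMod p) : ℂ) =
        Complex.exp (Complex.I * (2 * Real.pi * t / p : ℝ)) := by
      rw [ZMod.stdAddChar_apply, ZMod.toCircle_natCast]
      congr 1
      push_cast
      ring
    rw [e, Complex.norm_exp_I_mul_ofReal_sub_one, Real.norm_eq_abs, abs_of_nonneg]
    · congr 2
      ring
    · refine mul_nonneg zero_le_two (Real.sin_nonneg_of_nonneg_of_le_pi (by positivity) ?_)
      rw [div_div, div_le_iff₀ (by positivity)]
      nlinarith [Real.pi_pos]
  have key : ∀ s : ℝ, 0 < s → s ≤ p / 2 → 2 * s / p ≤ Real.sin (Real.pi * s / p) := by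
    intro s hs hsp
    have := Real.mul_le_sin (x := Real.pi * s / p) (by positivity) (by
      rw [div_le_iff₀ hp]
      nlinarith [Real.pi_pos])
    refine le_trans (le_of_eq ?_) this
    field_simp
  have hsym : Real.sin (Real.pi * t / p) = Real.sin (Real.pi * ((p - t : ℕ) : ℝ) / p) := by
    rw [← Real.sin_pi_sub]
    congr 1
    field_simp
    linarith
  rw [hn]
  have main : ∀ s : ℝ, 0 < s → 2 * s / p ≤ Real.sin (Real.pi * t / p) →
      2 / (2 * Real.sin (Real.pi * t / p)) ≤ p / 2 * (1 / s) := by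
    intro s hs h
    have : 0 < 2 * s / p := by positivity
    calc 2 / (2 * Real.sin (Real.pi * t / p)) ≤ 2 / (2 * (2 * s / p)) := by gcongr
      _ = _ := by field_simp
  rcases le_total (t : ℝ) (p / 2) with h | h
  · refine (main t ht' (key t ht' h)).trans ?_
    gcongr
    linarith [show (0:ℝ) ≤ 1 / ((p - t : ℕ) : ℝ) by positivity]
  · refine (main _ hpt (hsym ▸ key _ hpt (by linarith))).trans ?_
    gcongr
    linarith [show (0:ℝ) ≤ 1 / (t : ℝ) by positivity]

theorem sum_norm_sum_Ico_stdAddChar_le {p : ℕ} [Fact p.Prime] {u v : ℕ} (h : v - u ≤ p) :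
    ∑ t : ZMod p, ‖∑ n ∈ Finset.Ico u v, ZMod.stdAddChar (t * (n : ZMod p))‖ ≤ p * (2 + Real.log p) := by
  have hp : p.Prime := Fact.out
  have e1 : ∑ t : ZMod p, ‖∑ n ∈ Finset.Ico u v, ZMod.stdAddChar (t * (n : ZMod p))‖ =
      ∑ t ∈ Finset.range p, ‖∑ n ∈ Finset.Ico u v, ZMod.stdAddChar ((t : ZMod p) * (n : ZMod p))‖ := by
    refine Finset.sum_bij' (fun t _ => t.val) (fun t _ => (t : ZMod p)) ?_ ?_ ?_ ?_ ?_
    · intro t _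
      exact Finset.mem_range.2 (ZMod.val_lt t)
    · intro t _
      exact Finset.mem_univ _
    · intro t _
      simp
    · intro t ht
      exact ZMod.val_cast_of_lt (Finset.mem_range.1 ht)
    · intro t _
      simp
  rw [e1, Finset.range_eq_Ico, Finset.sum_eq_sum_Ico_succ_bot hp.pos]
  have b0 : ‖∑ n ∈ Finset.Ico u v, ZMod.stdAddChar (((0 : ℕ) : ZMod p) * (n : ZMod p))‖ ≤ p := by
    simp only [Nat.cast_zero, zero_mul, AddChar.map_zero_eq_one, Finset.sum_const, Nat.card_Ico,
      nsmul_eq_mul, mul_one, Complex.norm_natCast]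
    exact_mod_cast h
  have b1 : ∀ t ∈ Finset.Ico (0 + 1) p,
      ‖∑ n ∈ Finset.Ico u v, ZMod.stdAddChar ((t : ZMod p) * (n : ZMod p))‖ ≤
        p / 2 * (1 / (t : ℝ) + 1 / ((p - t : ℕ) : ℝ)) := by
    intro t ht
    rw [Finset.mem_Ico] at ht
    refine le_trans ?_ (two_div_norm_stdAddChar_sub_one_le (by omega) ht.2)
    have hne : (ZMod.stdAddChar (t : ZMod p) : ℂ) ≠ 1 := by
      rw [← AddChar.map_zero_eq_one (ZMod.stdAddChar (N := p)), ZMod.injective_stdAddChar.ne_iff]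
      rw [Ne, ZMod.natCast_eq_zero_iff]
      exact Nat.not_dvd_of_pos_of_lt (by omega) ht.2
    have := norm_sum_Ico_pow_le (AddChar.norm_apply _ _) hne u v
    refine le_trans (le_of_eq ?_) this
    congr 1
    refine Finset.sum_congr rfl fun n _ => ?_
    rw [← AddChar.map_nsmul_eq_pow, nsmul_eq_mul, mul_comm]
  have hh : ∑ t ∈ Finset.Ico (0 + 1) p, 1 / (t : ℝ) ≤ 1 + Real.log p := by
    have := harmonic_le_one_add_log (p - 1)
    rw [harmonic_eq_sum_Icc] at this
    push_cast at this
    calc _ = ∑ i ∈ Finset.Icc 1 (p - 1), (i : ℝ)⁻¹ := by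
          refine Finset.sum_congr ?_ fun _ _ => one_div _
          ext i
          have := hp.pos
          simp only [Finset.mem_Ico, Finset.mem_Icc]
          omega
      _ ≤ _ := this
      _ ≤ 1 + Real.log p := by
          gcongr
          · exact_mod_cast Nat.sub_pos_of_lt hp.one_lt
          · omega
  have hh' : ∑ t ∈ Finset.Ico (0 + 1) p, 1 / ((p - t : ℕ) : ℝ) =
      ∑ t ∈ Finset.Ico (0 + 1) p, 1 / (t : ℝ) := by
    refine Finset.sum_nbij' (fun t => p - t) (fun t => p - t) ?_ ?_ ?_ ?_ ?_ <;>
      intro t ht <;> simp only [Finset.mem_Ico] at ht ⊢ <;> omega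
  calc _ ≤ (p : ℝ) + ∑ t ∈ Finset.Ico (0 + 1) p, p / 2 * (1 / (t : ℝ) + 1 / ((p - t : ℕ) : ℝ)) :=
        add_le_add b0 (Finset.sum_le_sum b1)
    _ = p + p / 2 * (2 * ∑ t ∈ Finset.Ico (0 + 1) p, 1 / (t : ℝ)) := by
        rw [← Finset.mul_sum, Finset.sum_add_distrib, hh']
        ring
    _ ≤ p + p / 2 * (2 * (1 + Real.log p)) := by gcongr
    _ = _ := by ring

/-- Incomplete character sums along products of distinct linear factors. -/
theorem norm_sum_Ico_mulChar_prod_le {p : ℕ} [Fact p.Prime] {χ : MulChar (ZMod p) ℂ} (hχ : χ ≠ 1)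
    {S : Finset (ZMod p)} (hS : S.Nonempty) {u v : ℕ} (h : v - u ≤ p) :
    ‖∑ n ∈ Finset.Ico u v, χ (∏ b ∈ S, ((n : ZMod p) - b))‖ ≤
      S.card * √p * (2 + Real.log p) := by
  classical
  have hp : p.Prime := Fact.out
  have hp0 : (0 : ℝ) < p := by exact_mod_cast hp.pos
  have e : (p : ℂ) * ∑ n ∈ Finset.Ico u v, χ (∏ b ∈ S, ((n : ZMod p) - b)) =
      ∑ t : ZMod p, (∑ x : ZMod p, χ (∏ b ∈ S, (x - b)) *
        (ZMod.stdAddChar.mulShift (-t)) x) * ∑ n ∈ Finset.Ico u v, ZMod.stdAddChar (t * (n : ZMod p)) := by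
    simp only [Finset.sum_mul_sum]
    rw [Finset.mul_sum, Finset.sum_comm]
    trans ∑ n ∈ Finset.Ico u v, ∑ x : ZMod p, ∑ t : ZMod p, χ (∏ b ∈ S, (x - b)) *
        (ZMod.stdAddChar.mulShift (-t)) x * ZMod.stdAddChar (t * (n : ZMod p))
    swap
    · rw [Finset.sum_comm]
      exact Finset.sum_congr rfl fun x _ => Finset.sum_comm
    refine Finset.sum_congr rfl fun n _ => ?_
    have : ∀ x : ZMod p, ∑ t : ZMod p, χ (∏ b ∈ S, (x - b)) *
        (ZMod.stdAddChar.mulShift (-t)) x * ZMod.stdAddChar (t * (n : ZMod p)) =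
        if (n : ZMod p) - x = 0 then p * χ (∏ b ∈ S, (x - b)) else 0 := by
      intro x
      have h1 : ∀ t : ZMod p, χ (∏ b ∈ S, (x - b)) *
        (ZMod.stdAddChar.mulShift (-t)) x * ZMod.stdAddChar (t * (n : ZMod p)) =
          χ (∏ b ∈ S, (x - b)) * ZMod.stdAddChar (t * ((n : ZMod p) - x)) := by
        intro t
        rw [mul_assoc, AddChar.mulShift_apply, ← AddChar.map_add_eq_mul]
        congr 2
        ring
      rw [Finset.sum_congr rfl fun t _ => h1 t, ← Finset.mul_sum,
        AddChar.sum_mulShift _ (ZMod.isPrimitive_stdAddChar p), ZMod.card]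
      split_ifs
      · ring
      · rw [Nat.cast_zero, mul_zero]
    rw [Finset.sum_congr rfl fun x _ => this x]
    simp [sub_eq_zero]
  have hb : p * ‖∑ n ∈ Finset.Ico u v, χ (∏ b ∈ S, ((n : ZMod p) - b))‖ ≤
      S.card * √p * (p * (2 + Real.log p)) := by
    calc _ = ‖(p : ℂ) * ∑ n ∈ Finset.Ico u v, χ (∏ b ∈ S, ((n : ZMod p) - b))‖ := by
          rw [norm_mul, Complex.norm_natCast]
      _ ≤ ∑ t : ZMod p, S.card * √p * ‖∑ n ∈ Finset.Ico u v, ZMod.stdAddChar (t * (n : ZMod p))‖ := by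
          rw [e]
          refine (norm_sum_le _ _).trans (Finset.sum_le_sum fun t _ => ?_)
          rw [norm_mul]
          gcongr
          exact norm_sum_mulChar_mul_addChar_le hχ _ hS
      _ ≤ _ := by
          rw [← Finset.mul_sum]
          gcongr
          exact sum_norm_sum_Ico_stdAddChar_le h
  rw [← mul_le_mul_iff_of_pos_left hp0]
  refine hb.trans (le_of_eq ?_)
  ring

/-- The van der Corput inequality. -/
theorem sq_mul_norm_sum_sq_le {a : ℤ → ℂ} {u v : ℤ} {N K : ℕ} (hN : v - u = N)
    (ha : ∀ n, n ∉ Finset.Ico u v → a n = 0) (ha1 : ∀ n, ‖a n‖ ≤ 1) {M : ℝ} (hM : 0 ≤ M)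
    (hcor : ∀ h : ℕ, 0 < h → h < K →
      ‖∑ n ∈ Finset.Ico u v, a (n + h) * (starRingEnd ℂ) (a n)‖ ≤ M) :
    (K : ℝ) ^ 2 * ‖∑ n ∈ Finset.Ico u v, a n‖ ^ 2 ≤ (N + K) * (K * N + K ^ 2 * M) := by
  have shift : ∀ (f : ℤ → ℂ), (∀ n, n ∉ Finset.Ico u v → f n = 0) → ∀ k : ℕ, k < K →
      ∑ m ∈ Finset.Ico u (v + K), f (m - k) = ∑ n ∈ Finset.Ico u v, f n := by
    intro f hf k hk
    symm
    refine Finset.sum_bij_ne_zero (fun n _ _ => n + k) ?_ ?_ ?_ ?_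
    · intro n hn _
      rw [Finset.mem_Ico] at hn ⊢
      omega
    · intro n _ _ n' _ _ h
      exact add_right_cancel h
    · intro m _ hm0
      refine ⟨m - k, ?_, hm0, sub_add_cancel _ _⟩
      by_contra h
      exact hm0 (hf _ h)
    · intro n _ _
      rw [add_sub_cancel_right]
  have e1 : (K : ℂ) * ∑ n ∈ Finset.Ico u v, a n =
      ∑ m ∈ Finset.Ico u (v + K), ∑ k ∈ Finset.range K, a (m - k) := by
    rw [Finset.sum_comm, Finset.sum_congr rfl fun k hk => shift a ha k (Finset.mem_range.1 hk)]
    simp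
  have hcard : ((Finset.Ico u (v + K)).card : ℝ) = N + K := by
    rw [Int.card_Ico]
    have : (v + K - u).toNat = N + K := by omega
    rw [this]
    push_cast
    rfl
  have e2 : ((∑ m ∈ Finset.Ico u (v + K), ‖∑ k ∈ Finset.range K, a (m - k)‖ ^ 2 : ℝ) : ℂ) =
      ∑ k ∈ Finset.range K, ∑ k' ∈ Finset.range K, ∑ m ∈ Finset.Ico u (v + K),
        a (m - k) * (starRingEnd ℂ) (a (m - k')) := by
    rw [Finset.sum_congr rfl fun k _ => Finset.sum_comm, Finset.sum_comm]
    push_cast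
    refine Finset.sum_congr rfl fun m _ => ?_
    rw [← Complex.mul_conj', map_sum, Finset.sum_mul_sum]
  have hlt : ∀ k k' : ℕ, k < k' → k' < K → ‖∑ m ∈ Finset.Ico u (v + K),
      a (m - k) * (starRingEnd ℂ) (a (m - k'))‖ ≤ M := by
    intro k k' hkk hk'
    have h := shift (fun n => a (n + ((k' - k : ℕ) : ℤ)) * (starRingEnd ℂ) (a n)) (fun n hn => by
      simp only [ha n hn, map_zero, mul_zero]) k' hk'
    refine le_trans (le_of_eq ?_) (hcor (k' - k) (by omega) (by omega))
    rw [← h]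
    congr 1
    refine Finset.sum_congr rfl fun m _ => ?_
    congr 2
    omega
  have e3 : ∀ k ∈ Finset.range K, ∀ k' ∈ Finset.range K,
      ‖∑ m ∈ Finset.Ico u (v + K), a (m - k) * (starRingEnd ℂ) (a (m - k'))‖ ≤
        M + if k = k' then (N : ℝ) else 0 := by
    intro k hk k' hk'
    rw [Finset.mem_range] at hk hk'
    rcases lt_trichotomy k k' with h | rfl | h
    · rw [if_neg h.ne, add_zero]
      exact hlt k k' h hk'
    · rw [if_pos rfl, shift (fun n => a n * (starRingEnd ℂ) (a n)) (fun n hn => by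
        simp only [ha n hn, zero_mul]) k hk]
      refine (norm_sum_le _ _).trans ?_
      have : ∀ n ∈ Finset.Ico u v, ‖a n * (starRingEnd ℂ) (a n)‖ ≤ 1 := by
        intro n _
        rw [norm_mul, RCLike.norm_conj]
        exact mul_le_one₀ (ha1 n) (norm_nonneg _) (ha1 n)
      refine (Finset.sum_le_sum this).trans ?_
      rw [Finset.sum_const, Int.card_Ico, hN]
      simp [hM]
    · rw [if_neg h.ne', add_zero]
      refine le_trans (le_of_eq ?_) (hlt k' k h hk)
      rw [← RCLike.norm_conj, map_sum]
      congr 1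
      refine Finset.sum_congr rfl fun m _ => ?_
      rw [map_mul, Complex.conj_conj, mul_comm]
  calc (K : ℝ) ^ 2 * ‖∑ n ∈ Finset.Ico u v, a n‖ ^ 2
      = ‖∑ m ∈ Finset.Ico u (v + K), ∑ k ∈ Finset.range K, a (m - k)‖ ^ 2 := by
        rw [← e1, norm_mul, Complex.norm_natCast, mul_pow]
    _ ≤ (∑ m ∈ Finset.Ico u (v + K), ‖∑ k ∈ Finset.range K, a (m - k)‖) ^ 2 := by
        gcongr
        exact norm_sum_le _ _
    _ ≤ (Finset.Ico u (v + K)).card *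
          ∑ m ∈ Finset.Ico u (v + K), ‖∑ k ∈ Finset.range K, a (m - k)‖ ^ 2 :=
        sq_sum_le_card_mul_sum_sq
    _ ≤ (N + K) * ∑ k ∈ Finset.range K, ∑ k' ∈ Finset.range K,
          (M + if k = k' then (N : ℝ) else 0) := by
        rw [hcard]
        gcongr
        have h0 : (∑ m ∈ Finset.Ico u (v + K), ‖∑ k ∈ Finset.range K, a (m - k)‖ ^ 2 : ℝ) =
            ‖((∑ m ∈ Finset.Ico u (v + K), ‖∑ k ∈ Finset.range K, a (m - k)‖ ^ 2 : ℝ) : ℂ)‖ := by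
          rw [Complex.norm_real, Real.norm_eq_abs, abs_of_nonneg]
          positivity
        rw [h0, e2]
        refine (norm_sum_le _ _).trans (Finset.sum_le_sum fun k hk => ?_)
        exact (norm_sum_le _ _).trans (Finset.sum_le_sum fun k' hk' => e3 k hk k' hk')
    _ = (N + K) * (K * N + K ^ 2 * M) := by
        congr 1
        simp only [Finset.sum_add_distrib, Finset.sum_const, Finset.card_range, nsmul_eq_mul]
        rw [Finset.sum_congr rfl fun k hk => by
          rw [Finset.sum_ite_eq, if_pos hk]]
        rw [Finset.sum_const, Finset.card_range, nsmul_eq_mul]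
        ring

theorem natCast_factorial_ne_zero {p n : ℕ} (hp : p.Prime) (h : n < p) :
    (n.factorial : ZMod p) ≠ 0 := by
  rw [Ne, ZMod.natCast_eq_zero_iff, hp.dvd_factorial]
  omega

theorem norm_mulChar_eq_one {p : ℕ} [Fact p.Prime] (χ : MulChar (ZMod p) ℂ) {x : ZMod p}
    (hx : x ≠ 0) : ‖χ x‖ = 1 := by
  have : χ x ^ Fintype.card (ZMod p)ˣ = 1 := by
    rw [← map_pow, ← Units.val_mk0 hx, ← Units.val_pow_eq_pow_val, pow_card_eq_one, Units.val_one,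
      map_one]
  exact Complex.norm_eq_one_of_pow_eq_one this Fintype.card_ne_zero

theorem norm_sum_factorial_correlation_le {p : ℕ} [Fact p.Prime] {χ : MulChar (ZMod p) ℂ}
    (hχ : χ ≠ 1) {u v h : ℕ} (hh : 0 < h) (hhp : h < p) (hv : v + h ≤ p) :
    ‖∑ n ∈ Finset.Ico u v, χ ((n + h).factorial : ZMod p) *
      (starRingEnd ℂ) (χ (n.factorial : ZMod p))‖ ≤ h * √p * (2 + Real.log p) := by
  classical
  have hp : p.Prime := Fact.out
  have hinj : Set.InjOn (fun i : ℕ => -((i + 1 : ℕ) : ZMod p)) (Finset.range h) := by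
    intro i hi j hj hij
    simp only [Finset.coe_range, Set.mem_Iio] at hi hj
    have h1 := neg_injective hij
    rw [ZMod.natCast_eq_natCast_iff, Nat.ModEq, Nat.mod_eq_of_lt (by omega),
      Nat.mod_eq_of_lt (by omega)] at h1
    omega
  set S := (Finset.range h).image fun i : ℕ => -((i + 1 : ℕ) : ZMod p) with hS
  have hcard : S.card = h := by
    rw [hS, Finset.card_image_of_injOn hinj, Finset.card_range]
  have hne : S.Nonempty := by
    rw [← Finset.card_pos, hcard]
    exact hh
  have hb := norm_sum_Ico_mulChar_prod_le hχ hne (u := u) (v := v) (by omega)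
  rw [hcard] at hb
  refine le_trans (le_of_eq ?_) hb
  congr 1
  refine Finset.sum_congr rfl fun n hn => ?_
  rw [Finset.mem_Ico] at hn
  have e : ((n + h).factorial : ZMod p) =
      n.factorial * ∏ b ∈ S, ((n : ZMod p) - b) := by
    rw [hS, Finset.prod_image hinj, ← Nat.factorial_mul_ascFactorial,
      Nat.ascFactorial_eq_prod_range, Nat.cast_mul, Nat.cast_prod]
    congr 1
    refine Finset.prod_congr rfl fun i _ => ?_
    push_cast
    ring
  rw [e, map_mul, mul_comm, ← mul_assoc, ← Complex.normSq_eq_conj_mul_self,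
    Complex.normSq_eq_norm_sq, norm_mulChar_eq_one χ (natCast_factorial_ne_zero hp (by omega))]
  simp

/-- The bound for character sums with factorials. -/
theorem norm_sum_mulChar_factorial_pow_four_le {p : ℕ} [Fact p.Prime] (hp2 : Odd p)
    {χ : MulChar (ZMod p) ℂ} (hχ : χ ≠ 1) {H N : ℕ} (hN : 0 < N) (hHN : H + N < p) :
    ‖∑ n ∈ Finset.Icc (H + 1) (H + N), χ (n.factorial : ZMod p)‖ ^ 4 ≤
      100 * ((N : ℝ) ^ 3 * √p * Real.log p) := by
  classical
  have hp : p.Prime := Fact.out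
  have hp3 : 3 ≤ p := by
    have := hp.two_le
    rcases hp2 with ⟨k, rfl⟩
    omega
  have hL : 1 ≤ Real.log p := by
    rw [Real.le_log_iff_exp_le (by exact_mod_cast hp.pos)]
    have : (3 : ℝ) ≤ p := by exact_mod_cast hp3
    linarith [Real.exp_one_lt_d9]
  have hsp : 1 ≤ √(p : ℝ) := by
    rw [Real.one_le_sqrt]
    exact_mod_cast hp.one_lt.le
  set L := Real.log p with hLdef
  set q := √(p : ℝ) * L with hq
  have hq1 : 1 ≤ q := one_le_mul_of_one_le_of_one_le hsp hL
  have hN1 : (1 : ℝ) ≤ N := by exact_mod_cast hN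
  set s := ‖∑ n ∈ Finset.Icc (H + 1) (H + N), χ (n.factorial : ZMod p)‖ with hs
  have hs0 : 0 ≤ s := norm_nonneg _
  have hsN : s ≤ N := by
    refine (norm_sum_le _ _).trans ?_
    refine (Finset.sum_le_sum fun n _ => DirichletCharacter.norm_le_one χ _).trans ?_
    simp
  rw [mul_assoc, ← hq]
  set x := √(N / q) with hx
  have hx2 : x ^ 2 * q = N := by
    rw [hx, Real.sq_sqrt (by positivity)]
    field_simp
  have hx0 : 0 ≤ x := Real.sqrt_nonneg _
  rcases lt_or_ge x 1 with hx1 | hx1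
  · have hNq : (N : ℝ) ≤ q := by
      rw [← hx2]
      have : x ^ 2 ≤ 1 := pow_le_one₀ hx0 hx1.le
      nlinarith
    calc s ^ 4 ≤ (N : ℝ) ^ 4 := by gcongr
      _ = (N : ℝ) ^ 3 * N := by ring
      _ ≤ (N : ℝ) ^ 3 * q := by gcongr
      _ ≤ _ := by
        have : 0 ≤ (N : ℝ) ^ 3 * q := by positivity
        linarith
  set K := ⌊x⌋₊ with hK
  have hKx : (K : ℝ) ≤ x := Nat.floor_le hx0
  have hK1 : 1 ≤ K := Nat.one_le_floor_iff _ |>.2 hx1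
  have hK2 : x ≤ 2 * K := by
    have h1 := Nat.lt_floor_add_one x
    have h2 : (1 : ℝ) ≤ K := by exact_mod_cast hK1
    linarith
  have hxN : x ≤ N := by
    rw [← hx2]
    nlinarith
  have hKN : K ≤ N := by exact_mod_cast hKx.trans hxN
  let a : ℤ → ℂ := fun n => if n ∈ Finset.Ico ((H : ℤ) + 1) (H + N + 1) then
    χ (n.toNat.factorial : ZMod p) else 0
  have hsum : ∀ f : ℤ → ℂ, ∀ M : ℕ, ∑ n ∈ Finset.Ico ((H : ℤ) + 1) (H + M + 1), f n =
      ∑ n ∈ Finset.Ico (H + 1) (H + M + 1), f (n : ℤ) := by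
    intro f M
    symm
    refine Finset.sum_nbij (fun n : ℕ => (n : ℤ)) ?_ ?_ ?_ fun _ _ => rfl
    · intro n hn
      rw [Finset.mem_Ico] at hn ⊢
      omega
    · intro n _ m _ h
      exact Int.ofNat_inj.1 h
    · intro n hn
      rw [Finset.coe_Ico, Set.mem_Ico] at hn
      refine ⟨n.toNat, ?_, ?_⟩
      · rw [Finset.coe_Ico, Set.mem_Ico]
        omega
      · simp only
        omega
  have hcor : ∀ h : ℕ, 0 < h → h < K → ‖∑ n ∈ Finset.Ico ((H : ℤ) + 1) (H + N + 1),
      a (n + h) * (starRingEnd ℂ) (a n)‖ ≤ K * √p * (2 + L) := by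
    intro h hh hhK
    have e : ∑ n ∈ Finset.Ico ((H : ℤ) + 1) (H + N + 1), a (n + h) * (starRingEnd ℂ) (a n) =
        ∑ n ∈ Finset.Ico (H + 1) (H + (N - h) + 1), χ ((n + h).factorial : ZMod p) *
          (starRingEnd ℂ) (χ (n.factorial : ZMod p)) := by
      rw [hsum]
      symm
      refine Finset.sum_subset_zero_on_sdiff ?_ ?_ ?_
      · intro n hn
        rw [Finset.mem_Ico] at hn ⊢
        omega
      · intro n hn
        rw [Finset.mem_sdiff, Finset.mem_Ico, Finset.mem_Ico] at hn
        have : a (n + h) = 0 := if_neg (by rw [Finset.mem_Ico]; omega)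
        rw [this, zero_mul]
      · intro n hn
        rw [Finset.mem_Ico] at hn
        have e1 : a (n + h) = χ ((n + h).factorial : ZMod p) :=
          if_pos (by rw [Finset.mem_Ico]; omega)
        have e2 : a n = χ (n.factorial : ZMod p) :=
          if_pos (by rw [Finset.mem_Ico]; omega)
        rw [e1, e2]
    rw [e]
    refine (norm_sum_factorial_correlation_le hχ hh (by omega) (by omega)).trans ?_
    gcongr
  have hv := sq_mul_norm_sum_sq_le (a := a) (u := (H : ℤ) + 1) (v := H + N + 1) (N := N) (K := K)
    (by ring) (fun n hn => if_neg hn) (fun n => by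
      simp only [a]
      split_ifs
      · exact DirichletCharacter.norm_le_one χ _
      · simp) (by positivity) hcor
  have hS : ‖∑ n ∈ Finset.Ico ((H : ℤ) + 1) (H + N + 1), a n‖ = s := by
    rw [hsum, hs]
    congr 1
    refine Finset.sum_congr ?_ fun n hn => ?_
    · ext n
      rw [Finset.mem_Ico, Finset.mem_Icc]
      omega
    · rw [Finset.mem_Icc] at hn
      exact if_pos (by rw [Finset.mem_Ico]; omega)
  rw [hS] at hv
  have hK0 : (1 : ℝ) ≤ K := by exact_mod_cast hK1
  have hKN' : (K : ℝ) ≤ N := by exact_mod_cast hKN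
  have h2 : √(p : ℝ) * (2 + L) ≤ 3 * q := by
    rw [hq]
    nlinarith
  have h3 : (K : ℝ) * s ^ 2 ≤ K * (10 * (N * x * q)) := by
    have h4 : (K : ℝ) * (K * s ^ 2) ≤ K * (2 * N * (N + K * (K * (3 * q)))) := by
      calc (K : ℝ) * (K * s ^ 2) = K ^ 2 * s ^ 2 := by ring
        _ ≤ (N + K) * (K * N + K ^ 2 * (K * √p * (2 + L))) := hv
        _ ≤ (N + N) * (K * N + K ^ 2 * (K * (3 * q))) := by
          rw [mul_assoc (K : ℝ) (√p)]
          gcongr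
        _ = _ := by ring
    have h5 := le_of_mul_le_mul_left h4 (by linarith)
    refine h5.trans ?_
    have h6 : (N : ℝ) ≤ 2 * K * x * q := by
      rw [← hx2]
      nlinarith [mul_nonneg hx0 (by linarith : 0 ≤ q)]
    have h7 : (K : ℝ) * (K * (3 * q)) ≤ 3 * (K * x * q) := by
      nlinarith [mul_nonneg (by linarith : (0 : ℝ) ≤ K) (by linarith : 0 ≤ q)]
    nlinarith
  have h8 := le_of_mul_le_mul_left h3 (by linarith)
  calc s ^ 4 = (s ^ 2) ^ 2 := by ring
    _ ≤ (10 * (N * x * q)) ^ 2 := by gcongr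
    _ = 100 * (N ^ 2 * (x ^ 2 * q) * q) := by ring
    _ = _ := by
      rw [hx2]
      ring

open Classical in
theorem sum_sum_mul_inv_mul_le {G : Type*} [CommGroup G] [Fintype G] {φ : ℕ → G} {s : Finset ℕ}
    {d : ℕ} (hφ : ∀ g, (s.filter fun n => n + d ∈ s ∧ φ (n + d) * (φ n)⁻¹ = g).card ≤ d)
    {ρ : G → ℝ} (hρ : ∀ y, 0 ≤ ρ y) :
    ∑ n ∈ s, (if n + d ∈ s then ∑ y, ρ (y * (φ n)⁻¹) * ρ (y * (φ (n + d))⁻¹) else 0) ≤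
      d * (∑ y, ρ y) ^ 2 := by
  have e : ∀ n, ∑ y, ρ (y * (φ n)⁻¹) * ρ (y * (φ (n + d))⁻¹) =
      ∑ z, ρ z * ρ (z * (φ (n + d) * (φ n)⁻¹)) := by
    intro n
    rw [← Equiv.sum_comp (Equiv.mulRight (φ (n + d)))]
    refine Finset.sum_congr rfl fun z _ => ?_
    simp only [Equiv.coe_mulRight, mul_inv_cancel_right]
    rw [mul_comm, mul_assoc]
  have hz : ∀ z, ∑ n ∈ s.filter (fun n => n + d ∈ s), ρ (z * (φ (n + d) * (φ n)⁻¹)) ≤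
      d * ∑ y, ρ y := by
    intro z
    rw [← Finset.sum_fiberwise _ fun n => φ (n + d) * (φ n)⁻¹, Finset.mul_sum,
      ← Equiv.sum_comp (Equiv.mulLeft z) fun y => (d : ℝ) * ρ y]
    refine Finset.sum_le_sum fun g _ => ?_
    rw [Finset.sum_congr rfl (g := fun _ => ρ (z * g)) fun n hn => by
      rw [(Finset.mem_filter.1 hn).2], Finset.sum_const, nsmul_eq_mul, Finset.filter_filter]
    exact mul_le_mul_of_nonneg_right (by exact_mod_cast hφ g) (hρ _)
  rw [← Finset.sum_filter, Finset.sum_congr rfl fun n _ => e n, Finset.sum_comm, sq, ← mul_assoc,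
    Finset.mul_sum]
  refine Finset.sum_le_sum fun z _ => ?_
  rw [← Finset.mul_sum, mul_comm]
  exact mul_le_mul_of_nonneg_right (hz z) (hρ z)

open Classical in
theorem sum_sq_sum_mul_inv_le {G : Type*} [CommGroup G] [Fintype G] {φ : ℕ → G} {u N K : ℕ}
    (hK : 0 < K) (hφ : ∀ d, 0 < d → ∀ g, ((Finset.Ico u (u + N)).filter fun n =>
      n + d ∈ Finset.Ico u (u + N) ∧ φ (n + d) * (φ n)⁻¹ = g).card ≤ d)
    {ρ : G → ℝ} (hρ : ∀ y, 0 ≤ ρ y) :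
    ∑ y, (∑ n ∈ Finset.Ico u (u + N), ρ (y * (φ n)⁻¹)) ^ 2 ≤
      ((N : ℝ) / K + 1) * (N * ∑ y, ρ y ^ 2 + 2 * K ^ 2 * (∑ y, ρ y) ^ 2) := by
  set I := Finset.Ico u (u + N) with hI
  set T : ℕ → ℕ → ℝ := fun n n' => ∑ y, ρ (y * (φ n)⁻¹) * ρ (y * (φ n')⁻¹) with hT
  have hT0 : ∀ n n', 0 ≤ T n n' := fun n n' =>
    Finset.sum_nonneg fun y _ => mul_nonneg (hρ _) (hρ _)
  have hTs : ∀ n n', T n n' = T n' n := fun n n' =>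
    Finset.sum_congr rfl fun y _ => mul_comm _ _
  have hTd : ∀ n, T n n = ∑ y, ρ y ^ 2 := by
    intro n
    rw [← Equiv.sum_comp (Equiv.mulRight (φ n)⁻¹) fun y => ρ y ^ 2]
    exact Finset.sum_congr rfl fun y _ => (sq _).symm
  have hmaps : ∀ n ∈ I, (n - u) / K ∈ Finset.range (N / K + 1) := by
    intro n hn
    rw [hI, Finset.mem_Ico] at hn
    rw [Finset.mem_range, Nat.lt_succ_iff]
    exact Nat.div_le_div_right (by omega)
  have hnear : ∑ n ∈ I, ∑ n' ∈ I, (if n < n' ∧ n' < n + K then T n n' else 0) ≤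
      K ^ 2 * (∑ y, ρ y) ^ 2 := by
    calc _ = ∑ n ∈ I, ∑ n' ∈ I, ∑ d ∈ Finset.Ico 1 K, (if n + d = n' then T n n' else 0) := by
          refine Finset.sum_congr rfl fun n _ => Finset.sum_congr rfl fun n' _ => ?_
          split_ifs with h
          · rw [Finset.sum_eq_single (n' - n)]
            · rw [if_pos (by omega)]
            · intro d _ hd
              rw [if_neg (by omega)]
            · intro h'
              rw [Finset.mem_Ico] at h'
              omega
          · symm
            refine Finset.sum_eq_zero fun d hd => ?_
            rw [Finset.mem_Ico] at hd
            rw [if_neg (by omega)]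
      _ = ∑ d ∈ Finset.Ico 1 K, ∑ n ∈ I, (if n + d ∈ I then T n (n + d) else 0) := by
          rw [Finset.sum_congr rfl fun n _ => Finset.sum_comm, Finset.sum_comm]
          refine Finset.sum_congr rfl fun d _ => Finset.sum_congr rfl fun n _ => ?_
          rw [Finset.sum_ite_eq]
      _ ≤ ∑ d ∈ Finset.Ico 1 K, K * (∑ y, ρ y) ^ 2 := by
          refine Finset.sum_le_sum fun d hd => ?_
          rw [Finset.mem_Ico] at hd
          refine (sum_sum_mul_inv_mul_le (hφ d (by omega)) hρ).trans ?_
          gcongr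
          exact hd.2.le
      _ ≤ _ := by
          rw [Finset.sum_const, Nat.card_Ico, nsmul_eq_mul, sq (K : ℝ), mul_assoc]
          gcongr
          omega
  have hblock : ∑ j ∈ Finset.range (N / K + 1), ∑ n ∈ I.filter (fun n => (n - u) / K = j),
      ∑ n' ∈ I.filter (fun n => (n - u) / K = j), T n n' ≤
        N * ∑ y, ρ y ^ 2 + 2 * K ^ 2 * (∑ y, ρ y) ^ 2 := by
    have e : ∑ j ∈ Finset.range (N / K + 1), ∑ n ∈ I.filter (fun n => (n - u) / K = j),
        ∑ n' ∈ I.filter (fun n => (n - u) / K = j), T n n' =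
        ∑ n ∈ I, ∑ n' ∈ I, if (n' - u) / K = (n - u) / K then T n n' else 0 := by
      rw [← Finset.sum_fiberwise_of_maps_to hmaps]
      refine Finset.sum_congr rfl fun j _ => Finset.sum_congr rfl fun n hn => ?_
      rw [Finset.sum_filter, (Finset.mem_filter.1 hn).2]
    have hpt : ∀ n ∈ I, ∀ n' ∈ I, (if (n' - u) / K = (n - u) / K then T n n' else 0) ≤
        (if n = n' then T n n' else 0) + (if n < n' ∧ n' < n + K then T n n' else 0) +
          (if n' < n ∧ n < n' + K then T n' n else 0) := by
      intro n hn n' hn'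
      rw [hI, Finset.mem_Ico] at hn hn'
      have p1 : 0 ≤ if n = n' then T n n' else 0 := by split_ifs <;> simp [hT0]
      have p2 : 0 ≤ if n < n' ∧ n' < n + K then T n n' else 0 := by split_ifs <;> simp [hT0]
      have p3 : 0 ≤ if n' < n ∧ n < n' + K then T n' n else 0 := by split_ifs <;> simp [hT0]
      split_ifs at p1 p2 p3 ⊢ <;> try first | omega | linarith [hTs n n']
      rename_i h _ _ _
      exfalso
      have h1 := Nat.div_add_mod (n - u) K
      have h2 := Nat.div_add_mod (n' - u) K
      have h3 := Nat.mod_lt (n - u) hK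
      have h4 := Nat.mod_lt (n' - u) hK
      rw [h] at h2
      omega
    rw [e]
    refine (Finset.sum_le_sum fun n hn => Finset.sum_le_sum fun n' hn' => hpt n hn n' hn').trans ?_
    simp only [Finset.sum_add_distrib]
    have h3 : ∑ n ∈ I, ∑ n' ∈ I, (if n' < n ∧ n < n' + K then T n' n else 0) ≤
        K ^ 2 * (∑ y, ρ y) ^ 2 := by
      rw [Finset.sum_comm]
      exact hnear
    have h1 : ∑ n ∈ I, ∑ n' ∈ I, (if n = n' then T n n' else 0) = N * ∑ y, ρ y ^ 2 := by
      rw [Finset.sum_congr rfl fun n hn => by rw [Finset.sum_ite_eq, if_pos hn, hTd],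
        Finset.sum_const, hI, Nat.card_Ico, Nat.add_sub_cancel_left, nsmul_eq_mul]
    linarith
  calc ∑ y, (∑ n ∈ I, ρ (y * (φ n)⁻¹)) ^ 2
      ≤ ∑ y, (((Finset.range (N / K + 1)).card : ℝ) * ∑ j ∈ Finset.range (N / K + 1),
          (∑ n ∈ I.filter (fun n => (n - u) / K = j), ρ (y * (φ n)⁻¹)) ^ 2) := by
        refine Finset.sum_le_sum fun y _ => ?_
        rw [← Finset.sum_fiberwise_of_maps_to hmaps]
        exact sq_sum_le_card_mul_sum_sq
    _ = ((N / K + 1 : ℕ) : ℝ) * ∑ j ∈ Finset.range (N / K + 1),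
          ∑ n ∈ I.filter (fun n => (n - u) / K = j),
            ∑ n' ∈ I.filter (fun n => (n - u) / K = j), T n n' := by
        rw [← Finset.mul_sum, Finset.card_range, Finset.sum_comm]
        congr 1
        refine Finset.sum_congr rfl fun j _ => ?_
        simp only [sq, Finset.sum_mul_sum, hT]
        rw [Finset.sum_comm]
        exact Finset.sum_congr rfl fun n _ => Finset.sum_comm
    _ ≤ ((N : ℝ) / K + 1) * (N * ∑ y, ρ y ^ 2 + 2 * K ^ 2 * (∑ y, ρ y) ^ 2) := by
        refine mul_le_mul ?_ hblock ?_ (by positivity)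
        · push_cast
          gcongr
          exact Nat.cast_div_le
        · exact Finset.sum_nonneg fun j _ => Finset.sum_nonneg fun n _ =>
            Finset.sum_nonneg fun n' _ => hT0 _ _

open Classical in
/-- The number of ways of writing a group element as an ordered product of `r` values of `φ` on `s`. -/
noncomputable def productReps {G : Type*} [CommGroup G] (φ : ℕ → G) (s : Finset ℕ) : ℕ → G → ℝ
  | 0 => fun y => if y = 1 then 1 else 0
  | r + 1 => fun y => ∑ n ∈ s, productReps φ s r (y * (φ n)⁻¹)

theorem productReps_nonneg {G : Type*} [CommGroup G] (φ : ℕ → G) (s : Finset ℕ) (r : ℕ) (y : G) :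
    0 ≤ productReps φ s r y := by
  induction r generalizing y with
  | zero =>
    simp only [productReps]
    split_ifs <;> norm_num
  | succ r ih => exact Finset.sum_nonneg fun n _ => ih _

theorem sum_productReps_mul {G : Type*} [CommGroup G] [Fintype G] (φ : ℕ → G) (s : Finset ℕ)
    (r : ℕ) (χ : G →* ℂ) :
    ∑ y, (productReps φ s r y : ℂ) * χ y = (∑ n ∈ s, χ (φ n)) ^ r := by
  classical
  induction r with
  | zero =>
    rw [Finset.sum_eq_single 1 (fun y _ hy => by simp [productReps, hy]) (by simp)]
    simp [productReps]
  | succ r ih =>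
    simp only [productReps, Complex.ofReal_sum, Finset.sum_mul]
    rw [Finset.sum_comm, pow_succ, Finset.mul_sum]
    refine Finset.sum_congr rfl fun n _ => ?_
    rw [← ih, ← Equiv.sum_comp (Equiv.mulRight (φ n)), Finset.sum_mul]
    refine Finset.sum_congr rfl fun y _ => ?_
    simp [mul_assoc]

theorem sum_productReps {G : Type*} [CommGroup G] [Fintype G] (φ : ℕ → G) (s : Finset ℕ) (r : ℕ) :
    ∑ y, productReps φ s r y = (s.card : ℝ) ^ r := by
  have := sum_productReps_mul φ s r 1
  simp only [MonoidHom.one_apply, mul_one, Finset.sum_const, nsmul_eq_mul] at this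
  exact_mod_cast this

open Classical in
/-- The bound for the number of solutions of the symmetric equation in `2 * r` variables. -/
theorem exists_sum_sq_productReps_le (r : ℕ) : ∃ C : ℝ, 0 < C ∧ ∀ {G : Type} [CommGroup G]
    [Fintype G] {φ : ℕ → G} {u N : ℕ}, 0 < N →
    (∀ d, 0 < d → ∀ g, ((Finset.Ico u (u + N)).filter fun n =>
      n + d ∈ Finset.Ico u (u + N) ∧ φ (n + d) * (φ n)⁻¹ = g).card ≤ d) →
    ∑ y, productReps φ (Finset.Ico u (u + N)) r y ^ 2 ≤
      C * (N : ℝ) ^ (2 * (r : ℝ) - 1 + 2 ^ (-(r : ℝ))) := by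
  induction r with
  | zero =>
    refine ⟨1, one_pos, fun {G} _ _ {φ u N} _ _ => ?_⟩
    simp [productReps]
  | succ r ih =>
    obtain ⟨C, hC, h⟩ := ih
    refine ⟨2 * (C + 8), by positivity, fun {G} _ _ {φ u N} hN hφ => ?_⟩
    have hN1 : (1 : ℝ) ≤ N := by exact_mod_cast hN
    have hN0 : (0 : ℝ) < N := by linarith
    set δ : ℝ := 2 ^ (-(r : ℝ)) with hδ
    have hδ0 : 0 < δ := by positivity
    have hδ1 : δ ≤ 1 := Real.rpow_le_one_of_one_le_of_nonpos one_le_two (by simp)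
    have hδ2 : (2 : ℝ) ^ (-((r + 1 : ℕ) : ℝ)) = δ / 2 := by
      rw [hδ, Nat.cast_add, Nat.cast_one, neg_add, Real.rpow_add two_pos, Real.rpow_neg_one]
      ring
    set x : ℝ := (N : ℝ) ^ (δ / 2) with hx
    have hx1 : 1 ≤ x := Real.one_le_rpow hN1 (by positivity)
    set K := ⌈x⌉₊ with hKdef
    have hK : 0 < K := Nat.ceil_pos.2 (by linarith)
    have hKx : x ≤ K := Nat.le_ceil x
    have hK2 : (K : ℝ) ≤ 2 * x := by
      have := Nat.ceil_lt_add_one (by linarith : 0 ≤ x)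
      linarith
    have hs := sum_sq_sum_mul_inv_le (φ := φ) (u := u) (N := N) hK hφ
      (productReps_nonneg φ (Finset.Ico u (u + N)) r)
    rw [sum_productReps, Nat.card_Ico, Nat.add_sub_cancel_left] at hs
    have hxx : x ^ 2 = (N : ℝ) ^ δ := by
      rw [hx, ← Real.rpow_natCast, ← Real.rpow_mul hN0.le]
      congr 1
      push_cast
      ring
    have hJ : (N : ℝ) / K + 1 ≤ 2 * (N : ℝ) ^ (1 - δ / 2) := by
      have h1 : (N : ℝ) / K ≤ (N : ℝ) ^ (1 - δ / 2) := by
        rw [Real.rpow_sub hN0, Real.rpow_one, ← hx]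
        gcongr
      have h2 : 1 ≤ (N : ℝ) ^ (1 - δ / 2) := Real.one_le_rpow hN1 (by linarith)
      linarith
    have hmain : N * ∑ y, productReps φ (Finset.Ico u (u + N)) r y ^ 2 +
        2 * (K : ℝ) ^ 2 * ((N : ℝ) ^ r) ^ 2 ≤ (C + 8) * (N : ℝ) ^ (2 * (r : ℝ) + δ) := by
      have h1 : N * ∑ y, productReps φ (Finset.Ico u (u + N)) r y ^ 2 ≤
          C * (N : ℝ) ^ (2 * (r : ℝ) + δ) := by
        calc _ ≤ N * (C * (N : ℝ) ^ (2 * (r : ℝ) - 1 + δ)) := by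
              gcongr
              exact h hN hφ
          _ = C * ((N : ℝ) ^ (1 : ℝ) * (N : ℝ) ^ (2 * (r : ℝ) - 1 + δ)) := by
              rw [Real.rpow_one]
              ring
          _ = _ := by
              rw [← Real.rpow_add hN0]
              congr 2
              ring
      have h2 : 2 * (K : ℝ) ^ 2 * ((N : ℝ) ^ r) ^ 2 ≤ 8 * (N : ℝ) ^ (2 * (r : ℝ) + δ) := by
        calc _ ≤ 2 * (2 * x) ^ 2 * ((N : ℝ) ^ r) ^ 2 := by gcongr
          _ = 8 * (((N : ℝ) ^ r) ^ 2 * x ^ 2) := by ring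
          _ = _ := by
              rw [hxx, Real.rpow_add hN0, ← pow_mul, ← Real.rpow_natCast]
              congr 3
              push_cast
              ring
      linarith
    calc _ ≤ ((N : ℝ) / K + 1) * (N * ∑ y, productReps φ (Finset.Ico u (u + N)) r y ^ 2 +
        2 * (K : ℝ) ^ 2 * ((N : ℝ) ^ r) ^ 2) := hs
      _ ≤ (2 * (N : ℝ) ^ (1 - δ / 2)) * ((C + 8) * (N : ℝ) ^ (2 * (r : ℝ) + δ)) := by
          gcongr
      _ = 2 * (C + 8) * ((N : ℝ) ^ (1 - δ / 2) * (N : ℝ) ^ (2 * (r : ℝ) + δ)) := by ring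
      _ = _ := by
          rw [← Real.rpow_add hN0, hδ2]
          congr 2
          push_cast
          ring

/-- The factorial as a unit modulo `p`, with junk value `1` when it is not invertible. -/
noncomputable def factorialUnit (p : ℕ) [Fact p.Prime] (n : ℕ) : (ZMod p)ˣ :=
  if h : (n.factorial : ZMod p) ≠ 0 then Units.mk0 _ h else 1

theorem coe_factorialUnit {p : ℕ} [Fact p.Prime] {n : ℕ} (h : n < p) :
    (factorialUnit p n : ZMod p) = n.factorial := by
  rw [factorialUnit, dif_pos (natCast_factorial_ne_zero Fact.out h), Units.val_mk0]

open Classical in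
theorem card_filter_factorialUnit_le {p : ℕ} [Fact p.Prime] {u N : ℕ} (hN : u + N ≤ p) {d : ℕ}
    (hd : 0 < d) (g : (ZMod p)ˣ) :
    ((Finset.Ico u (u + N)).filter fun n => n + d ∈ Finset.Ico u (u + N) ∧
      factorialUnit p (n + d) * (factorialUnit p n)⁻¹ = g).card ≤ d := by
  set Q : (ZMod p)[X] := ∏ i ∈ Finset.range d, (X + C ((i + 1 : ℕ) : ZMod p)) with hQ
  have hQm : Q.Monic := monic_prod_of_monic _ _ fun i _ => monic_X_add_C _
  have hQd : Q.natDegree = d := by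
    rw [hQ, natDegree_prod_of_monic _ _ fun i _ => monic_X_add_C _]
    simp only [natDegree_X_add_C, Finset.sum_const, Finset.card_range, smul_eq_mul, mul_one]
  have hd' : (Q - C (g : ZMod p)).natDegree = d := by rw [natDegree_sub_C, hQd]
  have h0 : Q - C (g : ZMod p) ≠ 0 := by
    intro h
    rw [h, natDegree_zero] at hd'
    omega
  refine le_trans ?_ ((Multiset.toFinset_card_le (Q - C (g : ZMod p)).roots).trans
    ((card_roots' _).trans hd'.le))
  refine Finset.card_le_card_of_injOn (fun n => (n : ZMod p)) ?_ ?_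
  · intro n hn
    rw [Finset.mem_coe, Finset.mem_filter, Finset.mem_Ico, Finset.mem_Ico] at hn
    rw [Finset.mem_coe, Multiset.mem_toFinset, mem_roots h0, IsRoot.def, eval_sub, eval_C,
      sub_eq_zero]
    have h1 := congrArg (fun x : (ZMod p)ˣ => (x : ZMod p)) (mul_inv_eq_iff_eq_mul.1 hn.2.2)
    simp only [Units.val_mul] at h1
    rw [coe_factorialUnit (by omega), coe_factorialUnit (by omega),
      ← Nat.factorial_mul_ascFactorial, Nat.cast_mul, mul_comm] at h1
    have h2 := mul_right_cancel₀ (natCast_factorial_ne_zero Fact.out (by omega)) h1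
    rw [← h2, Nat.ascFactorial_eq_prod_range, hQ, eval_prod, Nat.cast_prod]
    refine Finset.prod_congr rfl fun i _ => ?_
    rw [eval_add, eval_X, eval_C]
    push_cast
    ring
  · intro n hn m hm h
    rw [Finset.mem_coe, Finset.mem_filter, Finset.mem_Ico] at hn hm
    simp only at h
    rw [ZMod.natCast_eq_natCast_iff, Nat.ModEq, Nat.mod_eq_of_lt (by omega),
      Nat.mod_eq_of_lt (by omega)] at h
    exact h

theorem conj_mulChar_units {p : ℕ} [Fact p.Prime] (χ : MulChar (ZMod p) ℂ) (y : (ZMod p)ˣ) :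
    (starRingEnd ℂ) (χ y) = χ ((y : ZMod p)⁻¹) := by
  have h1 : ‖χ y‖ = 1 := norm_mulChar_eq_one χ y.ne_zero
  rw [← Complex.inv_eq_conj h1]
  refine inv_eq_of_mul_eq_one_left ?_
  rw [← map_mul, inv_mul_cancel₀ y.ne_zero, map_one]

theorem sum_norm_sum_mulChar_pow {p : ℕ} [Fact p.Prime] {H N : ℕ} (hHN : H + N < p) (r : ℕ) :
    ∑ χ : DirichletCharacter ℂ p,
      ‖∑ n ∈ Finset.Icc (H + 1) (H + N), χ (n.factorial : ZMod p)‖ ^ (2 * r) =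
      ((p : ℝ) - 1) *
        ∑ y, productReps (factorialUnit p) (Finset.Ico (H + 1) (H + 1 + N)) r y ^ 2 := by
  classical
  have hp : p.Prime := Fact.out
  set ρ := productReps (factorialUnit p) (Finset.Ico (H + 1) (H + 1 + N)) r with hρ
  have hI : Finset.Icc (H + 1) (H + N) = Finset.Ico (H + 1) (H + 1 + N) := by
    ext n
    rw [Finset.mem_Icc, Finset.mem_Ico]
    omega
  have h1 : ∀ χ : DirichletCharacter ℂ p,
      (∑ n ∈ Finset.Icc (H + 1) (H + N), χ (n.factorial : ZMod p)) ^ r =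
        ∑ y : (ZMod p)ˣ, (ρ y : ℂ) * χ y := by
    intro χ
    rw [hI]
    have := sum_productReps_mul (factorialUnit p) (Finset.Ico (H + 1) (H + 1 + N)) r
      (χ.toMonoidHom.comp (Units.coeHom _))
    refine Eq.trans ?_ this.symm
    congr 1
    refine Finset.sum_congr rfl fun n hn => ?_
    rw [Finset.mem_Ico] at hn
    rw [← coe_factorialUnit (by omega)]
    rfl
  have h2 : ((∑ χ : DirichletCharacter ℂ p,
      ‖∑ n ∈ Finset.Icc (H + 1) (H + N), χ (n.factorial : ZMod p)‖ ^ (2 * r) : ℝ) : ℂ) =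
      ∑ y : (ZMod p)ˣ, ∑ y' : (ZMod p)ˣ, (ρ y : ℂ) * ρ y' *
        ∑ χ : DirichletCharacter ℂ p, χ ((y' : ZMod p)⁻¹) * χ (y : ZMod p) := by
    simp only [Finset.mul_sum]
    rw [Finset.sum_congr rfl fun y _ => Finset.sum_comm, Finset.sum_comm, Complex.ofReal_sum]
    refine Finset.sum_congr rfl fun χ _ => ?_
    rw [mul_comm 2 r, pow_mul, ← norm_pow, h1, Complex.ofReal_pow, ← Complex.mul_conj', map_sum,
      Finset.sum_mul_sum]
    refine Finset.sum_congr rfl fun y _ => Finset.sum_congr rfl fun y' _ => ?_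
    rw [map_mul, Complex.conj_ofReal, conj_mulChar_units]
    ring
  have h3 : ∀ y y' : (ZMod p)ˣ,
      ∑ χ : DirichletCharacter ℂ p, χ ((y' : ZMod p)⁻¹) * χ (y : ZMod p) =
        if y' = y then ((p - 1 : ℕ) : ℂ) else 0 := by
    intro y y'
    rw [DirichletCharacter.sum_char_inv_mul_char_eq ℂ y'.isUnit, Nat.totient_prime hp]
    simp only [Units.val_inj]
  rw [← Complex.ofReal_inj, h2]
  simp only [h3, mul_ite, mul_zero, Finset.sum_ite_eq', Finset.mem_univ, if_true]
  push_cast [Nat.cast_sub hp.one_lt.le]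
  rw [Finset.mul_sum]
  refine Finset.sum_congr rfl fun y _ => ?_
  ring

theorem sub_one_mul_card_filter_prod_eq {p : ℕ} [Fact p.Prime] {ℓ : ℕ} (s : Finset ℕ) {a : ZMod p}
    (ha : a ≠ 0) :
    ((p : ℂ) - 1) * (((Fintype.piFinset fun _ : Fin ℓ => s).filter
      fun n => (∏ i, ((n i).factorial : ZMod p)) = a).card : ℂ) =
      ∑ χ : DirichletCharacter ℂ p, χ a⁻¹ * (∑ n ∈ s, χ (n.factorial : ZMod p)) ^ ℓ := by
  classical
  have hp : p.Prime := Fact.out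
  have h1 : ∀ χ : DirichletCharacter ℂ p, (∑ n ∈ s, χ (n.factorial : ZMod p)) ^ ℓ =
      ∑ n ∈ Fintype.piFinset fun _ : Fin ℓ => s, χ (∏ i, ((n i).factorial : ZMod p)) := by
    intro χ
    rw [← Fin.prod_const, Finset.prod_univ_sum]
    exact Finset.sum_congr rfl fun n _ => (map_prod χ _ _).symm
  simp only [h1, Finset.mul_sum]
  rw [Finset.sum_comm, Finset.sum_congr rfl fun n _ =>
    DirichletCharacter.sum_char_inv_mul_char_eq ℂ ha.isUnit _, Nat.totient_prime hp,
    ← Finset.sum_filter, Finset.sum_const, nsmul_eq_mul, Nat.cast_sub hp.one_lt.le, Nat.cast_one,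
    mul_comm]
  congr 3
  ext n
  simp only [Finset.mem_filter, eq_comm]

theorem abs_card_filter_prod_factorial_sub_le {p : ℕ} [Fact p.Prime] {ℓ r : ℕ} (hℓr : 2 * r ≤ ℓ)
    {H N : ℕ} (hHN : H + N < p) {a : ZMod p} (ha : a ≠ 0) {M : ℝ} (hM0 : 0 ≤ M)
    (hM : ∀ χ : DirichletCharacter ℂ p, χ ≠ 1 →
      ‖∑ n ∈ Finset.Icc (H + 1) (H + N), χ (n.factorial : ZMod p)‖ ≤ M) :
    |((((Fintype.piFinset fun _ : Fin ℓ => Finset.Icc (H + 1) (H + N))).filter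
            fun n => (∏ i, ((n i).factorial : ZMod p)) = a).card : ℝ) -
            (N : ℝ) ^ ℓ / ((p : ℝ) - 1)| ≤
      M ^ (ℓ - 2 * r) *
        ∑ y, productReps (factorialUnit p) (Finset.Ico (H + 1) (H + 1 + N)) r y ^ 2 := by
  classical
  have hp : p.Prime := Fact.out
  have hp1 : (0 : ℝ) < (p : ℝ) - 1 := by
    rw [sub_pos]
    exact_mod_cast hp.one_lt
  set F : ℝ := ((((Fintype.piFinset fun _ : Fin ℓ => Finset.Icc (H + 1) (H + N))).filter
            fun n => (∏ i, ((n i).factorial : ZMod p)) = a).card : ℝ) with hF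
  set S : DirichletCharacter ℂ p → ℂ :=
    fun χ => ∑ n ∈ Finset.Icc (H + 1) (H + N), χ (n.factorial : ZMod p) with hS
  have h := sub_one_mul_card_filter_prod_eq (ℓ := ℓ) (Finset.Icc (H + 1) (H + N)) ha
  rw [← Finset.add_sum_erase _ _ (Finset.mem_univ (1 : DirichletCharacter ℂ p))] at h
  have hS1 : S 1 = N := by
    simp only [hS]
    rw [Finset.sum_congr rfl fun n hn => MulChar.one_apply
      (natCast_factorial_ne_zero hp (by rw [Finset.mem_Icc] at hn; omega)).isUnit]
    simp
  have h1 : (((p : ℝ) - 1 : ℝ) : ℂ) * ((F - (N : ℝ) ^ ℓ / ((p : ℝ) - 1) : ℝ) : ℂ) =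
      ∑ χ ∈ Finset.univ.erase (1 : DirichletCharacter ℂ p), χ a⁻¹ * S χ ^ ℓ := by
    rw [← Complex.ofReal_mul, mul_sub, mul_div_cancel₀ _ hp1.ne', hF]
    push_cast
    rw [h, MulChar.one_apply (inv_ne_zero ha).isUnit, one_mul]
    change S 1 ^ ℓ + _ - _ = _
    rw [hS1, add_sub_cancel_left]
  have h2 : ((p : ℝ) - 1) * |F - (N : ℝ) ^ ℓ / ((p : ℝ) - 1)| ≤
      M ^ (ℓ - 2 * r) * ∑ χ : DirichletCharacter ℂ p, ‖S χ‖ ^ (2 * r) := by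
    calc _ = ‖(((p : ℝ) - 1 : ℝ) : ℂ) * ((F - (N : ℝ) ^ ℓ / ((p : ℝ) - 1) : ℝ) : ℂ)‖ := by
          rw [norm_mul, Complex.norm_real, Complex.norm_real, Real.norm_eq_abs, Real.norm_eq_abs,
            abs_of_pos hp1]
      _ ≤ ∑ χ ∈ Finset.univ.erase (1 : DirichletCharacter ℂ p),
            M ^ (ℓ - 2 * r) * ‖S χ‖ ^ (2 * r) := by
          rw [h1]
          refine (norm_sum_le _ _).trans (Finset.sum_le_sum fun χ hχ => ?_)
          rw [norm_mul, norm_pow]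
          calc _ ≤ 1 * ‖S χ‖ ^ ℓ := by
                gcongr
                exact DirichletCharacter.norm_le_one χ _
            _ = ‖S χ‖ ^ (ℓ - 2 * r) * ‖S χ‖ ^ (2 * r) := by
                rw [one_mul, ← pow_add, Nat.sub_add_cancel hℓr]
            _ ≤ _ := by
                gcongr
                exact hM χ (Finset.ne_of_mem_erase hχ)
      _ = M ^ (ℓ - 2 * r) * ∑ χ ∈ Finset.univ.erase (1 : DirichletCharacter ℂ p),
            ‖S χ‖ ^ (2 * r) := by rw [Finset.mul_sum]
      _ ≤ _ := by
          gcongr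
          exact Finset.erase_subset _ _
  rw [sum_norm_sum_mulChar_pow hHN] at h2
  refine le_of_mul_le_mul_left (h2.trans (le_of_eq ?_)) hp1
  ring

end

/-- Theorem 7 (asymptotic formula for `F_ℓ(a,H,N)`): for fixed `ℓ ≥ 2r ≥ 1`,
uniformly in `a ≢ 0 (mod p)`, the number of `ℓ`-tuples with
`H+1 ≤ n_i ≤ H+N` and `n_1! ⋯ n_ℓ! ≡ a (mod p)` satisfies
`|F_ℓ(a,H,N) - N^ℓ/(p-1)| ≤ C N^{3ℓ/4 + r/2 - 1 + 2^{-r}} p^{(ℓ-2r)/8} (log p)^{(ℓ-2r)/4}`. -/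
theorem count_factorial_product_representations (ℓ r : ℕ) (hr : 1 ≤ r) (hℓr : 2 * r ≤ ℓ) :
    ∃ C : ℝ, 0 < C ∧ ∀ p : ℕ, p.Prime → Odd p →
      ∀ H N : ℕ, 0 < N → H + N < p →
      ∀ a : ZMod p, a ≠ 0 →
        |((((Fintype.piFinset fun _ : Fin ℓ => Finset.Icc (H + 1) (H + N))).filter
            fun n => (∏ i, ((n i).factorial : ZMod p)) = a).card : ℝ) -
            (N : ℝ) ^ ℓ / ((p : ℝ) - 1)| ≤
          C * (N : ℝ) ^ (3 * (ℓ : ℝ) / 4 + (r : ℝ) / 2 - 1 + 2 ^ (-(r : ℝ))) *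
            (p : ℝ) ^ (((ℓ : ℝ) - 2 * r) / 8) * (Real.log p) ^ (((ℓ : ℝ) - 2 * r) / 4) := by
  classical
  obtain ⟨C, hC0, hC⟩ := exists_sum_sq_productReps_le r
  refine ⟨100 ^ (((ℓ : ℝ) - 2 * r) / 4) * C, by positivity, ?_⟩
  intro p hp hp2 H N hN hHN a ha
  have : Fact p.Prime := ⟨hp⟩
  have hlog : 0 ≤ Real.log p := Real.log_natCast_nonneg p
  have hN0 : (0 : ℝ) < N := by exact_mod_cast hN
  set K : ℝ := 100 * ((N : ℝ) ^ 3 * √p * Real.log p) with hK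
  have hK0 : 0 ≤ K := by positivity
  have hM : ∀ χ : DirichletCharacter ℂ p, χ ≠ 1 →
      ‖∑ n ∈ Finset.Icc (H + 1) (H + N), χ (n.factorial : ZMod p)‖ ≤ K ^ (1 / 4 : ℝ) := by
    intro χ hχ
    refine le_of_pow_le_pow_left₀ four_ne_zero (Real.rpow_nonneg hK0 _) ?_
    rw [← Real.rpow_mul_natCast hK0]
    norm_num
    exact norm_sum_mulChar_factorial_pow_four_le hp2 hχ hN hHN
  have hpow : (K ^ (1 / 4 : ℝ)) ^ (ℓ - 2 * r) =
      100 ^ (((ℓ : ℝ) - 2 * r) / 4) * (N : ℝ) ^ (3 * ((ℓ : ℝ) - 2 * r) / 4) *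
        (p : ℝ) ^ (((ℓ : ℝ) - 2 * r) / 8) * (Real.log p) ^ (((ℓ : ℝ) - 2 * r) / 4) := by
    rw [← Real.rpow_mul_natCast hK0, Nat.cast_sub hℓr, hK, Real.sqrt_eq_rpow,
      ← Real.rpow_natCast (N : ℝ) 3, Real.mul_rpow (by positivity) (by positivity),
      Real.mul_rpow (by positivity) hlog, Real.mul_rpow (by positivity) (by positivity),
      ← Real.rpow_mul hN0.le, ← Real.rpow_mul (Nat.cast_nonneg p)]
    push_cast
    ring_nf
  have hrep := hC (G := (ZMod p)ˣ) (φ := factorialUnit p) (u := H + 1) hN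
    fun d hd g => by
      convert card_filter_factorialUnit_le (u := H + 1) (N := N) (by omega) hd g
  have hexp : (N : ℝ) ^ (3 * (ℓ : ℝ) / 4 + (r : ℝ) / 2 - 1 + 2 ^ (-(r : ℝ))) =
      (N : ℝ) ^ (3 * ((ℓ : ℝ) - 2 * r) / 4) * (N : ℝ) ^ (2 * (r : ℝ) - 1 + 2 ^ (-(r : ℝ))) := by
    rw [← Real.rpow_add hN0]
    ring_nf
  calc _ ≤ (K ^ (1 / 4 : ℝ)) ^ (ℓ - 2 * r) *
        ∑ y, productReps (factorialUnit p) (Finset.Ico (H + 1) (H + 1 + N)) r y ^ 2 := by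
        convert abs_card_filter_prod_factorial_sub_le hℓr hHN ha (Real.rpow_nonneg hK0 _) hM
    _ ≤ (K ^ (1 / 4 : ℝ)) ^ (ℓ - 2 * r) *
        (C * (N : ℝ) ^ (2 * (r : ℝ) - 1 + 2 ^ (-(r : ℝ)))) := by gcongr
    _ = _ := by
        rw [hpow, hexp]
        ring
end
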